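/- There exist constants C > 0 and T_0 > 0 such that for every T ≥ T_0 and every real H with (ln ln T)/ln T < H < T^(1/ln ln T), setting U_0 = T^(0.5001), the Hardy–Littlewood formula | ∫_T^{T+U_0} ( ∫_t^{t+H} Z(u) du )² dt − 2π·H·U_0 | ≤ C·U_0/ln T holds. -/

import Mathlib

/-- The Riemann–Siegel theta function. -/
noncomputable def RSTheta (t : ℝ) : ℝ :=
  (Complex.log (Complex.Gamma (1 / 4 + Complex.I * t / 2))).im - t / 2 * Real.log Real.pi

/-- Hardy's Z-function, which is real-valued on `ℝ` (taken via the real part). -/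
noncomputable def HardyZ (t : ℝ) : ℝ :=
  (Complex.exp (Complex.I * RSTheta t) * riemannZeta (1 / 2 + Complex.I * t)).re

section
open Complex Filter Topology

namespace HL

/-- The phase factor `exp (i θ(t))`. -/
noncomputable def G (t : ℝ) : ℂ := Complex.exp (I * RSTheta t)

/-- The leading part of theta. -/
noncomputable def P (t : ℝ) : ℝ := t / 2 * Real.log (t / (2 * Real.pi)) - t / 2

/-- The finite approximations of theta. -/
noncomputable def thn (n : ℕ) (t : ℝ) : ℝ :=
  t / 2 * Real.log n - ∑ j ∈ Finset.range (n + 1), Real.arctan (t / 2 / (j + 1 / 4))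
    - t / 2 * Real.log Real.pi

lemma norm_G (t : ℝ) : ‖G t‖ = 1 := by
  unfold G; rw [mul_comm]; exact Complex.norm_exp_ofReal_mul_I _

lemma gam_ne (t : ℝ) : Complex.Gamma (1 / 4 + I * t / 2) ≠ 0 := by
  apply Complex.Gamma_ne_zero_of_re_pos
  simp

lemma G_eq (t : ℝ) : G t = Complex.Gamma (1 / 4 + I * t / 2) / ‖Complex.Gamma (1 / 4 + I * t / 2)‖
    * Complex.exp (-I * (t / 2 * Real.log Real.pi : ℝ)) := by
  have h0 := gam_ne t
  unfold G RSTheta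
  set z := Complex.Gamma (1 / 4 + I * t / 2)
  rw [Complex.log_im]
  have h1 : z / ‖z‖ = Complex.exp (I * z.arg) := by
    have := Complex.norm_mul_exp_arg_mul_I z
    have hz : (‖z‖ : ℂ) ≠ 0 := by simpa using h0
    rw [div_eq_iff hz, mul_comm I]
    rw [mul_comm]; exact this.symm
  rw [h1, ← Complex.exp_add]
  congr 1
  push_cast; ring

lemma phase_pt (x b : ℝ) (hb : 0 < b) :
    ((b : ℂ) + I * x) = ‖(b : ℂ) + I * x‖ * Complex.exp (I * Real.arctan (x / b)) := by
  have hn : ‖(b : ℂ) + I * x‖ = b * √(1 + (x / b) ^ 2) := by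
    have : (b : ℂ) + I * x = (b : ℂ) + x * I := by ring
    rw [this, Complex.norm_add_mul_I]
    rw [show b ^ 2 + x ^ 2 = b ^ 2 * (1 + (x / b) ^ 2) by field_simp]
    rw [Real.sqrt_mul (by positivity), Real.sqrt_sq hb.le]
  have hs : 0 < √(1 + (x / b) ^ 2) := by positivity
  rw [hn, mul_comm I (Real.arctan (x / b) : ℂ), Complex.exp_mul_I, ← Complex.ofReal_cos,
    ← Complex.ofReal_sin, Real.cos_arctan, Real.sin_arctan]
  have h2 : ((√(1 + (x / b) ^ 2) : ℝ) : ℂ) ≠ 0 := by exact_mod_cast hs.ne'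
  have hb' : (b : ℂ) ≠ 0 := by exact_mod_cast hb.ne'
  set q : ℝ := √(1 + (x / b) ^ 2)
  push_cast
  field_simp

lemma gammaSeq_phase (t : ℝ) (n : ℕ) (hn : 1 ≤ n) :
    Complex.GammaSeq (1 / 4 + I * t / 2) n / ‖Complex.GammaSeq (1 / 4 + I * t / 2) n‖ =
      Complex.exp (I * (t / 2 * Real.log n -
        ∑ j ∈ Finset.range (n + 1), Real.arctan (t / 2 / (j + 1 / 4)) : ℝ)) := by
  have hn0 : (0 : ℝ) < n := by exact_mod_cast hn
  have key : Complex.GammaSeq (1 / 4 + I * t / 2) n =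
      ((n : ℝ) ^ (1 / 4 : ℝ) * (n.factorial : ℝ) /
        ∏ j ∈ Finset.range (n + 1), ‖(((j : ℝ) + 1 / 4 : ℝ) : ℂ) + I * (t / 2 : ℝ)‖ : ℝ) *
      Complex.exp (I * (t / 2 * Real.log n -
        ∑ j ∈ Finset.range (n + 1), Real.arctan (t / 2 / (j + 1 / 4)) : ℝ)) := by
    unfold Complex.GammaSeq
    have h1 : (n : ℂ) ^ (1 / 4 + I * t / 2) = ((n : ℝ) ^ (1 / 4 : ℝ) : ℝ) *
        Complex.exp (I * (t / 2 * Real.log n : ℝ)) := by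
      have hn' : (n : ℂ) ≠ 0 := by exact_mod_cast hn0.ne'
      rw [Complex.cpow_add _ _ hn', Complex.ofReal_cpow hn0.le]
      congr 1
      · push_cast; rfl
      · rw [Complex.cpow_def_of_ne_zero hn']
        congr 1
        rw [Complex.natCast_log.symm]
        push_cast; ring
    have h2 : ∏ j ∈ Finset.range (n + 1), ((1 / 4 + I * t / 2 : ℂ) + j) =
        (∏ j ∈ Finset.range (n + 1), ‖(((j : ℝ) + 1 / 4 : ℝ) : ℂ) + I * (t / 2 : ℝ)‖ : ℝ) *
        Complex.exp (I * (∑ j ∈ Finset.range (n + 1), Real.arctan (t / 2 / (j + 1 / 4)) : ℝ)) := by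
      push_cast
      rw [Finset.mul_sum, Complex.exp_sum, ← Finset.prod_mul_distrib]
      apply Finset.prod_congr rfl
      intro j _
      have := phase_pt (t / 2) (j + 1 / 4) (by positivity)
      push_cast at this
      rw [← this]; ring
    rw [h1, h2]
    rw [Complex.ofReal_sub, mul_sub, Complex.exp_sub]
    generalize (∏ j ∈ Finset.range (n + 1), ‖(((j : ℝ) + 1 / 4 : ℝ) : ℂ) + I * (t / 2 : ℝ)‖) = p
    generalize ((n : ℝ) ^ (1 / 4 : ℝ)) = q
    push_cast
    generalize Complex.exp (I * ((t : ℂ) / 2 * _)) = e1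
    generalize Complex.exp (I * _) = e2
    rw [div_mul_div_comm]
    congr 1
    ring
  set R : ℝ := ((n : ℝ) ^ (1 / 4 : ℝ) * (n.factorial : ℝ) /
        ∏ j ∈ Finset.range (n + 1), ‖(((j : ℝ) + 1 / 4 : ℝ) : ℂ) + I * (t / 2 : ℝ)‖ : ℝ) with hR
  have hRpos : 0 < R := by
    rw [hR]
    apply div_pos (mul_pos (Real.rpow_pos_of_pos hn0 _) (by positivity))
    apply Finset.prod_pos
    intro j _
    rw [norm_pos_iff]
    intro h
    have := congrArg Complex.re h
    simp at this
    have : (0 : ℝ) < j + 4⁻¹ := by positivity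
    linarith
  rw [key, norm_mul, Complex.norm_exp_I_mul_ofReal, mul_one, Complex.norm_real,
    Real.norm_of_nonneg hRpos.le]
  have : (R : ℂ) ≠ 0 := by exact_mod_cast hRpos.ne'
  exact mul_div_cancel_left₀ _ this

lemma tendsto_thn (t : ℝ) :
    Tendsto (fun n : ℕ => Complex.exp (I * thn n t)) atTop (𝓝 (G t)) := by
  rw [G_eq]
  have h1 := Complex.GammaSeq_tendsto_Gamma (1 / 4 + I * t / 2)
  have h2 : Tendsto (fun n : ℕ => Complex.GammaSeq (1 / 4 + I * t / 2) n /
      ‖Complex.GammaSeq (1 / 4 + I * t / 2) n‖ * Complex.exp (-I * (t / 2 * Real.log Real.pi : ℝ)))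
      atTop (𝓝 (Complex.Gamma (1 / 4 + I * t / 2) / ‖Complex.Gamma (1 / 4 + I * t / 2)‖
    * Complex.exp (-I * (t / 2 * Real.log Real.pi : ℝ)))) := by
    apply Tendsto.mul_const
    apply Tendsto.div h1
    · exact (Complex.continuous_ofReal.tendsto _).comp h1.norm
    · simpa using gam_ne t
  refine h2.congr' ?_
  filter_upwards [eventually_ge_atTop 1] with n hn
  rw [gammaSeq_phase t n hn, ← Complex.exp_add]
  congr 1
  unfold thn
  push_cast; ring

/-- telescoping comparison -/
lemma sum_compare (τ : ℝ) (hτ : 2 ≤ τ) (n : ℕ) :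
    |∑ j ∈ Finset.range (n + 1), ((j : ℝ) + 1 / 4) / (((j : ℝ) + 1 / 4) ^ 2 + τ ^ 2) -
      (1 / 2 * Real.log (((n : ℝ) + 1) ^ 2 + τ ^ 2) - Real.log τ)| ≤ 4 / τ := by
  have hτ0 : 0 < τ := by linarith
  set Φ : ℝ → ℝ := fun x => 1 / 2 * Real.log (x ^ 2 + τ ^ 2) with hΦ
  set f : ℝ → ℝ := fun x => x / (x ^ 2 + τ ^ 2) with hf
  have hΦd : ∀ x, HasDerivAt Φ (f x) x := by
    intro x
    have h1 : HasDerivAt (fun x : ℝ => x ^ 2 + τ ^ 2) (2 * x) x := by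
      simpa using (hasDerivAt_pow 2 x).add_const (τ ^ 2)
    have h2 := (h1.log (by positivity)).const_mul (1 / 2 : ℝ)
    exact h2.congr_deriv (by simp only [hf]; field_simp)
  have hfd : ∀ x, HasDerivAt f ((τ ^ 2 - x ^ 2) / (x ^ 2 + τ ^ 2) ^ 2) x := by
    intro x
    have h1 : HasDerivAt (fun x : ℝ => x ^ 2 + τ ^ 2) (2 * x) x := by
      simpa using (hasDerivAt_pow 2 x).add_const (τ ^ 2)
    have h2 := (hasDerivAt_id x).div h1 (by positivity)
    exact h2.congr_deriv (by simp only [id]; ring)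
  -- each difference
  have step : ∀ j : ℕ, |f (j + 1 / 4) - (Φ (j + 1) - Φ j)| ≤ 2 * (1 / (j + τ - 1) - 1 / (j + τ)) := by
    intro j
    have hj : (0 : ℝ) ≤ j := by positivity
    obtain ⟨c, hc, hc'⟩ := exists_hasDerivAt_eq_slope Φ f (show (j : ℝ) < j + 1 by linarith)
      (fun x _ => (hΦd x).continuousAt.continuousWithinAt) (fun x _ => hΦd x)
    have e1 : Φ (j + 1) - Φ j = f c := by rw [hc']; simp
    rw [e1]
    have hM : ∀ x ∈ Set.Icc (j : ℝ) (j + 1), ‖(τ ^ 2 - x ^ 2) / (x ^ 2 + τ ^ 2) ^ 2‖ ≤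
        2 / (j + τ) ^ 2 := by
      intro x hx
      rw [Real.norm_eq_abs, abs_div, abs_of_pos (a := (x ^ 2 + τ ^ 2) ^ 2) (by positivity)]
      have hx0 : 0 ≤ x := hj.trans hx.1
      calc |τ ^ 2 - x ^ 2| / (x ^ 2 + τ ^ 2) ^ 2 ≤ (x ^ 2 + τ ^ 2) / (x ^ 2 + τ ^ 2) ^ 2 := by
            gcongr
            rw [abs_le]; constructor <;> nlinarith [sq_nonneg x, sq_nonneg τ]
        _ = 1 / (x ^ 2 + τ ^ 2) := by field_simp
        _ ≤ 2 / (j + τ) ^ 2 := by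
            rw [div_le_div_iff₀ (by positivity) (by positivity)]
            nlinarith [sq_nonneg (x - τ), hx.1]
    have h3 := Convex.norm_image_sub_le_of_norm_hasDerivWithin_le (s := Set.Icc (j : ℝ) (j + 1))
      (fun x _ => (hfd x).hasDerivWithinAt) hM (convex_Icc _ _)
      (x := c) (y := j + 1 / 4) ⟨hc.1.le, hc.2.le⟩ ⟨by linarith, by linarith⟩
    rw [Real.norm_eq_abs] at h3
    refine h3.trans ?_
    have h4 : ‖(j : ℝ) + 1 / 4 - c‖ ≤ 1 := by
      rw [Real.norm_eq_abs, abs_le]; constructor <;> linarith [hc.1, hc.2]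
    have h5 : 2 / ((j : ℝ) + τ) ^ 2 ≤ 2 * (1 / (j + τ - 1) - 1 / (j + τ)) := by
      have a1 : 0 < (j : ℝ) + τ - 1 := by linarith
      have a2 : 0 < (j : ℝ) + τ := by linarith
      rw [div_sub_div _ _ a1.ne' a2.ne', ← mul_div_assoc, div_le_div_iff₀ (by positivity) (by positivity)]
      nlinarith
    calc _ ≤ 2 / ((j : ℝ) + τ) ^ 2 * 1 := by gcongr
      _ ≤ _ := by rw [mul_one]; exact h5
  have tel : (1 / 2 * Real.log (((n : ℝ) + 1) ^ 2 + τ ^ 2) - Real.log τ) =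
      ∑ j ∈ Finset.range (n + 1), (Φ (j + 1) - Φ j) := by
    have := Finset.sum_range_sub (fun j : ℕ => Φ j) (n + 1)
    push_cast at this
    rw [this, hΦ]
    simp [Real.log_pow]
  rw [tel, ← Finset.sum_sub_distrib]
  refine (Finset.abs_sum_le_sum_abs _ _).trans ?_
  refine (Finset.sum_le_sum (fun j _ => step j)).trans ?_
  rw [← Finset.mul_sum]
  have tel2 : ∑ j ∈ Finset.range (n + 1), (1 / ((j : ℝ) + τ - 1) - 1 / (j + τ)) =
      1 / (τ - 1) - 1 / ((n : ℝ) + τ) := by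
    have := Finset.sum_range_sub' (fun j : ℕ => 1 / ((j : ℝ) + τ - 1)) (n + 1)
    push_cast at this
    rw [zero_add] at this
    convert this using 2
    · congr 2; ring
    · congr 1; ring
  rw [tel2]
  have : 0 ≤ 1 / ((n : ℝ) + τ) := by positivity
  have h7 : 1 / (τ - 1) ≤ 2 / τ := by
    rw [div_le_div_iff₀ (by linarith) hτ0]; linarith
  have : 4 / τ = 2 * (2 / τ) := by ring
  rw [this]; gcongr; linarith

lemma hasDerivAt_P (t : ℝ) (ht : 0 < t) : HasDerivAt P (1 / 2 * Real.log (t / (2 * Real.pi))) t := by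
  unfold P
  have h1 : HasDerivAt (fun t : ℝ => t / (2 * Real.pi)) (1 / (2 * Real.pi)) t :=
    (hasDerivAt_id t).div_const _
  have h2 := h1.log (by positivity)
  have h3 := ((hasDerivAt_id t).div_const 2).mul h2
  have h4 := h3.sub ((hasDerivAt_id t).div_const 2)
  refine h4.congr_deriv ?_
  simp only [id]
  field_simp
  ring

lemma hasDerivAt_thn (n : ℕ) (t : ℝ) : HasDerivAt (thn n)
    (1 / 2 * Real.log n - ∑ j ∈ Finset.range (n + 1),
      1 / 2 * (((j : ℝ) + 1 / 4) / (((j : ℝ) + 1 / 4) ^ 2 + (t / 2) ^ 2))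
      - 1 / 2 * Real.log Real.pi) t := by
  unfold thn
  have hh : HasDerivAt (fun t : ℝ => t / 2) (1 / 2) t := (hasDerivAt_id t).div_const _
  refine ((hh.mul_const _).sub ?_).sub (hh.mul_const _)
  apply HasDerivAt.fun_sum
  intro j _
  have hj : (0 : ℝ) < (j : ℝ) + 1 / 4 := by positivity
  have := (hh.div_const ((j : ℝ) + 1 / 4)).arctan
  refine this.congr_deriv ?_
  field_simp

lemma thn_sub_P_lip (n : ℕ) (hn : 1 ≤ n) (a b : ℝ) (ha : 4 ≤ a) (hab : a ≤ b) :
    |(thn n b - P b) - (thn n a - P a)| ≤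
      (4 / a + 1 / 4 * Real.log ((((n : ℝ) + 1) ^ 2 + b ^ 2) / n ^ 2)) * (b - a) := by
  have hn0 : (0 : ℝ) < n := by exact_mod_cast hn
  have := Convex.norm_image_sub_le_of_norm_hasDerivWithin_le (s := Set.Icc a b)
      (f := fun t => thn n t - P t)
      (C := 4 / a + 1 / 4 * Real.log ((((n : ℝ) + 1) ^ 2 + b ^ 2) / n ^ 2))
      (fun x hx => ((hasDerivAt_thn n x).sub (hasDerivAt_P x (by linarith [hx.1]))).hasDerivWithinAt)
      ?_ (convex_Icc _ _) (x := a) (y := b) ⟨le_rfl, hab⟩ ⟨hab, le_rfl⟩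
  · rw [Real.norm_eq_abs, Real.norm_of_nonneg (by linarith : 0 ≤ b - a)] at this
    exact this
  intro x hx
  have hx0 : 0 < x := by linarith [hx.1]
  have h1 := sum_compare (x / 2) (by linarith [hx.1]) n
  rw [← Finset.mul_sum]
  set S := ∑ j ∈ Finset.range (n + 1), ((j : ℝ) + 1 / 4) / (((j : ℝ) + 1 / 4) ^ 2 + (x / 2) ^ 2)
  have h2 : 4 / (x / 2) ≤ 8 / a := by
    rw [div_le_div_iff₀ (by linarith) (by linarith)]; linarith [hx.1]
  have hlog : Real.log (x / (2 * Real.pi)) = Real.log (x / 2) - Real.log Real.pi := by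
    rw [← Real.log_div (by positivity) (by positivity)]; congr 1; field_simp
  have hlog2 : Real.log ((((n : ℝ) + 1) ^ 2 + b ^ 2) / n ^ 2) =
      Real.log (((n : ℝ) + 1) ^ 2 + b ^ 2) - 2 * Real.log n := by
    rw [Real.log_div (by positivity) (by positivity), Real.log_pow]; norm_num
  have hl3 : Real.log (((n : ℝ) + 1) ^ 2 + (x / 2) ^ 2) ≤ Real.log (((n : ℝ) + 1) ^ 2 + b ^ 2) := by
    apply Real.log_le_log (by positivity)
    have : x / 2 ≤ b := by linarith [hx.2]
    gcongr
  have hl4 : 2 * Real.log n ≤ Real.log (((n : ℝ) + 1) ^ 2 + (x / 2) ^ 2) := by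
    have : Real.log ((n : ℝ) ^ 2) ≤ Real.log (((n : ℝ) + 1) ^ 2 + (x / 2) ^ 2) := by
      apply Real.log_le_log (by positivity)
      nlinarith [sq_nonneg (x / 2)]
    rw [Real.log_pow] at this; exact_mod_cast this
  rw [hlog, hlog2, Real.norm_eq_abs, abs_le]
  rw [abs_le] at h1
  have h8 : 8 / a = 2 * (4 / a) := by ring
  constructor <;> linarith [h1.1, h1.2]

lemma norm_exp_sub_exp (x y : ℝ) : ‖Complex.exp (I * x) - Complex.exp (I * y)‖ ≤ |x - y| := by
  have : Complex.exp (I * x) - Complex.exp (I * y) =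
      Complex.exp (I * y) * (Complex.exp (I * (x - y : ℝ)) - 1) := by
    rw [mul_sub, ← Complex.exp_add]; congr 2
    · push_cast; ring
    · ring
  rw [this, norm_mul, Complex.norm_exp_I_mul_ofReal, one_mul]
  exact Real.norm_exp_I_mul_ofReal_sub_one_le

/-- slowly varying remainder -/
noncomputable def E (t : ℝ) : ℂ := G t * Complex.exp (-I * P t)

lemma norm_E (t : ℝ) : ‖E t‖ = 1 := by
  unfold E
  rw [norm_mul, norm_G, one_mul, show -I * (P t : ℂ) = I * ((-P t : ℝ) : ℂ) by push_cast; ring,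
    Complex.norm_exp_I_mul_ofReal]

lemma G_eq_E (t : ℝ) : G t = E t * Complex.exp (I * P t) := by
  unfold E
  rw [mul_assoc, ← Complex.exp_add]; simp

lemma E_lip (a b : ℝ) (ha : 4 ≤ a) (hab : a ≤ b) : ‖E b - E a‖ ≤ 4 / a * (b - a) := by
  have hE : ∀ t, Tendsto (fun n : ℕ => Complex.exp (I * (thn n t - P t : ℝ))) atTop (𝓝 (E t)) := by
    intro t
    have := (tendsto_thn t).mul_const (Complex.exp (-I * P t))
    refine this.congr ?_
    intro n
    rw [← Complex.exp_add]; congr 1; push_cast; ring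
  have h1 := ((hE b).sub (hE a)).norm
  have h2 : Tendsto (fun n : ℕ =>
      (4 / a + 1 / 4 * Real.log ((((n : ℝ) + 1) ^ 2 + b ^ 2) / n ^ 2)) * (b - a)) atTop
      (𝓝 ((4 / a + 1 / 4 * Real.log 1) * (b - a))) := by
    apply Tendsto.mul_const
    apply Tendsto.const_add
    apply Tendsto.const_mul
    have h3 : Tendsto (fun n : ℕ => (((n : ℝ) + 1) ^ 2 + b ^ 2) / n ^ 2) atTop (𝓝 1) := by
      have h4 : Tendsto (fun n : ℕ => (1 + ((n : ℝ))⁻¹) ^ 2 + b ^ 2 * ((n : ℝ)⁻¹) ^ 2) atTop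
          (𝓝 ((1 + 0) ^ 2 + b ^ 2 * 0 ^ 2)) := by
        have := tendsto_inv_atTop_nhds_zero_nat (𝕜 := ℝ)
        exact ((this.const_add 1).pow 2).add ((this.pow 2).const_mul _)
      simp only [add_zero, one_pow, ne_eq, OfNat.ofNat_ne_zero, not_false_eq_true, zero_pow,
        mul_zero] at h4
      refine h4.congr' ?_
      filter_upwards [eventually_ge_atTop 1] with n hn
      have : (n : ℝ) ≠ 0 := by positivity
      field_simp
    exact (Real.continuousAt_log one_ne_zero).tendsto.comp h3
  rw [Real.log_one, mul_zero, add_zero] at h2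
  refine le_of_tendsto_of_tendsto h1 h2 ?_
  filter_upwards [eventually_ge_atTop 1] with n hn
  exact (norm_exp_sub_exp _ _).trans (thn_sub_P_lip n hn a b ha hab)

lemma differentiable_G : Differentiable ℝ G := by
  intro t
  have h : G = fun t : ℝ => Complex.Gamma (1 / 4 + I * t / 2) / ‖Complex.Gamma (1 / 4 + I * t / 2)‖
    * Complex.exp (-I * (t / 2 * Real.log Real.pi : ℝ)) := funext G_eq
  rw [h]
  have hg : DifferentiableAt ℝ (fun t : ℝ => Complex.Gamma (1 / 4 + I * t / 2)) t := by
    have h1 : DifferentiableAt ℂ Complex.Gamma (1 / 4 + I * t / 2) := by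
      apply Complex.differentiableAt_Gamma
      intro m hm
      have := congrArg Complex.re hm
      simp at this
      have : (0 : ℝ) ≤ m := by positivity
      linarith
    have h2 : DifferentiableAt ℝ (fun t : ℝ => (1 / 4 + I * t / 2 : ℂ)) t := by fun_prop
    exact (h1.restrictScalars ℝ).comp t h2
  apply DifferentiableAt.mul
  · apply DifferentiableAt.div hg
    · have := hg.norm ℂ (gam_ne t)
      exact (Complex.ofRealCLM.differentiableAt (x := _)).comp t this
    · simpa using gam_ne t
  · fun_prop

lemma continuous_G : Continuous G := differentiable_G.continuous

lemma differentiableAt_E (t : ℝ) (ht : 0 < t) : DifferentiableAt ℝ E t := by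
  unfold E
  apply (differentiable_G t).mul
  have : DifferentiableAt ℝ (fun t : ℝ => ((P t : ℝ) : ℂ)) t :=
    (Complex.ofRealCLM.differentiableAt (x := _)).comp t (hasDerivAt_P t ht).differentiableAt
  fun_prop

lemma norm_deriv_E (t : ℝ) (ht : 5 ≤ t) : ‖deriv E t‖ ≤ 8 / t := by
  apply norm_deriv_le_of_lip' (by positivity)
  have h1 : ∀ᶠ x in 𝓝 t, t / 2 < x ∧ 4 < x :=
    (lt_mem_nhds (by linarith)).and (lt_mem_nhds (by linarith))
  filter_upwards [h1] with x hx
  rcases le_total t x with h | h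
  · refine (E_lip t x (by linarith) h).trans ?_
    rw [Real.norm_of_nonneg (by linarith)]
    apply mul_le_mul_of_nonneg_right _ (by linarith)
    gcongr; norm_num
  · rw [norm_sub_rev]
    refine (E_lip x t hx.2.le h).trans ?_
    rw [norm_sub_rev, Real.norm_of_nonneg (by linarith)]
    apply mul_le_mul_of_nonneg_right _ (by linarith)
    rw [div_le_div_iff₀ (by linarith) (by linarith)]; linarith

end HL
end

section
open Complex Filter Topology

namespace HL

lemma hasDerivAt_cpow_real (x : ℝ) (hx : 0 < x) (r : ℂ) :
    HasDerivAt (fun y : ℝ => (y : ℂ) ^ r) (r * (x : ℂ) ^ (r - 1)) x := by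
  rcases eq_or_ne r 0 with h | h
  · subst h; simpa using hasDerivAt_const x (1 : ℂ)
  · exact hasDerivAt_ofReal_cpow_const hx.ne' h

noncomputable def bt (k : ℕ) (s : ℂ) : ℂ :=
  (s - 1) / 2 * ((k : ℂ) ^ (-s) + ((k + 1 : ℕ) : ℂ) ^ (-s)) +
    (((k + 1 : ℕ) : ℂ) ^ (1 - s) - (k : ℂ) ^ (1 - s))

lemma norm_bt_le (k : ℕ) (hk : 1 ≤ k) (s : ℂ) (hs : 0 ≤ s.re) :
    ‖bt k s‖ ≤ ‖s - 1‖ * ‖s‖ * ‖s + 1‖ * (k : ℝ) ^ (-s.re - 2) := by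
  have hk0 : (0 : ℝ) < k := by exact_mod_cast hk
  set M := ‖s - 1‖ * ‖s‖ * ‖s + 1‖ * (k : ℝ) ^ (-s.re - 2) with hM
  have hM0 : 0 ≤ M := by positivity
  set f : ℝ → ℂ := fun x => (s - 1) / 2 * (((x - k : ℝ) : ℂ) * ((k : ℂ) ^ (-s) + (x : ℂ) ^ (-s))) +
    ((x : ℂ) ^ (1 - s) - (k : ℂ) ^ (1 - s)) with hf
  set f' : ℝ → ℂ := fun x => (s - 1) / 2 * ((k : ℂ) ^ (-s) - (x : ℂ) ^ (-s) -
    s * (((x - k : ℝ) : ℂ) * (x : ℂ) ^ (-s - 1))) with hf'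
  have hlin : ∀ x : ℝ, HasDerivAt (fun x : ℝ => ((x - k : ℝ) : ℂ)) 1 x := by
    intro x
    have := ((hasDerivAt_id x).sub_const (k : ℝ)).ofReal_comp
    simpa using this
  have d1 : ∀ x : ℝ, 0 < x → HasDerivAt f (f' x) x := by
    intro x hx
    have h1 := (hlin x).mul ((hasDerivAt_cpow_real x hx (-s)).const_add ((k : ℂ) ^ (-s)))
    have h2 := (h1.const_mul ((s - 1) / 2)).add
      ((hasDerivAt_cpow_real x hx (1 - s)).sub_const ((k : ℂ) ^ (1 - s)))
    refine h2.congr_deriv ?_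
    simp only [hf']
    rw [show 1 - s - 1 = -s by ring]
    ring
  have d2 : ∀ x : ℝ, 0 < x → HasDerivAt f'
      ((s - 1) / 2 * (s * (s + 1) * (((x - k : ℝ) : ℂ) * (x : ℂ) ^ (-s - 2)))) x := by
    intro x hx
    have h1 := ((hlin x).mul (hasDerivAt_cpow_real x hx (-s - 1))).const_mul s
    have h2 := (((hasDerivAt_cpow_real x hx (-s)).const_sub ((k : ℂ) ^ (-s))).sub h1).const_mul
      ((s - 1) / 2)
    refine h2.congr_deriv ?_
    rw [show -s - 1 - 1 = -s - 2 by ring]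
    ring
  have b2 : ∀ x ∈ Set.Icc (k : ℝ) (k + 1),
      ‖(s - 1) / 2 * (s * (s + 1) * (((x - k : ℝ) : ℂ) * (x : ℂ) ^ (-s - 2)))‖ ≤ M := by
    intro x hx
    have hx0 : 0 < x := hk0.trans_le hx.1
    have h1 : ‖((x - k : ℝ) : ℂ)‖ ≤ 1 := by
      rw [Complex.norm_real, Real.norm_eq_abs, abs_le]; constructor <;> linarith [hx.1, hx.2]
    have h2 : ‖(x : ℂ) ^ (-s - 2)‖ ≤ (k : ℝ) ^ (-s.re - 2) := by
      rw [Complex.norm_cpow_eq_rpow_re_of_pos hx0]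
      simp only [sub_re, neg_re, re_ofNat]
      exact Real.rpow_le_rpow_of_nonpos hk0 hx.1 (by linarith)
    have h3 : ‖(s - 1) / 2‖ ≤ ‖s - 1‖ := by
      rw [norm_div]; simp only [Complex.norm_ofNat]; linarith [norm_nonneg (s - 1)]
    rw [norm_mul, norm_mul, norm_mul, norm_mul, hM]
    calc _ ≤ ‖s - 1‖ * (‖s‖ * ‖s + 1‖ * (1 * (k : ℝ) ^ (-s.re - 2))) := by gcongr
      _ = _ := by ring
  have c1 : ∀ x ∈ Set.Icc (k : ℝ) (k + 1), ‖f' x‖ ≤ M := by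
    intro x hx
    have := Convex.norm_image_sub_le_of_norm_hasDerivWithin_le (s := Set.Icc (k : ℝ) (k + 1))
      (fun y hy => (d2 y (hk0.trans_le hy.1)).hasDerivWithinAt) b2 (convex_Icc _ _)
      (x := k) (y := x) ⟨le_rfl, by linarith⟩ hx
    have h0 : f' k = 0 := by simp [hf']
    rw [h0, sub_zero] at this
    refine this.trans ?_
    rw [Real.norm_of_nonneg (by linarith [hx.1])]
    nlinarith [hx.2]
  have := Convex.norm_image_sub_le_of_norm_hasDerivWithin_le (s := Set.Icc (k : ℝ) (k + 1))
      (fun y hy => (d1 y (hk0.trans_le hy.1)).hasDerivWithinAt) c1 (convex_Icc _ _)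
      (x := k) (y := k + 1) ⟨le_rfl, by linarith⟩ ⟨by linarith, le_rfl⟩
  have h0 : f k = 0 := by simp [hf]
  have h1 : f (k + 1) = bt k s := by
    simp only [hf, bt]; push_cast; ring_nf
  rw [h0, h1, sub_zero] at this
  simpa using this

lemma sum_bt (M : ℕ) (s : ℂ) : ∑ n ∈ Finset.range M, bt (n + 1) s =
    (s - 1) * (∑ n ∈ Finset.range (M + 1), ((n + 1 : ℕ) : ℂ) ^ (-s) - 1 / 2
      - 1 / 2 * ((M + 1 : ℕ) : ℂ) ^ (-s)) + ((M + 1 : ℕ) : ℂ) ^ (1 - s) - 1 := by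
  induction M with
  | zero => simp; right; norm_num
  | succ M ih =>
    rw [Finset.sum_range_succ, ih, Finset.sum_range_succ _ (M + 1)]
    unfold bt
    ring

lemma summable_bt (s : ℂ) (hs : 0 ≤ s.re) : Summable (fun n : ℕ => bt (n + 1) s) := by
  have h : Summable (fun n : ℕ => ‖s - 1‖ * ‖s‖ * ‖s + 1‖ * ((n + 1 : ℕ) : ℝ) ^ (-s.re - 2)) := by
    apply Summable.mul_left
    exact (summable_nat_add_iff 1).mpr (Real.summable_nat_rpow.mpr (by linarith))
  exact Summable.of_norm_bounded h (fun n => norm_bt_le (n + 1) (by omega) s hs)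

lemma zeta_bt_of_one_lt (s : ℂ) (hs : 1 < s.re) :
    riemannZeta₁ s = (s - 1) / 2 + 1 + ∑' n : ℕ, bt (n + 1) s := by
  have hs1 : s ≠ 1 := by rintro rfl; simp at hs
  have hz : (s - 1) * riemannZeta s = riemannZeta₁ s := by
    rw [riemannZeta_eq_inv_sub_mul hs1, mul_inv_cancel_left₀ (sub_ne_zero.mpr hs1)]
  rw [← hz]
  have h1 := (summable_bt s (by linarith)).hasSum.tendsto_sum_nat
  simp_rw [sum_bt] at h1
  have hsum : Summable (fun n : ℕ => ((n + 1 : ℕ) : ℂ) ^ (-s)) := by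
    have := (summable_nat_add_iff 1).mpr (Complex.summable_one_div_nat_cpow.mpr hs)
    refine this.congr ?_
    intro n; rw [Complex.cpow_neg, one_div]
  have hzz : HasSum (fun n : ℕ => ((n + 1 : ℕ) : ℂ) ^ (-s)) (riemannZeta s) := by
    rw [zeta_eq_tsum_one_div_nat_add_one_cpow hs]
    have := hsum.hasSum
    convert this using 3 with n
    rw [Complex.cpow_neg, one_div]; push_cast; rfl
  have t1 := (tendsto_add_atTop_iff_nat 1).mpr hzz.tendsto_sum_nat
  have tn : ∀ r : ℂ, r.re < 0 → Tendsto (fun M : ℕ => ((M + 1 : ℕ) : ℂ) ^ r) atTop (𝓝 0) := by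
    intro r hr
    rw [tendsto_zero_iff_norm_tendsto_zero]
    have : Tendsto (fun M : ℕ => ((M + 1 : ℕ) : ℝ) ^ (r.re)) atTop (𝓝 0) := by
      have h := tendsto_rpow_neg_atTop (y := -r.re) (by linarith)
      rw [neg_neg] at h
      exact h.comp (tendsto_natCast_atTop_atTop.comp (tendsto_add_atTop_nat 1))
    refine this.congr ?_
    intro n
    rw [Complex.norm_natCast_cpow_of_pos (by omega)]
  have t2 := tn (-s) (by simp; linarith)
  have t3 := tn (1 - s) (by simp; linarith)
  have t4 := (((((t1.sub_const (1 / 2)).sub (t2.const_mul (1 / 2))).const_mul (s - 1)).add t3).sub_const 1)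
  have := tendsto_nhds_unique h1 t4
  rw [this]; ring

lemma zeta_bt (s : ℂ) (hs : 0 < s.re) :
    riemannZeta₁ s = (s - 1) / 2 + 1 + ∑' n : ℕ, bt (n + 1) s := by
  set R : ℝ := ‖s‖ + 3 with hR
  have hR3 : 3 ≤ R := by have := norm_nonneg s; linarith
  set U : Set ℂ := {z : ℂ | 0 < z.re} ∩ Metric.ball 0 R with hU
  have hUo : IsOpen U := (isOpen_lt continuous_const Complex.continuous_re).inter Metric.isOpen_ball
  have hUc : Convex ℝ U := (convex_halfSpace_re_gt 0).inter (convex_ball _ _)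
  have hd : DifferentiableOn ℂ (fun s : ℂ => (s - 1) / 2 + 1 + ∑' n : ℕ, bt (n + 1) s) U := by
    apply DifferentiableOn.add (by fun_prop)
    have hu : Summable (fun n : ℕ => (R + 1) * R * (R + 1) * ((n + 1 : ℕ) : ℝ) ^ (-2 : ℝ)) := by
      apply Summable.mul_left
      exact (summable_nat_add_iff 1).mpr (Real.summable_nat_rpow.mpr (by norm_num))
    apply differentiableOn_tsum_of_summable_norm hu _ hUo
    · intro n w hw
      have hw0 : 0 < w.re := hw.1
      have hwR : ‖w‖ ≤ R := by
        have := hw.2; rw [Metric.mem_ball, dist_zero_right] at this; exact this.le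
      refine (norm_bt_le (n + 1) (by omega) w hw0.le).trans ?_
      have e1 : ‖w - 1‖ ≤ R + 1 := (norm_sub_le _ _).trans (by simpa using hwR)
      have e2 : ‖w + 1‖ ≤ R + 1 := (norm_add_le _ _).trans (by simpa using hwR)
      have e3 : ((n + 1 : ℕ) : ℝ) ^ (-w.re - 2) ≤ ((n + 1 : ℕ) : ℝ) ^ (-2 : ℝ) := by
        apply Real.rpow_le_rpow_of_exponent_le
        · push_cast; linarith [(Nat.cast_nonneg n : (0 : ℝ) ≤ n)]
        · linarith
      gcongr
    · intro n
      unfold bt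
      have h1 : ((n + 1 : ℕ) : ℂ) ≠ 0 := by exact_mod_cast (by omega : n + 1 ≠ 0)
      have h2 : ((n + 1 + 1 : ℕ) : ℂ) ≠ 0 := by exact_mod_cast (by omega : n + 1 + 1 ≠ 0)
      intro z _
      apply DifferentiableAt.differentiableWithinAt
      have k1 : ∀ c : ℂ, c ≠ 0 → DifferentiableAt ℂ (fun s : ℂ => c ^ (-s)) z := fun c hc =>
        DifferentiableAt.const_cpow (by fun_prop) (Or.inl hc)
      have k2 : ∀ c : ℂ, c ≠ 0 → DifferentiableAt ℂ (fun s : ℂ => c ^ (1 - s)) z := fun c hc =>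
        DifferentiableAt.const_cpow (by fun_prop) (Or.inl hc)
      have := k1 _ h1
      have := k1 _ h2
      have := k2 _ h1
      have := k2 _ h2
      fun_prop
  have h2U : (2 : ℂ) ∈ U := by
    refine ⟨by simp, ?_⟩
    rw [Metric.mem_ball, dist_zero_right]; simp; linarith
  have hsU : s ∈ U := ⟨hs, by rw [Metric.mem_ball, dist_zero_right]; linarith⟩
  have := (differentiable_riemannZeta₁.differentiableOn.analyticOnNhd hUo).eqOn_of_preconnected_of_eventuallyEq
    (hd.analyticOnNhd hUo) hUc.isPreconnected h2U ?_ hsU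
  · exact this
  · have : ∀ᶠ z : ℂ in 𝓝 2, 1 < z.re :=
      (isOpen_lt continuous_const Complex.continuous_re).mem_nhds (by simp)
    filter_upwards [this] with z hz
    exact zeta_bt_of_one_lt z hz

lemma zeta_approx : ∃ C > (0 : ℝ), ∀ u : ℝ, ∀ N : ℕ, 1 ≤ N →
    ‖riemannZeta (1 / 2 + I * u) - ∑ n ∈ Finset.Icc 1 N, (n : ℂ) ^ (-(1 / 2 + I * u : ℂ))‖ ≤
      (N : ℝ) ^ (-(1 / 2) : ℝ) + 3 * (N : ℝ) ^ (1 / 2 : ℝ) / (1 + |u|) +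
      C * (1 + |u|) ^ 2 * (N : ℝ) ^ (-1.4 : ℝ) := by
  have hsm : Summable (fun n : ℕ => ((n + 1 : ℕ) : ℝ) ^ (-1.1 : ℝ)) :=
    (summable_nat_add_iff 1).mpr (Real.summable_nat_rpow.mpr (by norm_num))
  set C := ∑' n : ℕ, ((n + 1 : ℕ) : ℝ) ^ (-1.1 : ℝ) with hC
  have hC0 : 0 ≤ C := tsum_nonneg (fun n => by positivity)
  refine ⟨2 * C + 1, by linarith, ?_⟩
  intro u N hN
  set s : ℂ := 1 / 2 + I * u with hs
  have hre : s.re = 1 / 2 := by simp [hs]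
  have him : s.im = u := by simp [hs]
  have hs1 : s - 1 ≠ 0 := by
    intro h; have := congrArg Complex.re h; rw [sub_re, hre] at this; norm_num at this
  have hNpos : (0 : ℝ) < N := by exact_mod_cast hN
  obtain ⟨M, rfl⟩ : ∃ M, N = M + 1 := ⟨N - 1, by omega⟩
  have h1 := zeta_bt s (by rw [hre]; norm_num)
  have hz : (s - 1) * riemannZeta s = riemannZeta₁ s := by
    rw [riemannZeta_eq_inv_sub_mul (sub_ne_zero.mp hs1), mul_inv_cancel_left₀ hs1]
  rw [← (summable_bt s (by rw [hre]; norm_num)).sum_add_tsum_nat_add M, sum_bt, ← hz] at h1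
  set τ := ∑' n : ℕ, bt (n + M + 1) s with hτ
  have hidx : ∑ n ∈ Finset.Icc 1 (M + 1), (n : ℂ) ^ (-s) =
      ∑ n ∈ Finset.range (M + 1), ((n + 1 : ℕ) : ℂ) ^ (-s) := by
    rw [Finset.range_eq_Ico, Finset.sum_Ico_add' (fun n : ℕ => (n : ℂ) ^ (-s)) 0 (M + 1) 1]
    rfl
  rw [hidx]
  set S := ∑ n ∈ Finset.range (M + 1), ((n + 1 : ℕ) : ℂ) ^ (-s)
  have key : riemannZeta s - S = -(1 / 2 * ((M + 1 : ℕ) : ℂ) ^ (-s)) +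
      ((M + 1 : ℕ) : ℂ) ^ (1 - s) / (s - 1) + τ / (s - 1) := by
    field_simp
    linear_combination 2 * h1
  have hus : 1 + |u| ≤ 3 * ‖s - 1‖ := by
    have hh : ‖s - 1‖ ^ 2 = 1 / 4 + u ^ 2 := by
      rw [Complex.sq_norm, Complex.normSq_apply, sub_re, sub_im, hre, him]; norm_num; ring
    apply le_of_sq_le_sq _ (by positivity)
    rw [mul_pow, hh]
    nlinarith [sq_nonneg (|u| - 1), sq_abs u, abs_nonneg u]
  have hnorm_s : ‖s‖ ≤ 1 + |u| := by
    have := Complex.norm_le_abs_re_add_abs_im s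
    rw [hre, him] at this
    have e : |(1 / 2 : ℝ)| = 1 / 2 := by norm_num
    linarith
  have hnorm_s1 : ‖s + 1‖ ≤ 2 * (1 + |u|) := by
    refine (norm_add_le _ _).trans ?_
    rw [norm_one]; linarith [abs_nonneg u]
  have htau : ‖τ‖ ≤ ‖s - 1‖ * ((1 + |u|) * (2 * (1 + |u|))) * (((M + 1 : ℕ) : ℝ) ^ (-1.4 : ℝ) * C) := by
    rw [hτ, hC, ← tsum_mul_left, ← tsum_mul_left]
    apply tsum_of_norm_bounded ((hsm.mul_left _).mul_left _).hasSum
    intro n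
    refine (norm_bt_le (n + M + 1) (by omega) s (by rw [hre]; norm_num)).trans ?_
    rw [hre]
    have e1 : ((n + M + 1 : ℕ) : ℝ) ^ (-(1 / 2) - 2 : ℝ) ≤
        ((M + 1 : ℕ) : ℝ) ^ (-1.4 : ℝ) * ((n + 1 : ℕ) : ℝ) ^ (-1.1 : ℝ) := by
      have hp : (0 : ℝ) < ((n + M + 1 : ℕ) : ℝ) := by positivity
      rw [show (-(1 / 2) - 2 : ℝ) = -1.4 + -1.1 by norm_num, Real.rpow_add hp]
      apply mul_le_mul
      · apply Real.rpow_le_rpow_of_nonpos (by positivity) _ (by norm_num)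
        exact_mod_cast (by omega)
      · apply Real.rpow_le_rpow_of_nonpos (by positivity) _ (by norm_num)
        exact_mod_cast (by omega)
      · positivity
      · positivity
    calc _ ≤ ‖s - 1‖ * (1 + |u|) * (2 * (1 + |u|)) *
          (((M + 1 : ℕ) : ℝ) ^ (-1.4 : ℝ) * ((n + 1 : ℕ) : ℝ) ^ (-1.1 : ℝ)) := by gcongr
      _ = _ := by ring
  have hs1p : 0 < ‖s - 1‖ := norm_pos_iff.mpr hs1
  rw [key]
  refine (norm_add₃_le).trans ?_
  have n1 : ‖-(1 / 2 * ((M + 1 : ℕ) : ℂ) ^ (-s))‖ ≤ ((M + 1 : ℕ) : ℝ) ^ (-(1 / 2) : ℝ) := by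
    rw [norm_neg, norm_mul, Complex.norm_natCast_cpow_of_pos (by omega), neg_re, hre]
    have : (0 : ℝ) ≤ ((M + 1 : ℕ) : ℝ) ^ (-(1 / 2) : ℝ) := by positivity
    have e : ‖(1 / 2 : ℂ)‖ = 1 / 2 := by norm_num
    rw [e]; linarith
  have n2 : ‖((M + 1 : ℕ) : ℂ) ^ (1 - s) / (s - 1)‖ ≤
      3 * ((M + 1 : ℕ) : ℝ) ^ (1 / 2 : ℝ) / (1 + |u|) := by
    rw [norm_div, Complex.norm_natCast_cpow_of_pos (by omega), sub_re, hre, one_re]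
    norm_num only
    have : (0 : ℝ) ≤ ((M + 1 : ℕ) : ℝ) ^ (1 / 2 : ℝ) := by positivity
    rw [div_le_div_iff₀ hs1p (by positivity)]
    nlinarith
  have n3 : ‖τ / (s - 1)‖ ≤ (2 * C + 1) * (1 + |u|) ^ 2 * ((M + 1 : ℕ) : ℝ) ^ (-1.4 : ℝ) := by
    rw [norm_div, div_le_iff₀ hs1p]
    refine htau.trans ?_
    have : (0 : ℝ) ≤ ((M + 1 : ℕ) : ℝ) ^ (-1.4 : ℝ) := by positivity
    have h9 : 0 ≤ ‖s - 1‖ * (1 + |u|) ^ 2 * ((M + 1 : ℕ) : ℝ) ^ (-1.4 : ℝ) := by positivity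
    nlinarith
  linarith

end HL
end

section
open Complex Filter Topology
namespace HL

noncomputable def f (t : ℝ) : ℂ := riemannZeta (1 / 2 + I * t)

lemma half_ne_one (t : ℝ) : (1 / 2 + I * t : ℂ) ≠ 1 := by
  intro h; have := congrArg Complex.re h; norm_num at this
lemma half_ne_zero (t : ℝ) : (1 / 2 + I * t : ℂ) ≠ 0 := by
  intro h; have := congrArg Complex.re h; simp at this

lemma continuous_f : Continuous f := by
  rw [continuous_iff_continuousAt]
  intro t
  have h := (differentiableAt_riemannZeta (half_ne_one t)).continuousAt
  exact ContinuousAt.comp (f := fun t : ℝ => (1 / 2 + I * t : ℂ)) h (by fun_prop)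

lemma HardyZ_coe (t : ℝ) : (HardyZ t : ℂ) = G t * f t := by
  have hconj : (starRingEnd ℂ) (G t * f t) = G t * f t := by
    set s : ℂ := 1 / 2 + I * t with hs
    have hcs : (starRingEnd ℂ) s = 1 - s := by
      apply Complex.ext <;> simp [hs]; norm_num
    have hcs0 : 1 - s ≠ 0 := by
      rw [← hcs]; exact (map_ne_zero _).mpr (half_ne_zero t)
    have hG0 : ∀ z : ℂ, 0 < z.re → Gammaℝ z ≠ 0 := fun z hz => Gammaℝ_ne_zero_of_re_pos hz
    have h1 : completedRiemannZeta s = Gammaℝ s * riemannZeta s := by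
      rw [riemannZeta_def_of_ne_zero (half_ne_zero t), ← hs]
      rw [mul_div_cancel₀ _ (hG0 s (by simp [hs]))]
    have h2 : completedRiemannZeta (1 - s) = Gammaℝ (1 - s) * riemannZeta (1 - s) := by
      rw [riemannZeta_def_of_ne_zero hcs0]
      have := hG0 (1 - s) (by simp [hs]; norm_num)
      field_simp
    have h3 : Gammaℝ (1 - s) = (starRingEnd ℂ) (Gammaℝ s) := by
      rw [← hcs, Gammaℝ_def, Gammaℝ_def, map_mul, ← Complex.Gamma_conj]
      congr 1
      · have : (starRingEnd ℂ) (-s / 2) = -(starRingEnd ℂ) s / 2 := by simp [Complex.conj_ofNat]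
        rw [← this, Complex.cpow_conj, Complex.conj_ofReal]
        · rw [Complex.arg_ofReal_of_nonneg Real.pi_pos.le]; exact Real.pi_pos.ne
      · simp [Complex.conj_ofNat]
    rw [completedRiemannZeta_one_sub, h1, h3, ← hcs, riemannZeta_conj, ← map_mul] at h2
    -- G t = real * Gammaℝ s
    have h4 : ∃ r : ℝ, G t = r * Gammaℝ s := by
      refine ⟨‖Complex.Gamma (1 / 4 + I * t / 2)‖⁻¹ * Real.pi ^ (1 / 4 : ℝ), ?_⟩
      rw [G_eq, Gammaℝ_def, Complex.cpow_def_of_ne_zero (by exact_mod_cast Real.pi_ne_zero)]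
      have e1 : s / 2 = 1 / 4 + I * t / 2 := by rw [hs]; ring
      have e2 : (Real.pi ^ (1 / 4 : ℝ) : ℝ) = Real.exp (Real.log Real.pi * (1 / 4)) := by
        rw [Real.rpow_def_of_pos Real.pi_pos]
      rw [e1, e2, ← Complex.ofReal_log Real.pi_pos.le]
      have e3 : (((Real.log Real.pi : ℝ) : ℂ) * (-s / 2)) = ((Real.log Real.pi * (1 / 4) : ℝ) : ℂ) * (-1) + (-I * (t / 2 * Real.log Real.pi)) := by
        rw [hs]; push_cast; ring
      rw [e3, Complex.exp_add]
      push_cast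
      rw [mul_neg_one, Complex.exp_neg]
      have := Complex.exp_ne_zero ((Real.log Real.pi : ℂ) * (1 / 4))
      field_simp
    obtain ⟨r, hr⟩ := h4
    have : G t * f t = r * (Gammaℝ s * riemannZeta s) := by rw [hr, f]; ring
    rw [this, map_mul, ← h2, Complex.conj_ofReal]
  have := Complex.conj_eq_iff_re.mp hconj
  exact this

lemma abs_HardyZ (t : ℝ) : |HardyZ t| = ‖f t‖ := by
  rw [← Real.norm_eq_abs, ← Complex.norm_real, HardyZ_coe, norm_mul, norm_G, one_mul]

lemma continuous_HardyZ : Continuous HardyZ := by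
  have h : Continuous (fun t => (G t * f t).re) := by
    have := continuous_G; have := continuous_f; fun_prop
  exact h

lemma f_crude : ∃ C > 0, ∀ u : ℝ, ‖f u‖ ≤ C * (1 + |u|) ^ 2 := by
  obtain ⟨C, hC, h⟩ := zeta_approx
  refine ⟨5 + C, by linarith, fun u => ?_⟩
  have := h u 1 le_rfl
  simp only [Finset.Icc_self, Finset.sum_singleton, Nat.cast_one, Complex.one_cpow, Real.one_rpow, mul_one] at this
  have h2 : ‖f u‖ ≤ ‖f u - 1‖ + 1 := by
    simpa using norm_add_le (f u - 1) 1
  have hu := abs_nonneg u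
  have h3 : 3 / (1 + |u|) ≤ 3 := by
    rw [div_le_iff₀ (by linarith)]; nlinarith
  unfold f at *
  nlinarith [sq_nonneg (|u|)]
end HL
end

section
open Complex Filter Topology MeasureTheory
namespace HL

lemma exists_bump : ∃ ψ : ℝ → ℝ, Continuous ψ ∧ (∀ x, 0 ≤ ψ x) ∧ (∀ x, ψ (-x) = ψ x) ∧
    (∀ x, 1 ≤ |x| → ψ x = 0) ∧ Integrable ψ ∧ (∫ x, ψ x = 1) ∧ (∃ M > 0, ∀ x, ψ x ≤ M) ∧
    ∃ k : ℝ → ℂ, Continuous k ∧ Integrable k ∧ Integrable (fun y => ‖k y‖ * (1 + y ^ 4)) ∧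
      ∀ x : ℝ, ∫ y, k y * Complex.exp (I * (x * y)) = ψ x := by
  let b : ContDiffBump (0 : ℝ) := ⟨1 / 2, 1, by norm_num, by norm_num⟩
  let ψ : ℝ → ℝ := b.normed volume
  have hcs : HasCompactSupport ψ := b.hasCompactSupport_normed
  have hz : ∀ x, 1 ≤ |x| → ψ x = 0 := by
    intro x hx
    by_contra h
    have : x ∈ Function.support ψ := h
    rw [ContDiffBump.support_normed_eq] at this
    simp [b] at this
    linarith
  have hcd : ContDiff ℝ ((⊤ : ℕ∞) : WithTop ℕ∞) (fun x => (ψ x : ℂ)) :=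
    Complex.ofRealCLM.contDiff.comp b.contDiff_normed
  have hcs2 : HasCompactSupport (fun x => (ψ x : ℂ)) := hcs.comp_left (g := fun x : ℝ => (x : ℂ)) (by simp)
  let S : SchwartzMap ℝ ℂ := hcs2.toSchwartzMap hcd
  let γ : SchwartzMap ℝ ℂ := FourierTransform.fourier S
  have hinv : ∀ x : ℝ, ∫ w, γ w * Complex.exp (I * (2 * Real.pi * x * w)) = ψ x := by
    intro x
    have h1 : FourierTransformInv.fourierInv γ = S := FourierTransform.fourierInv_fourier_eq S
    have h2 : (FourierTransformInv.fourierInv γ) x = S x := by rw [h1]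
    rw [SchwartzMap.fourierInv_coe, Real.fourierInv_eq'] at h2
    have h3 : S x = (ψ x : ℂ) := rfl
    rw [← h3, ← h2]
    congr 1; ext w
    simp only [smul_eq_mul, RCLike.inner_apply, conj_trivial]
    rw [mul_comm]
    congr 2
    push_cast; ring
  refine ⟨ψ, b.continuous_normed, b.nonneg_normed, b.normed_neg, hz, b.integrable_normed, b.integral_normed, ?_, ?_⟩
  · obtain ⟨M, hM⟩ := hcs.exists_bound_of_continuous b.continuous_normed
    refine ⟨|M| + 1, by positivity, fun x => ?_⟩
    have := hM x
    have h2 := le_abs_self (ψ x)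
    have h3 := le_abs_self M
    rw [Real.norm_eq_abs] at this
    linarith
  · have hp : (0:ℝ) < 2 * Real.pi := by positivity
    refine ⟨fun y => γ (y / (2 * Real.pi)) / (2 * Real.pi), ?_, ?_, ?_, ?_⟩
    · have := γ.continuous; fun_prop
    · exact (γ.integrable.comp_div hp.ne').div_const _
    · have h4 := (γ.integrable_pow_mul volume 4).comp_div hp.ne'
      have h0 := (γ.integrable_pow_mul volume 0).comp_div hp.ne'
      have := (h0.div_const (2 * Real.pi)).add (h4.mul_const ((2 * Real.pi) ^ 3))
      refine this.congr (Eventually.of_forall fun y => ?_)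
      simp only [Pi.add_apply, pow_zero, one_mul, norm_div, norm_mul, Complex.norm_real, Real.norm_eq_abs, Complex.norm_ofNat, abs_of_pos Real.pi_pos]
      rw [div_pow, abs_of_pos (two_pos : (0:ℝ) < 2), show |y| ^ 4 = y ^ 4 by rw [← abs_pow, abs_of_nonneg (by positivity)]]
      field_simp
    · intro x
      have h := MeasureTheory.Measure.integral_comp_div (fun w : ℝ => γ w * Complex.exp (I * (2 * Real.pi * x * w))) (2 * Real.pi)
      rw [hinv x, abs_of_pos hp] at h
      have h5 : ∀ y : ℝ, γ (y / (2 * Real.pi)) / (2 * Real.pi) * Complex.exp (I * (x * y)) =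
        (2 * Real.pi : ℂ)⁻¹ * (γ (y / (2 * Real.pi)) * Complex.exp (I * (2 * Real.pi * x * ((y / (2 * Real.pi) : ℝ) : ℂ)))) := by
        intro y
        have : (2 * Real.pi * x * ((y / (2 * Real.pi) : ℝ) : ℂ) : ℂ) = x * y := by
          push_cast; have : (Real.pi : ℂ) ≠ 0 := by exact_mod_cast Real.pi_ne_zero
          field_simp
        rw [this]; ring
      simp_rw [h5]
      rw [integral_const_mul, h]
      have : (Real.pi : ℂ) ≠ 0 := by exact_mod_cast Real.pi_ne_zero
      simp
      field_simp

lemma exists_kernel : ∃ C > 0, ∀ B η : ℝ, 2 ≤ B → 0 < η → η ≤ 1 →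
    ∃ K : ℝ → ℂ, ∃ W : ℝ → ℝ, Continuous K ∧ Integrable K ∧ Integrable (fun y => ‖K y‖ * (1 + y ^ 4)) ∧
      (∫ y, ‖K y‖ * (1 + y ^ 4) ≤ C * B / η ^ 4) ∧
      (∀ l : ℝ, ∫ y, K y * Complex.exp (I * (l * y)) = W l) ∧
      (∀ l, 0 ≤ W l ∧ W l ≤ 1) ∧ (∀ l, η ≤ l → l ≤ (B - 1) * η → W l = 1) ∧
      (∀ l, l ≤ -η → W l = 0) ∧ (∀ l, |l| ≤ (B - 1) * η → W l + W (-l) = 1) ∧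
      (∀ l m, |W l - W m| ≤ C / η * |l - m|) := by
  obtain ⟨ψ, hc, h0, hev, hsupp, hIntg, hone, ⟨M, hM, hbd⟩, k, kc, ki, ki4, kinv⟩ := exists_bump
  set Φ : ℝ → ℝ := fun x => ∫ u in (-1)..x, ψ u with hΦ
  have hii : ∀ a b, IntervalIntegrable ψ volume a b := fun a b => hc.intervalIntegrable a b
  have hsub : ∀ a b, Φ b - Φ a = ∫ u in a..b, ψ u := fun a b =>
    intervalIntegral.integral_interval_sub_left (hii _ _) (hii _ _)
  have Φmono : Monotone Φ := by
    intro a b hab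
    have := intervalIntegral.integral_nonneg hab (f := ψ) (μ := volume) (fun u _ => h0 u)
    rw [← hsub] at this; linarith
  have hout : ∀ a b, (∀ u ∈ Set.uIcc a b, 1 ≤ |u|) → Φ b = Φ a := by
    intro a b h
    have : ∫ u in a..b, ψ u = 0 := by
      rw [intervalIntegral.integral_congr (g := fun _ => 0) (fun u hu => hsupp u (h u hu))]; simp
    rw [← hsub] at this; linarith
  have Φm1 : Φ (-1) = 0 := by simp [hΦ]
  have Φlo : ∀ x, x ≤ -1 → Φ x = 0 := by
    intro x hx
    rw [← Φm1]; apply hout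
    intro u hu
    rw [Set.uIcc_of_ge hx] at hu
    rw [abs_of_nonpos (by linarith [hu.2])]; linarith [hu.2]
  have Φ1 : Φ 1 = 1 := by
    refine Eq.trans ?_ hone
    rw [hΦ]
    simp only
    rw [intervalIntegral.integral_of_le (by norm_num)]
    rw [setIntegral_eq_integral_of_forall_compl_eq_zero]
    intro x hx
    apply hsupp
    by_contra hcon
    push Not at hcon
    rw [abs_lt] at hcon
    exact hx ⟨hcon.1, hcon.2.le⟩
  have Φhi : ∀ x, 1 ≤ x → Φ x = 1 := by
    intro x hx
    rw [← Φ1]; apply hout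
    intro u hu
    rw [Set.uIcc_of_le hx] at hu
    rw [abs_of_nonneg (by linarith [hu.1])]; linarith [hu.1]
  have Φrange : ∀ x, 0 ≤ Φ x ∧ Φ x ≤ 1 := by
    intro x
    constructor
    · rcases le_total x (-1) with h | h
      · rw [Φlo x h]
      · rw [← Φm1]; exact Φmono h
    · rcases le_total x 1 with h | h
      · rw [← Φ1]; exact Φmono h
      · rw [Φhi x h]
  have Φsym : ∀ x, Φ x + Φ (-x) = 1 := by
    intro x
    have h1 : Φ (-x) - Φ (-1) = Φ 1 - Φ x := by
      rw [hsub, hsub]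
      have := intervalIntegral.integral_comp_neg (a := x) (b := 1) ψ
      rw [← this]; congr 1; ext u; exact hev u
    rw [Φm1, Φ1] at h1; linarith
  have Φlip : ∀ x y, |Φ x - Φ y| ≤ M * |x - y| := by
    intro x y
    rw [hsub]
    have := intervalIntegral.norm_integral_le_of_norm_le_const (a := y) (b := x) (f := ψ) (C := M)
      (fun u _ => by rw [Real.norm_eq_abs, abs_of_nonneg (h0 u)]; exact hbd u)
    simpa using this
  set J := ∫ y, ‖k y‖ * (1 + y ^ 4) with hJ
  have hJ0 : 0 ≤ J := integral_nonneg fun y => by positivity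
  refine ⟨J + 2 * M + 1, by positivity, fun B η hB hη hη1 => ?_⟩
  set D : ℝ → ℂ := fun y => ∫ a in (0:ℝ)..B, Complex.exp (-I * (a * y)) with hD
  have hDc : Continuous D := by
    apply intervalIntegral.continuous_parametric_intervalIntegral_of_continuous' (by fun_prop)
  have hDb : ∀ y, ‖D y‖ ≤ B := by
    intro y
    have := intervalIntegral.norm_integral_le_of_norm_le_const (a := 0) (b := B)
      (f := fun a : ℝ => Complex.exp (-I * (a * y))) (C := 1)
      (fun u _ => by
        rw [show -I * ((u:ℂ) * y) = ((-(u * y) : ℝ) : ℂ) * I by push_cast; ring, Complex.norm_exp_ofReal_mul_I])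
    rw [sub_zero, one_mul, abs_of_nonneg (by linarith : (0:ℝ) ≤ B)] at this
    exact this
  -- unscaled kernel
  have hki : Integrable (fun y => k y * D y) := ki.mul_bdd hDc.aestronglyMeasurable (Eventually.of_forall hDb)
  have hinv : ∀ x : ℝ, ∫ y, (k y * D y) * Complex.exp (I * (x * y)) = ((Φ x - Φ (x - B) : ℝ) : ℂ) := by
    intro x
    have e1 : ∀ y : ℝ, (k y * D y) * Complex.exp (I * (x * y)) =
        ∫ a in (0:ℝ)..B, k y * Complex.exp (I * ((x - a : ℝ) * y)) := by
      intro y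
      rw [hD]
      simp only
      rw [mul_assoc, ← intervalIntegral.integral_mul_const, ← intervalIntegral.integral_const_mul]
      congr 1; ext a
      rw [← Complex.exp_add]; congr 2; push_cast; ring
    simp_rw [e1]
    rw [← MeasureTheory.intervalIntegral_integral_swap]
    · simp_rw [kinv]
      rw [hsub, intervalIntegral.integral_ofReal]
      congr 1
      rw [intervalIntegral.integral_comp_sub_left]
      simp
    · haveI : IsFiniteMeasure (volume.restrict (Set.uIoc 0 B)) := ⟨by simp [Set.uIoc]⟩
      have : Integrable (fun p : ℝ × ℝ => (1:ℂ) * k p.2) ((volume.restrict (Set.uIoc 0 B)).prod volume) :=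
        Integrable.mul_prod (integrable_const 1) ki
      refine (this.mul_bdd (g := fun p : ℝ × ℝ => Complex.exp (I * ((x - p.1 : ℝ) * p.2))) (c := 1) (by
        apply Continuous.aestronglyMeasurable; fun_prop) (Eventually.of_forall fun p => ?_)).congr (Eventually.of_forall fun p => ?_)
      · rw [show I * (((x - p.1 : ℝ):ℂ) * p.2) = (((x - p.1) * p.2 : ℝ) : ℂ) * I by push_cast; ring, Complex.norm_exp_ofReal_mul_I]
      · simp [Function.uncurry]
  have hptw : ∀ y : ℝ, ‖(η:ℂ) * (k (η * y) * D (η * y))‖ * (1 + y ^ 4) ≤ η * B / η ^ 4 * (‖k (η * y)‖ * (1 + (η * y) ^ 4)) := by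
    intro y
    rw [norm_mul, norm_mul, Complex.norm_real, Real.norm_eq_abs, abs_of_pos hη]
    have h1 := hDb (η * y)
    have h2 : 1 + y ^ 4 ≤ (1 + (η * y) ^ 4) / η ^ 4 := by
      rw [le_div_iff₀ (by positivity)]
      have : η ^ 4 ≤ 1 := pow_le_one₀ hη.le hη1
      nlinarith
    calc η * (‖k (η * y)‖ * ‖D (η * y)‖) * (1 + y ^ 4) ≤ η * (‖k (η * y)‖ * B) * ((1 + (η * y) ^ 4) / η ^ 4) := by gcongr
      _ = _ := by ring
  have hdom : Integrable (fun y : ℝ => η * B / η ^ 4 * (‖k (η * y)‖ * (1 + (η * y) ^ 4))) :=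
    (ki4.comp_mul_left' hη.ne').const_mul _
  refine ⟨fun y => η * (k (η * y) * D (η * y)), fun l => Φ (l / η) - Φ (l / η - B), by fun_prop, ?_, ?_, ?_, ?_, ?_, ?_, ?_, ?_, ?_⟩
  · exact (hki.comp_mul_left' hη.ne').const_mul _
  · exact hdom.mono' (by apply Continuous.aestronglyMeasurable; fun_prop) (Eventually.of_forall fun y => by
      rw [Real.norm_eq_abs, abs_of_nonneg (by positivity)]; exact hptw y)
  · refine (integral_mono_of_nonneg (Eventually.of_forall fun y => by positivity) hdom (Eventually.of_forall hptw)).trans ?_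
    rw [integral_const_mul, Measure.integral_comp_mul_left (fun y => ‖k y‖ * (1 + y ^ 4)), ← hJ, abs_of_pos (by positivity), smul_eq_mul]
    have : η * B / η ^ 4 * (η⁻¹ * J) = B / η ^ 4 * J := by field_simp
    rw [this]
    have h5 : 0 ≤ B / η ^ 4 := by positivity
    have h6 : (J + 2 * M + 1) * B / η ^ 4 = B / η ^ 4 * (J + 2 * M + 1) := by ring
    rw [h6]
    gcongr; linarith
  · intro l
    have h := Measure.integral_comp_mul_left (fun y : ℝ => k y * D y * Complex.exp (I * (((l / η : ℝ) : ℂ) * y))) η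
    rw [hinv, abs_of_pos (by positivity)] at h
    have e : ∀ y : ℝ, η * (k (η * y) * D (η * y)) * Complex.exp (I * (l * y)) = η * (k (η * y) * D (η * y) * Complex.exp (I * (((l / η : ℝ) : ℂ) * ((η * y : ℝ) : ℂ)))) := by
      intro y
      have : (((l / η : ℝ) : ℂ) * ((η * y : ℝ) : ℂ)) = l * y := by
        rw [← Complex.ofReal_mul, ← Complex.ofReal_mul]; congr 1; field_simp
      rw [this]; ring
    simp_rw [e]
    rw [integral_const_mul, h]
    have : (η : ℂ) ≠ 0 := by exact_mod_cast hη.ne'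
    rw [Complex.real_smul]
    push_cast
    field_simp
  · intro l
    constructor
    · linarith [Φmono (by linarith : l / η - B ≤ l / η)]
    · linarith [(Φrange (l / η)).2, (Φrange (l / η - B)).1]
  · intro l h1 h2
    have h3 : 1 ≤ l / η := by rw [le_div_iff₀ hη]; linarith
    have h4 : l / η ≤ B - 1 := by rw [div_le_iff₀ hη]; linarith
    simp only [Φhi _ h3, Φlo (l / η - B) (by linarith), sub_zero]
  · intro l h1
    have h3 : l / η ≤ -1 := by rw [div_le_iff₀ hη]; linarith
    simp only [Φlo _ h3, Φlo (l / η - B) (by linarith), sub_zero]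
  · intro l h
    have h4 : l / η ≤ B - 1 := by rw [div_le_iff₀ hη]; linarith [le_abs_self l]
    have h5 : -l / η ≤ B - 1 := by rw [div_le_iff₀ hη]; linarith [neg_abs_le l]
    simp only [Φlo (l / η - B) (by linarith), Φlo (-l / η - B) (by linarith), sub_zero]
    rw [neg_div]; exact Φsym _
  · intro l m
    have h1 := Φlip (l / η) (m / η)
    have h2 := Φlip (l / η - B) (m / η - B)
    have h3 : |l / η - m / η| = |l - m| / η := by rw [← sub_div, abs_div, abs_of_pos hη]
    have h4 : l / η - B - (m / η - B) = l / η - m / η := by ring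
    rw [h4] at h2
    rw [h3] at h1 h2
    have h5 : |Φ (l / η) - Φ (l / η - B) - (Φ (m / η) - Φ (m / η - B))| ≤ |Φ (l / η) - Φ (m / η)| + |Φ (l / η - B) - Φ (m / η - B)| := by
      rw [show Φ (l / η) - Φ (l / η - B) - (Φ (m / η) - Φ (m / η - B)) = (Φ (l / η) - Φ (m / η)) - (Φ (l / η - B) - Φ (m / η - B)) by ring]
      exact abs_sub _ _
    have h6 : (J + 2 * M + 1) / η * |l - m| = (J + 2 * M + 1) * (|l - m| / η) := by ring
    rw [h6]
    have h7 : 0 ≤ |l - m| / η := by positivity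
    simp only
    nlinarith
end HL
end

section
open Complex Filter Topology MeasureTheory
namespace HL

/-- half logarithm -/
noncomputable def Lg (t : ℝ) : ℝ := 1 / 2 * Real.log (t / (2 * Real.pi))

noncomputable def SX (X : ℕ) (u : ℝ) : ℂ := ∑ n ∈ Finset.Icc 1 X, (n : ℂ) ^ (-(1 / 2 + I * u : ℂ))

lemma norm_term (n : ℕ) (hn : 1 ≤ n) (u : ℝ) : ‖(n : ℂ) ^ (-(1 / 2 + I * u : ℂ))‖ = (n : ℝ) ^ (-(1/2) : ℝ) := by
  rw [Complex.norm_natCast_cpow_of_pos (by omega)]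
  simp

lemma sum_sqrt (X : ℕ) : ∑ n ∈ Finset.Icc 1 X, (n : ℝ) ^ (-(1/2) : ℝ) ≤ 2 * (X : ℝ) ^ (1/2 : ℝ) := by
  induction X with
  | zero => simp
  | succ X ih =>
    rw [Finset.sum_Icc_succ_top (by omega)]
    refine (add_le_add_left ih _).trans ?_
    rw [Real.rpow_neg (by positivity), ← Real.sqrt_eq_rpow, ← Real.sqrt_eq_rpow]
    push_cast
    have h1 : 0 < Real.sqrt ((X:ℝ) + 1) := Real.sqrt_pos.mpr (by positivity)
    have h2 := Real.sq_sqrt (by positivity : (0:ℝ) ≤ (X:ℝ) + 1)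
    have h3 := Real.sq_sqrt (by positivity : (0:ℝ) ≤ (X:ℝ))
    have h4 := Real.sqrt_nonneg (X:ℝ)
    have h5 : 0 < (Real.sqrt ((X:ℝ) + 1))⁻¹ := by positivity
    have h6 : (Real.sqrt ((X:ℝ) + 1))⁻¹ * Real.sqrt ((X:ℝ) + 1) = 1 := by field_simp
    nlinarith [sq_nonneg (Real.sqrt ((X:ℝ) + 1) - Real.sqrt X)]

lemma norm_SX (X : ℕ) (u : ℝ) : ‖SX X u‖ ≤ 2 * (X : ℝ) ^ (1/2 : ℝ) := by
  refine (norm_sum_le _ _).trans ?_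
  refine le_trans (le_of_eq ?_) (sum_sqrt X)
  apply Finset.sum_congr rfl
  intro n hn
  exact norm_term n (Finset.mem_Icc.mp hn).1 u

lemma abs_log_one_add (x : ℝ) (hx : |x| ≤ 1 / 2) : |Real.log (1 + x)| ≤ 2 * |x| := by
  rw [abs_le] at hx
  have h1 : 0 < 1 + x := by linarith
  have h2 := Real.log_le_sub_one_of_pos h1
  have h3 := Real.one_sub_inv_le_log_of_pos h1
  have h4 : 1 - (1 + x)⁻¹ = x / (1 + x) := by field_simp; ring
  rw [h4] at h3
  have h5 := abs_nonneg x
  have h6 := le_abs_self x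
  have h7 := neg_abs_le x
  have h8 : -(2 * |x|) ≤ x / (1 + x) := by
    rw [le_div_iff₀ h1]
    rcases le_total 0 x with h | h
    · rw [abs_of_nonneg h]; nlinarith
    · rw [abs_of_nonpos h]; nlinarith
  rw [abs_le]; constructor <;> linarith

lemma Lg_sub (t s : ℝ) (ht : 0 < t) (hs : |s| ≤ t / 2) : |Lg (t + s) - Lg t| ≤ |s| / t := by
  have hx : |s / t| ≤ 1 / 2 := by
    rw [abs_div, abs_of_pos ht, div_le_iff₀ ht]; linarith
  have h1 := abs_log_one_add (s / t) hx
  have hs' := abs_le.mp hs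
  have h2 : Lg (t + s) - Lg t = 1 / 2 * Real.log (1 + s / t) := by
    unfold Lg
    rw [← mul_sub, ← Real.log_div (by have := Real.pi_pos; apply ne_of_gt; apply div_pos <;> linarith) (by have := Real.pi_pos; positivity)]
    congr 2
    have := Real.pi_pos
    field_simp
  rw [h2, abs_mul, abs_of_pos (by norm_num : (0:ℝ) < 1/2)]
  rw [abs_div, abs_of_pos ht] at h1
  linarith

lemma P_taylor (t y : ℝ) (ht : 0 < t) (hy : |y| ≤ t / 2) : |P (t + y) - P t - y * Lg t| ≤ y ^ 2 / t := by
  have hy' := abs_le.mp hy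
  have h := Convex.norm_image_sub_le_of_norm_hasDerivWithin_le (f := fun s => P (t + s) - s * Lg t)
    (f' := fun s => Lg (t + s) - Lg t) (C := |y| / t) (s := Set.uIcc 0 y) (x := 0) (y := y) ?_ ?_ (convex_uIcc 0 y)
    Set.left_mem_uIcc Set.right_mem_uIcc
  · simp only [add_zero, zero_mul, sub_zero, Real.norm_eq_abs] at h
    calc _ = |P (t + y) - y * Lg t - P t| := by congr 1; ring
      _ ≤ _ := h
      _ = _ := by rw [div_mul_eq_mul_div, ← sq, sq_abs]
  · intro s hs
    have hs2 : |s| ≤ |y| := by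
      have := Set.abs_sub_left_of_mem_uIcc hs; simpa using this
    have hs3 := abs_le.mp (hs2.trans hy)
    have h1 := (hasDerivAt_P (t + s) (by linarith)).comp_const_add t s
    have h2 := h1.sub ((hasDerivAt_id s).mul_const (Lg t))
    exact (h2.congr_deriv (by simp [Lg])).hasDerivWithinAt
  · intro s hs
    have hs2 : |s| ≤ |y| := by
      have := Set.abs_sub_left_of_mem_uIcc hs; simpa using this
    refine (Lg_sub t s ht (hs2.trans hy)).trans ?_
    gcongr

lemma G_taylor (t y : ℝ) (ht : 8 ≤ t) (hy : |y| ≤ t / 2) :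
    ‖G (t + y) - G t * Complex.exp (I * (Lg t * y))‖ ≤ (8 * |y| + y ^ 2) / t := by
  have hy' := abs_le.mp hy
  have h1 : ‖E (t + y) - E t‖ ≤ 8 * |y| / t := by
    rcases le_total 0 y with h | h
    · refine (E_lip t (t + y) (by linarith) (by linarith)).trans ?_
      rw [abs_of_nonneg h, add_sub_cancel_left, div_mul_eq_mul_div]
      gcongr; linarith
    · rw [norm_sub_rev]
      refine (E_lip (t + y) t (by linarith) (by linarith)).trans ?_
      rw [abs_of_nonpos h, div_mul_eq_mul_div, div_le_div_iff₀ (by linarith) (by linarith)]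
      nlinarith
  have h2 : ‖Complex.exp (I * P (t + y)) - Complex.exp (I * P t) * Complex.exp (I * (Lg t * y))‖ ≤ y ^ 2 / t := by
    rw [← Complex.exp_add, show I * (P t : ℂ) + I * (Lg t * y) = I * ((P t + Lg t * y : ℝ) : ℂ) by push_cast; ring]
    refine (norm_exp_sub_exp _ _).trans ?_
    refine le_trans (le_of_eq ?_) (P_taylor t y (by linarith) hy)
    congr 1; ring
  rw [G_eq_E, G_eq_E, show E (t + y) * Complex.exp (I * P (t + y)) - E t * Complex.exp (I * P t) * Complex.exp (I * (Lg t * y))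
    = (E (t + y) - E t) * Complex.exp (I * P (t + y)) + E t * (Complex.exp (I * P (t + y)) - Complex.exp (I * P t) * Complex.exp (I * (Lg t * y))) by ring]
  refine (norm_add_le _ _).trans ?_
  rw [norm_mul, norm_mul, norm_E, one_mul, mul_comm I, Complex.norm_exp_ofReal_mul_I, mul_one, add_div]
  rw [mul_comm I] at h2
  exact add_le_add h1 h2
end HL
end

section
open Complex Filter Topology MeasureTheory
namespace HL

set_option maxHeartbeats 1000000 in
lemma pointwise_err : ∃ C > 0, ∀ T ≥ (16:ℝ), ∀ t : ℝ, T ≤ t → t ≤ 2 * T → ∀ y : ℝ,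
    ‖(HardyZ (t + y) : ℂ) - G t * Complex.exp (I * (Lg t * y)) * SX ⌊T ^ (5/3 : ℝ)⌋₊ (t + y)‖ ≤
      C * T ^ (-(1/6) : ℝ) * (1 + y ^ 4) := by
  obtain ⟨C₁, hC₁, hz⟩ := zeta_approx
  obtain ⟨C₂, hC₂, hf⟩ := f_crude
  refine ⟨100 + 100 * C₁ + 1000 * C₂, by positivity, fun T hT t ht1 ht2 y => ?_⟩
  have hT0 : 0 < T := by linarith
  set X := ⌊T ^ (5/3 : ℝ)⌋₊ with hX
  have hTp : (1:ℝ) ≤ T ^ (5/3 : ℝ) := Real.one_le_rpow (by linarith) (by norm_num)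
  have hX1 : 1 ≤ X := Nat.le_floor (by simpa using hTp)
  have hXr : (1:ℝ) ≤ X := by exact_mod_cast hX1
  have hXu : (X : ℝ) ≤ T ^ (5/3 : ℝ) := Nat.floor_le (by positivity)
  have hXl : T ^ (5/3 : ℝ) / 2 ≤ X := by
    have := Nat.lt_floor_add_one (T ^ (5/3 : ℝ))
    rw [← hX] at this
    linarith
  have e0 : T ^ (-(1/6) : ℝ) = T ^ (5/6 : ℝ) * T⁻¹ := by
    rw [← Real.rpow_neg_one T, ← Real.rpow_add hT0]; norm_num
  set q := T ^ (-(1/6) : ℝ) with hq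
  have hq0 : 0 < q := by positivity
  have hXh : (X : ℝ) ^ (1/2 : ℝ) ≤ q * T := by
    rw [e0, mul_assoc, inv_mul_cancel₀ hT0.ne', mul_one]
    calc (X : ℝ) ^ (1/2 : ℝ) ≤ (T ^ (5/3 : ℝ)) ^ (1/2 : ℝ) := Real.rpow_le_rpow (by positivity) hXu (by norm_num)
      _ = _ := by rw [← Real.rpow_mul hT0.le]; norm_num
  have hqT : 1 ≤ q * T := by
    rw [e0, mul_assoc, inv_mul_cancel₀ hT0.ne', mul_one]
    exact Real.one_le_rpow (by linarith) (by norm_num)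
  have hS : ‖SX X (t + y)‖ ≤ 2 * (q * T) := (norm_SX X _).trans (by linarith)
  have hy4 : 0 ≤ y ^ 4 := by positivity
  rw [HardyZ_coe]
  rcases le_or_gt |y| (T / 2) with h | h
  · have hyt : |y| ≤ t / 2 := by linarith
    have hG := G_taylor t y (by linarith) hyt
    have hy' := abs_le.mp h
    have habs : |t + y| = t + y := abs_of_pos (by linarith)
    have hZ := hz (t + y) X hX1
    rw [habs] at hZ
    have b1 : (X : ℝ) ^ (-(1/2) : ℝ) ≤ 2 * q := by
      calc (X : ℝ) ^ (-(1/2) : ℝ) ≤ (T ^ (5/3 : ℝ) / 2) ^ (-(1/2) : ℝ) :=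
            Real.rpow_le_rpow_of_nonpos (by positivity) hXl (by norm_num)
        _ = T ^ (-(5/6) : ℝ) * (2:ℝ) ^ (1/2 : ℝ) := by
            rw [Real.div_rpow (by positivity) (by norm_num), ← Real.rpow_mul hT0.le, Real.rpow_neg (by norm_num : (0:ℝ) ≤ 2), div_inv_eq_mul]
            norm_num
        _ ≤ q * 2 := by
            gcongr
            · exact Real.rpow_le_rpow_of_exponent_le (by linarith) (by norm_num)
            · calc (2:ℝ) ^ (1/2 : ℝ) ≤ 2 ^ (1:ℝ) := Real.rpow_le_rpow_of_exponent_le (by norm_num) (by norm_num)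
                _ = 2 := by norm_num
        _ = _ := by ring
    have b2 : 3 * (X : ℝ) ^ (1/2 : ℝ) / (1 + (t + y)) ≤ 6 * q := by
      rw [div_le_iff₀ (by linarith)]
      nlinarith
    have b3 : C₁ * (1 + (t + y)) ^ 2 * (X : ℝ) ^ (-1.4 : ℝ) ≤ 64 * C₁ * q := by
      have c1 : (X : ℝ) ^ (-1.4 : ℝ) ≤ 4 * T ^ (-(7/3) : ℝ) := by
        calc (X : ℝ) ^ (-1.4 : ℝ) ≤ (T ^ (5/3 : ℝ) / 2) ^ (-1.4 : ℝ) :=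
              Real.rpow_le_rpow_of_nonpos (by positivity) hXl (by norm_num)
          _ = (2:ℝ) ^ (1.4 : ℝ) * T ^ (-(7/3) : ℝ) := by
              rw [Real.div_rpow (by positivity) (by norm_num), ← Real.rpow_mul hT0.le, Real.rpow_neg (by norm_num : (0:ℝ) ≤ 2), div_inv_eq_mul, mul_comm]
              norm_num
          _ ≤ _ := by
              gcongr
              calc (2:ℝ) ^ (1.4 : ℝ) ≤ 2 ^ (2:ℝ) := Real.rpow_le_rpow_of_exponent_le (by norm_num) (by norm_num)
                _ = 4 := by norm_num
      have c2 : (1 + (t + y)) ^ 2 ≤ (4 * T) ^ 2 := by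
        exact pow_le_pow_left₀ (by linarith) (by linarith) 2
      have c3 : T ^ 2 * T ^ (-(7/3) : ℝ) ≤ q := by
        rw [← Real.rpow_natCast T 2, ← Real.rpow_add hT0]
        exact Real.rpow_le_rpow_of_exponent_le (by linarith) (by norm_num)
      calc C₁ * (1 + (t + y)) ^ 2 * (X : ℝ) ^ (-1.4 : ℝ) ≤ C₁ * (4 * T) ^ 2 * (4 * T ^ (-(7/3) : ℝ)) := by gcongr
        _ = 64 * C₁ * (T ^ 2 * T ^ (-(7/3) : ℝ)) := by ring
        _ ≤ _ := by gcongr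
    have hfs : ‖f (t + y) - SX X (t + y)‖ ≤ (8 + 64 * C₁) * q := by
      have : ‖f (t + y) - SX X (t + y)‖ ≤ _ := hZ
      linarith
    rw [show G (t + y) * f (t + y) - G t * Complex.exp (I * (Lg t * y)) * SX X (t + y) =
      G (t + y) * (f (t + y) - SX X (t + y)) + (G (t + y) - G t * Complex.exp (I * (Lg t * y))) * SX X (t + y) by ring]
    refine (norm_add_le _ _).trans ?_
    rw [norm_mul, norm_mul, norm_G, one_mul]
    have b4 : ‖G (t + y) - G t * Complex.exp (I * (Lg t * y))‖ * ‖SX X (t + y)‖ ≤ (8 * |y| + y ^ 2) / T * (2 * (q * T)) := by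
      gcongr
      refine hG.trans ?_
      gcongr
    have b5 : (8 * |y| + y ^ 2) / T * (2 * (q * T)) = 2 * (8 * |y| + y ^ 2) * q := by field_simp
    have b6 : 2 * (8 * |y| + y ^ 2) ≤ 18 * (1 + y ^ 4) := by
      have := abs_nonneg y
      have := sq_abs y
      nlinarith [sq_nonneg (y ^ 2 - 1), sq_nonneg (|y| - 1)]
    calc _ ≤ (8 + 64 * C₁) * q + 18 * (1 + y ^ 4) * q := by
          rw [b5] at b4
          have := mul_le_mul_of_nonneg_right b6 hq0.le
          linarith
      _ ≤ _ := by
        have : 0 ≤ C₂ * q * (1 + y ^ 4) := by positivity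
        have : 0 ≤ C₁ * q * y ^ 4 := by positivity
        have : 0 ≤ q * y ^ 4 := by positivity
        have : 0 ≤ C₁ * q := by positivity
        linarith
  · refine (norm_sub_le _ _).trans ?_
    have hE : ‖Complex.exp (I * (Lg t * y))‖ = 1 := by
      rw [show I * ((Lg t : ℂ) * y) = ((Lg t * y : ℝ) : ℂ) * I by push_cast; ring, Complex.norm_exp_ofReal_mul_I]
    rw [norm_mul, norm_mul, norm_mul, norm_G, norm_G, hE, one_mul, one_mul, one_mul]
    have h1 := hf (t + y)
    have h2 : 1 + |t + y| ≤ 6 * |y| := by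
      have := abs_add_le t y
      rw [abs_of_pos (by linarith : 0 < t)] at this
      linarith
    have h3 : ‖f (t + y)‖ ≤ 36 * C₂ * y ^ 2 := by
      calc _ ≤ _ := h1
        _ ≤ C₂ * (6 * |y|) ^ 2 := by gcongr
        _ = _ := by rw [mul_pow, sq_abs]; ring
    have h4 : T ≤ y ^ 2 := by
      rw [← sq_abs]; nlinarith
    -- y^2 ≤ q T y^2 ≤ q y^4
    have h5 : y ^ 2 ≤ q * y ^ 4 := by
      have : y ^ 2 * 1 ≤ y ^ 2 * (q * T) := by gcongr
      have : q * y ^ 2 * T ≤ q * y ^ 2 * y ^ 2 := by gcongr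
      nlinarith
    have h6 : q * T ≤ q * y ^ 4 := by
      gcongr
      nlinarith
    have : 0 ≤ C₁ * q * (1 + y ^ 4) := by positivity
    have : 0 ≤ q * y ^ 4 := by positivity
    have : 0 ≤ C₂ * (q * y ^ 4) := by positivity
    have : C₂ * y ^ 2 ≤ C₂ * (q * y ^ 4) := by gcongr
    have : 0 ≤ C₂ * q := by positivity
    linarith
end HL
end

section
open Complex Filter Topology MeasureTheory
namespace HL

lemma term_split (n : ℕ) (hn : 1 ≤ n) (t y : ℝ) : (n : ℂ) ^ (-(1 / 2 + I * ((t + y : ℝ) : ℂ) : ℂ)) =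
    (n : ℂ) ^ (-(1 / 2 + I * t : ℂ)) * Complex.exp (I * (((-Real.log n : ℝ) : ℂ) * y)) := by
  have hn0 : (n : ℂ) ≠ 0 := by exact_mod_cast (by omega : n ≠ 0)
  rw [Complex.cpow_def_of_ne_zero hn0, Complex.cpow_def_of_ne_zero hn0, ← Complex.exp_add]
  congr 1
  rw [← Complex.natCast_log]
  push_cast; ring

lemma kernel_apply : ∃ C > 0, ∀ T ≥ (16:ℝ), ∀ t : ℝ, T ≤ t → t ≤ 2 * T → ∀ (κ : ℝ → ℂ) (kh : ℝ → ℂ),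
    Continuous κ → Integrable κ → Integrable (fun y => ‖κ y‖ * (1 + y ^ 4)) →
    (∀ l : ℝ, ∫ y, κ y * Complex.exp (I * (l * y)) = kh l) →
    ‖(∫ y, (HardyZ (t + y) : ℂ) * κ y) -
      G t * ∑ n ∈ Finset.Icc 1 ⌊T ^ (5/3 : ℝ)⌋₊, (n : ℂ) ^ (-(1 / 2 + I * t : ℂ)) * kh (Lg t - Real.log n)‖ ≤
      C * T ^ (-(1/6) : ℝ) * ∫ y, ‖κ y‖ * (1 + y ^ 4) := by
  obtain ⟨C, hC, h⟩ := pointwise_err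
  refine ⟨C, hC, fun T hT t ht1 ht2 κ kh kc ki ki4 hk => ?_⟩
  have hp := h T hT t ht1 ht2
  set X := ⌊T ^ (5/3 : ℝ)⌋₊
  set M : ℝ → ℂ := fun y => G t * Complex.exp (I * (Lg t * y)) * SX X (t + y) with hM
  have eM : ∀ y, M y * κ y = ∑ n ∈ Finset.Icc 1 X, G t * (n : ℂ) ^ (-(1 / 2 + I * t : ℂ)) *
      (κ y * Complex.exp (I * (((Lg t - Real.log n : ℝ) : ℂ) * y))) := by
    intro y
    simp only [hM, SX]
    rw [Finset.mul_sum, Finset.sum_mul]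
    apply Finset.sum_congr rfl
    intro n hn
    rw [term_split n (Finset.mem_Icc.mp hn).1 t y]
    have : Complex.exp (I * (((Lg t - Real.log n : ℝ) : ℂ) * y)) =
      Complex.exp (I * (Lg t * y)) * Complex.exp (I * (((-Real.log n : ℝ) : ℂ) * y)) := by
      rw [← Complex.exp_add]; congr 1; push_cast; ring
    rw [this]; ring
  have hie : ∀ l : ℝ, Integrable (fun y : ℝ => κ y * Complex.exp (I * (l * y))) := by
    intro l
    refine ki.mul_bdd (c := 1) (by apply Continuous.aestronglyMeasurable; fun_prop) (Eventually.of_forall fun y => ?_)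
    rw [show I * ((l : ℂ) * y) = ((l * y : ℝ) : ℂ) * I by push_cast; ring, Complex.norm_exp_ofReal_mul_I]
  have hMi : Integrable (fun y => M y * κ y) := by
    simp_rw [eM]
    apply integrable_finset_sum
    intro n _
    exact (hie _).const_mul _
  have hMv : ∫ y, M y * κ y = G t * ∑ n ∈ Finset.Icc 1 X, (n : ℂ) ^ (-(1 / 2 + I * t : ℂ)) * kh (Lg t - Real.log n) := by
    simp_rw [eM]
    rw [integral_finset_sum _ (fun n _ => (hie _).const_mul _), Finset.mul_sum]
    apply Finset.sum_congr rfl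
    intro n _
    rw [integral_const_mul, hk, mul_assoc]
  have hdom := ki4.const_mul (C * T ^ (-(1/6) : ℝ))
  have hptw : ∀ y, ‖((HardyZ (t + y) : ℂ) - M y) * κ y‖ ≤ C * T ^ (-(1/6) : ℝ) * (‖κ y‖ * (1 + y ^ 4)) := by
    intro y
    rw [norm_mul]
    calc _ ≤ C * T ^ (-(1/6) : ℝ) * (1 + y ^ 4) * ‖κ y‖ := by gcongr; exact hp y
      _ = _ := by ring
  have hMc : Continuous M := by
    have : Continuous (fun y : ℝ => SX X (t + y)) := by
      unfold SX
      apply continuous_finset_sum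
      intro n hn
      have hn0 : n ≠ 0 := by have := (Finset.mem_Icc.mp hn).1; omega
      have : NeZero (n : ℂ) := ⟨by exact_mod_cast hn0⟩
      exact Continuous.const_cpow (by fun_prop) (Or.inl (by exact_mod_cast hn0))
    rw [hM]; fun_prop
  have hdi : Integrable (fun y => ((HardyZ (t + y) : ℂ) - M y) * κ y) := by
    refine hdom.mono' ?_ (Eventually.of_forall hptw)
    apply Continuous.aestronglyMeasurable
    have := continuous_HardyZ
    fun_prop
  have e2 : ∫ y, (HardyZ (t + y) : ℂ) * κ y = (∫ y, ((HardyZ (t + y) : ℂ) - M y) * κ y) + ∫ y, M y * κ y := by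
    rw [← integral_add hdi hMi]
    congr 1; ext y; ring
  rw [e2, hMv, add_sub_cancel_right]
  refine (norm_integral_le_of_norm_le hdom (Eventually.of_forall hptw)).trans ?_
  rw [integral_const_mul]

lemma afe0 : ∃ C > 0, ∀ T ≥ (16:ℝ), ∀ B η : ℝ, 2 ≤ B → 0 < η → η ≤ 1 → 2 * Real.log T ≤ (B - 1) * η →
    ∃ W : ℝ → ℝ, 
      (∀ l, 0 ≤ W l ∧ W l ≤ 1) ∧ (∀ l, η ≤ l → l ≤ (B - 1) * η → W l = 1) ∧
      (∀ l, l ≤ -η → W l = 0) ∧ (∀ l m, |W l - W m| ≤ C / η * |l - m|) ∧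
    ∀ t : ℝ, T ≤ t → t ≤ 2 * T → 
    |HardyZ t - 2 * (G t * ∑ n ∈ Finset.Icc 1 ⌊T ^ (5/3 : ℝ)⌋₊, (n : ℂ) ^ (-(1 / 2 + I * t : ℂ)) * (W (Lg t - Real.log n) : ℂ)).re| ≤
      C * T ^ (-(1/6) : ℝ) * (B / η ^ 4) := by
  obtain ⟨C₀, hC₀, hp⟩ := pointwise_err
  obtain ⟨C₁, hC₁, hk⟩ := kernel_apply
  obtain ⟨C₂, hC₂, hK⟩ := exists_kernel
  refine ⟨C₀ + 4 * C₁ * C₂ + C₂, by positivity, fun T hT B η hB hη hη1 hlog => ?_⟩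
  obtain ⟨K, W, Kc, Ki, Ki4, Kb, KW, W01, W1, W0, Wsym, Wlip⟩ := hK B η hB hη hη1
  refine ⟨W, W01, W1, W0, ?_, ?_⟩
  · intro l m
    refine (Wlip l m).trans ?_
    gcongr
    nlinarith [mul_pos hC₁ hC₂]
  intro t ht1 ht2
  have hT0 : 0 < T := by linarith
  have r1 := hk T hT t ht1 ht2 K (fun l => (W l : ℂ)) Kc Ki Ki4 KW
  have hn : ∀ y, ‖(starRingEnd ℂ) (K y)‖ = ‖K y‖ := fun y => Complex.norm_conj _
  have r2 := hk T hT t ht1 ht2 (fun y => (starRingEnd ℂ) (K y)) (fun l => (W (-l) : ℂ))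
    (Complex.continuous_conj.comp Kc) (by
      refine Ki.mono (Complex.continuous_conj.comp Kc).aestronglyMeasurable (Eventually.of_forall fun y => ?_)
      exact (hn y).le) (by simpa only [hn] using Ki4) (by
      intro l
      have := congrArg (starRingEnd ℂ) (KW (-l))
      rw [← integral_conj, Complex.conj_ofReal] at this
      rw [← this]
      congr 1; ext y
      rw [map_mul, ← Complex.exp_conj]
      congr 2
      simp [Complex.conj_ofReal])
  simp only [hn] at r2
  have hcon : ∫ y, (HardyZ (t + y) : ℂ) * (starRingEnd ℂ) (K y) = (starRingEnd ℂ) (∫ y, (HardyZ (t + y) : ℂ) * K y) := by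
    rw [← integral_conj]; congr 1; ext y; simp [Complex.conj_ofReal]
  rw [hcon] at r2
  set X := ⌊T ^ (5/3 : ℝ)⌋₊ with hX
  set Y := ∫ y, (HardyZ (t + y) : ℂ) * K y
  set V := G t * ∑ n ∈ Finset.Icc 1 X, (n : ℂ) ^ (-(1 / 2 + I * t : ℂ)) * (W (Lg t - Real.log n) : ℂ)
  set V' := G t * ∑ n ∈ Finset.Icc 1 X, (n : ℂ) ^ (-(1 / 2 + I * t : ℂ)) * (W (-(Lg t - Real.log n)) : ℂ)
  have hVV : V + V' = G t * SX X t := by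
    simp only [V, V', SX]
    rw [← mul_add, ← Finset.sum_add_distrib]
    congr 1
    apply Finset.sum_congr rfl
    intro n hn
    rw [Finset.mem_Icc] at hn
    rw [← mul_add]
    norm_cast
    rw [Wsym, Complex.ofReal_one, mul_one]
    refine le_trans ?_ hlog
    have n1 : (1:ℝ) ≤ n := by exact_mod_cast hn.1
    have n2 : (n:ℝ) ≤ T ^ (5/3 : ℝ) := by
      have : (n : ℝ) ≤ X := by exact_mod_cast hn.2
      exact this.trans (Nat.floor_le (by positivity))
    have l1 : 0 ≤ Real.log n := Real.log_nonneg n1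
    have l2 : Real.log n ≤ 5 / 3 * Real.log T := by
      rw [← Real.log_rpow hT0]; exact Real.log_le_log (by linarith) n2
    have lT : 0 ≤ Real.log T := Real.log_nonneg (by linarith)
    have hpi := Real.pi_pos
    have hpi4 := Real.pi_le_four
    have l3 : 0 ≤ Lg t := by
      unfold Lg
      have : 1 ≤ t / (2 * Real.pi) := by rw [le_div_iff₀ (by positivity)]; linarith
      have := Real.log_nonneg this
      linarith
    have l4 : Lg t ≤ 1 / 2 * Real.log T := by
      unfold Lg
      have : t / (2 * Real.pi) ≤ T := by
        rw [div_le_iff₀ (by positivity)]; nlinarith [Real.pi_gt_three]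
      have := Real.log_le_log (div_pos (by linarith) (by positivity)) this
      linarith
    rw [abs_le]; constructor <;> linarith
  have r3 := hp T hT t ht1 ht2 0
  simp only [add_zero, Complex.ofReal_zero, mul_zero, Complex.exp_zero, mul_one, ne_eq, OfNat.ofNat_ne_zero, not_false_eq_true, zero_pow] at r3
  rw [← hX, ← hVV] at r3
  have hb : C₁ * T ^ (-(1/6) : ℝ) * ∫ y, ‖K y‖ * (1 + y ^ 4) ≤ C₁ * C₂ * (T ^ (-(1/6) : ℝ) * (B / η ^ 4)) := by
    calc _ ≤ C₁ * T ^ (-(1/6) : ℝ) * (C₂ * B / η ^ 4) := by gcongr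
      _ = _ := by ring
  set w := T ^ (-(1/6) : ℝ) * (B / η ^ 4) with hw
  have a1 : |(Y - V).re| ≤ C₁ * C₂ * w := (Complex.abs_re_le_norm _).trans (r1.trans hb)
  have a2 : |((starRingEnd ℂ) Y - V').re| ≤ C₁ * C₂ * w := (Complex.abs_re_le_norm _).trans (r2.trans hb)
  have a3 : |((HardyZ t : ℂ) - (V + V')).re| ≤ C₀ * T ^ (-(1/6) : ℝ) := (Complex.abs_re_le_norm _).trans r3
  have a4 : T ^ (-(1/6) : ℝ) ≤ w := by
    rw [hw]
    apply le_mul_of_one_le_right (by positivity)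
    rw [le_div_iff₀ (by positivity)]
    have : η ^ 4 ≤ 1 := pow_le_one₀ hη.le hη1
    linarith
  have a5 : C₀ * T ^ (-(1/6) : ℝ) ≤ C₀ * w := by gcongr
  have w0 : 0 ≤ w := by positivity
  simp only [Complex.sub_re, Complex.add_re, Complex.conj_re, Complex.ofReal_re] at a1 a2 a3
  have : (C₀ + 4 * C₁ * C₂ + C₂) * T ^ (-(1/6) : ℝ) * (B / η ^ 4) = (C₀ + 4 * C₁ * C₂ + C₂) * w := by rw [hw]; ring
  rw [this]
  have : 0 ≤ C₁ * C₂ * w := by positivity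
  have : 0 ≤ C₂ * w := by positivity
  rw [abs_le] at *
  constructor <;> linarith
end HL
end

section
open Complex Filter Topology MeasureTheory
namespace HL

noncomputable def eta (T : ℝ) : ℝ := T ^ (-(1/20000) : ℝ)
noncomputable def UU (T : ℝ) : ℝ := T ^ (0.5001 : ℝ)

lemma ev_small (a : ℝ) (ha : 0 < a) (c : ℝ) (hc : 0 < c) : ∀ᶠ T : ℝ in atTop, T ^ (-a) ≤ c :=
  ((tendsto_rpow_neg_atTop ha).eventually (Iic_mem_nhds hc))

/-- smoothed approximate functional equation with frozen weights -/
lemma prop_A : ∃ C > 0, ∀ᶠ T : ℝ in atTop, ∃ w : ℕ → ℝ, (∀ n, 0 ≤ w n ∧ w n ≤ 1) ∧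
    (∀ n : ℕ, 1 ≤ n → eta T ≤ Lg T - Real.log n → w n = 1) ∧
    (∀ n : ℕ, Lg T - Real.log n ≤ -eta T → w n = 0) ∧
    ∀ t, T ≤ t → t ≤ T + 2 * UU T →
    |HardyZ t - 2 * (G t * ∑ n ∈ Finset.Icc 1 ⌊T ^ (1/2 : ℝ)⌋₊, (w n : ℂ) * (n : ℂ) ^ (-(1 / 2 + I * t : ℂ))).re| ≤
      C * T ^ (-(1/10) : ℝ) := by
  obtain ⟨C, hC, h⟩ := afe0
  refine ⟨1000 * C + 8 * C, by positivity, ?_⟩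
  filter_upwards [eventually_ge_atTop 16, ev_small (1/20000) (by norm_num) (1/10) (by norm_num),
    ev_small (0.4999) (by norm_num) (1/10) (by norm_num)] with T hT he hu
  have hT0 : 0 < T := by linarith
  have hT1 : 1 ≤ T := by linarith
  have hη : 0 < eta T := by unfold eta; positivity
  have hη1 : eta T ≤ 1 / 10 := he
  have hlog0 : 1 ≤ Real.log T := by
    rw [Real.le_log_iff_exp_le hT0]
    linarith [Real.exp_one_lt_d9]
  have hU : UU T = T * T ^ (-(0.4999) : ℝ) := by
    unfold UU
    nth_rewrite 2 [← Real.rpow_one T]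
    rw [← Real.rpow_add hT0]; norm_num
  have hUT : UU T / T ≤ 1 / 10 := by rw [hU, mul_div_cancel_left₀ _ hT0.ne']; exact hu
  have hU0 : 0 < UU T := by unfold UU; positivity
  have hUle : UU T ≤ T / 10 := by rw [div_le_iff₀ hT0] at hUT; linarith
  set B := 10 * Real.log T / eta T with hB
  have hBη : B * eta T = 10 * Real.log T := by rw [hB]; field_simp
  have hB2 : 2 ≤ B := by
    rw [hB, le_div_iff₀ hη]; linarith
  obtain ⟨W, W01, W1, W0, Wlip, hW⟩ := h T hT B (eta T) hB2 hη (by linarith) (by nlinarith)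
  have hpi := Real.pi_pos
  have hpi4 := Real.pi_gt_three
  have hl2pi : 1 ≤ Real.log (2 * Real.pi) := by
    rw [Real.le_log_iff_exp_le (by positivity)]
    linarith [Real.exp_one_lt_d9]
  have hLg : ∀ t, 0 < t → Lg t = 1 / 2 * Real.log t - 1 / 2 * Real.log (2 * Real.pi) := by
    intro t ht
    unfold Lg
    rw [Real.log_div ht.ne' (by positivity)]; ring
  refine ⟨fun n => W (Lg T - Real.log n), fun n => W01 _, ?_, fun n hn => W0 _ hn, ?_⟩
  · intro n hn h1
    apply W1 _ h1
    have : 0 ≤ Real.log n := Real.log_nonneg (by exact_mod_cast hn)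
    rw [hLg T hT0]
    nlinarith
  intro t ht1 ht2
  have ht3 : t ≤ 2 * T := by linarith
  have r := hW t ht1 ht3
  set K := ⌊T ^ (1/2 : ℝ)⌋₊ with hK
  set X := ⌊T ^ (5/3 : ℝ)⌋₊ with hX
  have hKX : K ≤ X := Nat.floor_mono (Real.rpow_le_rpow_of_exponent_le hT1 (by norm_num))
  have hLd : |Lg t - Lg T| ≤ 2 * (UU T / T) := by
    have := Lg_sub T (t - T) hT0 (by rw [abs_of_nonneg (by linarith)]; linarith)
    rw [add_sub_cancel, abs_of_nonneg (by linarith : 0 ≤ t - T)] at this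
    refine this.trans ?_
    rw [← mul_div_assoc]
    gcongr; linarith
  have e1 : ∑ n ∈ Finset.Icc 1 X, (n : ℂ) ^ (-(1 / 2 + I * t : ℂ)) * (W (Lg t - Real.log n) : ℂ) =
      ∑ n ∈ Finset.Icc 1 K, (n : ℂ) ^ (-(1 / 2 + I * t : ℂ)) * (W (Lg t - Real.log n) : ℂ) := by
    symm
    apply Finset.sum_subset (Finset.Icc_subset_Icc_right hKX)
    intro n hn hn2
    have hn1 := (Finset.mem_Icc.mp hn).1
    have hnK : K < n := by
      by_contra hcon
      exact hn2 (Finset.mem_Icc.mpr ⟨hn1, by omega⟩)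
    have hnT : T ^ (1/2 : ℝ) < n := (Nat.floor_lt (by positivity)).mp hnK
    have hln : 1 / 2 * Real.log T ≤ Real.log n := by
      rw [← Real.log_rpow hT0]; exact Real.log_le_log (by positivity) hnT.le
    rw [W0, Complex.ofReal_zero, mul_zero]
    have := (abs_le.mp hLd).2
    rw [hLg T hT0] at this
    linarith
  rw [e1] at r
  have e2 : ‖∑ n ∈ Finset.Icc 1 K, (n : ℂ) ^ (-(1 / 2 + I * t : ℂ)) * (W (Lg t - Real.log n) : ℂ) -
      ∑ n ∈ Finset.Icc 1 K, (W (Lg T - Real.log n) : ℂ) * (n : ℂ) ^ (-(1 / 2 + I * t : ℂ))‖ ≤ 4 * C * T ^ (-(1/10) : ℝ) := by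
    rw [← Finset.sum_sub_distrib]
    refine (norm_sum_le _ _).trans ?_
    have : ∀ n ∈ Finset.Icc 1 K, ‖(n : ℂ) ^ (-(1 / 2 + I * t : ℂ)) * (W (Lg t - Real.log n) : ℂ) -
        (W (Lg T - Real.log n) : ℂ) * (n : ℂ) ^ (-(1 / 2 + I * t : ℂ))‖ ≤ (n : ℝ) ^ (-(1/2) : ℝ) * (C / eta T * (2 * (UU T / T))) := by
      intro n hn
      rw [mul_comm (W (Lg T - Real.log n) : ℂ), ← mul_sub, norm_mul, norm_term n (Finset.mem_Icc.mp hn).1,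
        ← Complex.ofReal_sub, Complex.norm_real, Real.norm_eq_abs]
      gcongr
      refine (Wlip _ _).trans ?_
      gcongr
      rwa [sub_sub_sub_cancel_right]
    refine (Finset.sum_le_sum this).trans ?_
    rw [← Finset.sum_mul]
    have h2 := sum_sqrt K
    have h3 : (K : ℝ) ^ (1/2 : ℝ) ≤ T ^ (1/4 : ℝ) := by
      calc (K : ℝ) ^ (1/2 : ℝ) ≤ (T ^ (1/2 : ℝ)) ^ (1/2 : ℝ) :=
            Real.rpow_le_rpow (by positivity) (Nat.floor_le (by positivity)) (by norm_num)
        _ = _ := by rw [← Real.rpow_mul hT0.le]; norm_num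
    calc _ ≤ (2 * T ^ (1/4 : ℝ)) * (C / eta T * (2 * (UU T / T))) := by
          gcongr; linarith
      _ = 4 * C * (T ^ (1/4 : ℝ) * (eta T)⁻¹ * (UU T / T)) := by ring
      _ ≤ 4 * C * T ^ (-(1/10) : ℝ) := by
          gcongr
          rw [hU, mul_div_cancel_left₀ _ hT0.ne', eta, ← Real.rpow_neg hT0.le, ← Real.rpow_add hT0, ← Real.rpow_add hT0]
          exact Real.rpow_le_rpow_of_exponent_le hT1 (by norm_num)
  have e3 : C * T ^ (-(1/6) : ℝ) * (B / eta T ^ 4) ≤ 1000 * C * T ^ (-(1/10) : ℝ) := by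
    have hl := Real.log_le_rpow_div hT0.le (by norm_num : (0:ℝ) < 1/100)
    have hi : (eta T)⁻¹ = T ^ (1/20000 : ℝ) := by rw [eta, Real.rpow_neg hT0.le, inv_inv]
    calc C * T ^ (-(1/6) : ℝ) * (B / eta T ^ 4) = 10 * C * T ^ (-(1/6) : ℝ) * Real.log T * ((eta T)⁻¹) ^ 5 := by
          rw [hB]; field_simp
      _ ≤ 10 * C * T ^ (-(1/6) : ℝ) * (T ^ (1/100 : ℝ) / (1/100)) * ((eta T)⁻¹) ^ 5 := by gcongr
      _ = 1000 * C * (T ^ (-(1/6) : ℝ) * T ^ (1/100 : ℝ) * ((eta T)⁻¹) ^ 5) := by ring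
      _ ≤ _ := by
          gcongr
          rw [hi, ← Real.rpow_natCast (T ^ (1/20000 : ℝ)), ← Real.rpow_mul hT0.le, ← Real.rpow_add hT0, ← Real.rpow_add hT0]
          exact Real.rpow_le_rpow_of_exponent_le hT1 (by norm_num)
  set V1 := ∑ n ∈ Finset.Icc 1 K, (n : ℂ) ^ (-(1 / 2 + I * t : ℂ)) * (W (Lg t - Real.log n) : ℂ)
  set V2 := ∑ n ∈ Finset.Icc 1 K, (W (Lg T - Real.log n) : ℂ) * (n : ℂ) ^ (-(1 / 2 + I * t : ℂ))
  have e4 : |(G t * V1).re - (G t * V2).re| ≤ 4 * C * T ^ (-(1/10) : ℝ) := by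
    rw [← Complex.sub_re, ← mul_sub]
    refine (Complex.abs_re_le_norm _).trans ?_
    rw [norm_mul, norm_G, one_mul]; exact e2
  have r2 := r.trans e3
  rw [abs_le] at e4 r2 ⊢
  constructor <;> linarith
end HL
end

section
open Complex Filter Topology MeasureTheory
namespace HL

/-- n^{-it} -/
noncomputable def en (n : ℕ) (t : ℝ) : ℂ := Complex.exp (I * (((-Real.log n : ℝ) : ℂ) * t))

lemma continuous_en (n : ℕ) : Continuous (en n) := by unfold en; fun_prop

lemma norm_en (n : ℕ) (t : ℝ) : ‖en n t‖ = 1 := by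
  unfold en
  rw [show I * (((-Real.log n : ℝ) : ℂ) * t) = ((-Real.log n * t : ℝ) : ℂ) * I by push_cast; ring, Complex.norm_exp_ofReal_mul_I]

lemma en_conj (m n : ℕ) (t : ℝ) : en m t * (starRingEnd ℂ) (en n t) = Complex.exp (((Real.log n - Real.log m : ℝ) * I : ℂ) * t) := by
  unfold en
  rw [← Complex.exp_conj, ← Complex.exp_add]
  congr 1
  simp only [map_mul, Complex.conj_I, Complex.conj_ofReal]
  push_cast
  ring

lemma norm_osc (w a d : ℝ) (hw : w ≠ 0) : ‖∫ t in a..d, Complex.exp (((w:ℂ) * I) * t)‖ ≤ 2 / |w| := by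
  have hc : ((w:ℂ) * I) ≠ 0 := by simp [hw]
  rw [integral_exp_mul_complex hc, norm_div]
  have h1 : ∀ x : ℝ, ‖Complex.exp ((w:ℂ) * I * x)‖ = 1 := by
    intro x
    rw [show (w:ℂ) * I * x = ((w * x : ℝ) : ℂ) * I by push_cast; ring, Complex.norm_exp_ofReal_mul_I]
  have h2 : ‖(w:ℂ) * I‖ = |w| := by simp
  rw [h2]
  gcongr
  refine (norm_sub_le _ _).trans ?_
  rw [h1, h1]; norm_num

lemma offdiag_pt (m n : ℕ) (hm : 1 ≤ m) (hmn : m < n) :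
    (m : ℝ) ^ (-(1/2) : ℝ) * (n : ℝ) ^ (-(1/2) : ℝ) * (1 / |Real.log n - Real.log m|) ≤
      (m : ℝ) ^ (-(1/2) : ℝ) * (n : ℝ) ^ (-(1/2) : ℝ) + 1 / ((n : ℝ) - m) := by
  have m0 : (0:ℝ) < m := by exact_mod_cast hm
  have hmn' : (m:ℝ) < n := by exact_mod_cast hmn
  have n0 : (0:ℝ) < n := by linarith
  have d0 : 0 < (n:ℝ) - m := by linarith
  have hl : ((n:ℝ) - m) / n ≤ Real.log n - Real.log m := by
    rw [← Real.log_div n0.ne' m0.ne']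
    have := Real.one_sub_inv_le_log_of_pos (div_pos n0 m0)
    rw [inv_div] at this
    rwa [sub_div, div_self n0.ne']
  have hp : 0 < ((n:ℝ) - m) / n := by positivity
  rw [abs_of_pos (by linarith)]
  have h1 : 1 / (Real.log n - Real.log m) ≤ n / ((n:ℝ) - m) := by
    rw [← one_div_div ((n:ℝ) - m) n]
    exact one_div_le_one_div_of_le hp hl
  have h2 : (n:ℝ) / ((n:ℝ) - m) = 1 + m * (1 / ((n:ℝ) - m)) := by field_simp; ring
  have h3 : (m : ℝ) ^ (-(1/2) : ℝ) * (n : ℝ) ^ (-(1/2) : ℝ) * m ≤ 1 := by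
    have : (n : ℝ) ^ (-(1/2) : ℝ) ≤ (m : ℝ) ^ (-(1/2) : ℝ) := Real.rpow_le_rpow_of_nonpos m0 hmn'.le (by norm_num)
    calc _ ≤ (m : ℝ) ^ (-(1/2) : ℝ) * (m : ℝ) ^ (-(1/2) : ℝ) * m := by gcongr
      _ = 1 := by
        rw [← Real.rpow_add m0]; norm_num
        rw [Real.rpow_neg_one]; field_simp
  calc _ ≤ (m : ℝ) ^ (-(1/2) : ℝ) * (n : ℝ) ^ (-(1/2) : ℝ) * (n / ((n:ℝ) - m)) := by gcongr
    _ = (m : ℝ) ^ (-(1/2) : ℝ) * (n : ℝ) ^ (-(1/2) : ℝ) + ((m : ℝ) ^ (-(1/2) : ℝ) * (n : ℝ) ^ (-(1/2) : ℝ) * m) * (1 / ((n:ℝ) - m)) := by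
      rw [h2]; ring
    _ ≤ (m : ℝ) ^ (-(1/2) : ℝ) * (n : ℝ) ^ (-(1/2) : ℝ) + 1 * (1 / ((n:ℝ) - m)) := by gcongr
    _ = _ := by ring

lemma offdiag_pt' (m n : ℕ) (hm : 1 ≤ m) (hn : 1 ≤ n) (hmn : m ≠ n) :
    (m : ℝ) ^ (-(1/2) : ℝ) * (n : ℝ) ^ (-(1/2) : ℝ) * (1 / |Real.log n - Real.log m|) ≤
      (m : ℝ) ^ (-(1/2) : ℝ) * (n : ℝ) ^ (-(1/2) : ℝ) + 1 / |(n : ℝ) - m| := by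
  rcases lt_or_gt_of_ne hmn with h | h
  · have h' : (m:ℝ) < n := by exact_mod_cast h
    rw [abs_of_pos (by linarith : (0:ℝ) < (n:ℝ) - m)]; exact offdiag_pt m n hm h
  · have h' : (n:ℝ) < m := by exact_mod_cast h
    rw [abs_sub_comm (n:ℝ), abs_of_pos (by linarith : (0:ℝ) < (m:ℝ) - n), abs_sub_comm, mul_comm ((m : ℝ) ^ (-(1/2) : ℝ))]
    exact offdiag_pt n m hn h

lemma harm (K : ℕ) : ∑ j ∈ Finset.Icc 1 K, 1 / (j:ℝ) ≤ 1 + Real.log K := by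
  have := harmonic_le_one_add_log K
  rw [harmonic_eq_sum_Icc] at this
  push_cast at this
  simpa using this

lemma sum_recip (K m : ℕ) (hm : m ∈ Finset.Icc 1 K) :
    ∑ n ∈ (Finset.Icc 1 K).erase m, 1 / |(n:ℝ) - m| ≤ 2 * (1 + Real.log K) := by
  rw [Finset.mem_Icc] at hm
  rw [← Finset.sum_filter_add_sum_filter_not _ (fun n => n < m)]
  have key : ∀ (s : Finset ℕ) (g : ℕ → ℕ), Set.InjOn g s → (∀ n ∈ s, g n ∈ Finset.Icc 1 K) →
      (∀ n ∈ s, |(n:ℝ) - m| = g n) → ∑ n ∈ s, 1 / |(n:ℝ) - m| ≤ 1 + Real.log K := by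
    intro s g hinj hmem heq
    calc ∑ n ∈ s, 1 / |(n:ℝ) - m| = ∑ n ∈ s, 1 / ((g n : ℕ) : ℝ) := Finset.sum_congr rfl (fun n hn => by rw [heq n hn])
      _ = ∑ j ∈ s.image g, 1 / (j:ℝ) := (Finset.sum_image (f := fun j : ℕ => 1 / (j:ℝ)) hinj).symm
      _ ≤ ∑ j ∈ Finset.Icc 1 K, 1 / (j:ℝ) := by
        apply Finset.sum_le_sum_of_subset_of_nonneg
        · intro j hj
          obtain ⟨n, hn, rfl⟩ := Finset.mem_image.mp hj
          exact hmem n hn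
        · intros; positivity
      _ ≤ _ := harm K
  have h1 := key (((Finset.Icc 1 K).erase m).filter (fun n => n < m)) (fun n => m - n) (by
      intro a ha b hb hab; simp at ha hb hab; omega) (by
      intro a ha; simp at ha ⊢; omega) (by
      intro a ha; simp at ha
      have : (a:ℝ) < m := by exact_mod_cast ha.2
      rw [abs_sub_comm, abs_of_pos (by linarith), Nat.cast_sub ha.2.le])
  have h2 := key (((Finset.Icc 1 K).erase m).filter (fun n => ¬ n < m)) (fun n => n - m) (by
      intro a ha b hb hab; simp at ha hb hab; omega) (by
      intro a ha; simp at ha ⊢; omega) (by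
      intro a ha; simp at ha
      have : (m:ℝ) ≤ a := by exact_mod_cast ha.2
      rw [abs_of_nonneg (by linarith), Nat.cast_sub ha.2])
  linarith

lemma mean_value (K : ℕ) (c : ℕ → ℂ) (b : ℝ) (hb : 0 ≤ b)
    (hcb : ∀ n ∈ Finset.Icc 1 K, ‖c n‖ ≤ b * (n : ℝ) ^ (-(1/2) : ℝ)) (a d : ℝ) :
    |(∫ t in a..d, ‖∑ n ∈ Finset.Icc 1 K, c n * en n t‖ ^ 2) - (d - a) * ∑ n ∈ Finset.Icc 1 K, ‖c n‖ ^ 2| ≤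
      12 * b ^ 2 * (K * (1 + Real.log K)) := by
  have hsq : ∀ t : ℝ, ((‖∑ n ∈ Finset.Icc 1 K, c n * en n t‖ ^ 2 : ℝ) : ℂ) =
      ∑ m ∈ Finset.Icc 1 K, ∑ n ∈ Finset.Icc 1 K, (c m * (starRingEnd ℂ) (c n)) *
        Complex.exp (((Real.log n - Real.log m : ℝ) * I : ℂ) * t) := by
    intro t
    rw [← Complex.normSq_eq_norm_sq, Complex.normSq_eq_conj_mul_self, mul_comm, map_sum, Finset.sum_mul_sum]
    apply Finset.sum_congr rfl; intro m _
    apply Finset.sum_congr rfl; intro n _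
    rw [map_mul, ← en_conj]; ring
  have hII : ∀ m n : ℕ, IntervalIntegrable (fun t : ℝ => (c m * (starRingEnd ℂ) (c n)) *
        Complex.exp (((Real.log n - Real.log m : ℝ) * I : ℂ) * t)) volume a d := by
    intro m n; apply Continuous.intervalIntegrable; fun_prop
  have hIntg : ((∫ t in a..d, ‖∑ n ∈ Finset.Icc 1 K, c n * en n t‖ ^ 2 : ℝ) : ℂ) =
      ∑ m ∈ Finset.Icc 1 K, ∑ n ∈ Finset.Icc 1 K, (c m * (starRingEnd ℂ) (c n)) *
        ∫ t in a..d, Complex.exp (((Real.log n - Real.log m : ℝ) * I : ℂ) * t) := by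
    rw [← intervalIntegral.integral_ofReal]
    simp_rw [hsq]
    rw [intervalIntegral.integral_finsetSum (fun m _ => by
      apply Continuous.intervalIntegrable
      apply continuous_finsetSum; intro n _; fun_prop)]
    apply Finset.sum_congr rfl; intro m _
    rw [intervalIntegral.integral_finsetSum (fun n _ => hII m n)]
    apply Finset.sum_congr rfl; intro n _
    rw [intervalIntegral.integral_const_mul]
  have hsplit : ((∫ t in a..d, ‖∑ n ∈ Finset.Icc 1 K, c n * en n t‖ ^ 2 : ℝ) : ℂ) - ((d - a) * ∑ n ∈ Finset.Icc 1 K, ‖c n‖ ^ 2 : ℝ) =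
      ∑ m ∈ Finset.Icc 1 K, ∑ n ∈ (Finset.Icc 1 K).erase m, (c m * (starRingEnd ℂ) (c n)) *
        ∫ t in a..d, Complex.exp (((Real.log n - Real.log m : ℝ) * I : ℂ) * t) := by
    rw [hIntg, Finset.mul_sum, Complex.ofReal_sum, ← Finset.sum_sub_distrib]
    apply Finset.sum_congr rfl; intro m hm
    rw [← Finset.add_sum_erase _ _ hm]
    have : c m * (starRingEnd ℂ) (c m) * ∫ t in a..d, Complex.exp (((Real.log m - Real.log m : ℝ) * I : ℂ) * t) =
      (((d - a) * ‖c m‖ ^ 2 : ℝ) : ℂ) := by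
      simp only [sub_self, Complex.ofReal_zero, zero_mul, Complex.exp_zero, intervalIntegral.integral_const]
      rw [Complex.mul_conj, Complex.normSq_eq_norm_sq]
      simp; ring
    rw [this]; ring
  have hnorm : |(∫ t in a..d, ‖∑ n ∈ Finset.Icc 1 K, c n * en n t‖ ^ 2) - (d - a) * ∑ n ∈ Finset.Icc 1 K, ‖c n‖ ^ 2| =
    ‖((∫ t in a..d, ‖∑ n ∈ Finset.Icc 1 K, c n * en n t‖ ^ 2 : ℝ) : ℂ) - ((d - a) * ∑ n ∈ Finset.Icc 1 K, ‖c n‖ ^ 2 : ℝ)‖ := by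
    rw [← Complex.ofReal_sub, Complex.norm_real, Real.norm_eq_abs]
  rw [hnorm, hsplit]
  have hterm : ∀ m ∈ Finset.Icc 1 K, ∀ n ∈ (Finset.Icc 1 K).erase m, ‖(c m * (starRingEnd ℂ) (c n)) *
        ∫ t in a..d, Complex.exp (((Real.log n - Real.log m : ℝ) * I : ℂ) * t)‖ ≤
        2 * b ^ 2 * ((m : ℝ) ^ (-(1/2) : ℝ) * (n : ℝ) ^ (-(1/2) : ℝ) + 1 / |(n : ℝ) - m|) := by
    intro m hm n hn
    have hn' := (Finset.mem_erase.mp hn)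
    have m1 := (Finset.mem_Icc.mp hm).1
    have n1 := (Finset.mem_Icc.mp hn'.2).1
    have m0 : (0:ℝ) < m := by exact_mod_cast m1
    have n0 : (0:ℝ) < n := by exact_mod_cast n1
    have hne : Real.log n - Real.log m ≠ 0 := by
      intro h
      have := Real.log_injOn_pos (Set.mem_Ioi.mpr n0) (Set.mem_Ioi.mpr m0) (by linarith)
      exact hn'.1 (by exact_mod_cast this)
    rw [norm_mul, norm_mul, Complex.norm_conj]
    calc _ ≤ (b * (m : ℝ) ^ (-(1/2) : ℝ)) * (b * (n : ℝ) ^ (-(1/2) : ℝ)) * (2 / |Real.log n - Real.log m|) := by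
          gcongr
          · exact hcb m hm
          · exact hcb n hn'.2
          · exact norm_osc _ a d hne
      _ = 2 * b ^ 2 * ((m : ℝ) ^ (-(1/2) : ℝ) * (n : ℝ) ^ (-(1/2) : ℝ) * (1 / |Real.log n - Real.log m|)) := by ring
      _ ≤ _ := by
          gcongr
          exact offdiag_pt' m n m1 n1 (Ne.symm hn'.1)
  refine (norm_sum_le _ _).trans ?_
  have hrow : ∀ m ∈ Finset.Icc 1 K, ‖∑ n ∈ (Finset.Icc 1 K).erase m, (c m * (starRingEnd ℂ) (c n)) *
        ∫ t in a..d, Complex.exp (((Real.log n - Real.log m : ℝ) * I : ℂ) * t)‖ ≤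
      2 * b ^ 2 * ((m : ℝ) ^ (-(1/2) : ℝ) * (2 * (K:ℝ) ^ (1/2 : ℝ)) + 2 * (1 + Real.log K)) := by
    intro m hm
    refine (norm_sum_le _ _).trans ((Finset.sum_le_sum (hterm m hm)).trans ?_)
    rw [← Finset.mul_sum, Finset.sum_add_distrib, ← Finset.mul_sum]
    gcongr
    · refine le_trans ?_ (sum_sqrt K)
      apply Finset.sum_le_sum_of_subset_of_nonneg (Finset.erase_subset _ _)
      intros; positivity
    · exact sum_recip K m hm
  refine (Finset.sum_le_sum hrow).trans ?_
  rw [← Finset.mul_sum, Finset.sum_add_distrib, ← Finset.sum_mul, Finset.sum_const, Nat.card_Icc]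
  rcases Nat.eq_zero_or_pos K with h0 | h0
  · subst h0; simp
  have hKr : (1:ℝ) ≤ K := by exact_mod_cast h0
  have hlK : 0 ≤ Real.log K := Real.log_nonneg hKr
  have hs : (K:ℝ) ^ (1/2 : ℝ) * (K:ℝ) ^ (1/2 : ℝ) = K := by
    rw [← Real.rpow_add (by linarith)]; norm_num
  have h1 : (∑ n ∈ Finset.Icc 1 K, (n : ℝ) ^ (-(1/2) : ℝ)) * (2 * (K:ℝ) ^ (1/2 : ℝ)) ≤ 4 * K := by
    calc _ ≤ (2 * (K:ℝ) ^ (1/2 : ℝ)) * (2 * (K:ℝ) ^ (1/2 : ℝ)) := by gcongr; exact sum_sqrt K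
      _ = 4 * ((K:ℝ) ^ (1/2 : ℝ) * (K:ℝ) ^ (1/2 : ℝ)) := by ring
      _ = _ := by rw [hs]
  rw [Nat.add_sub_cancel, nsmul_eq_mul]
  calc _ ≤ 2 * b ^ 2 * (4 * K + K * (2 * (1 + Real.log K))) := by gcongr
    _ ≤ 2 * b ^ 2 * (6 * (K * (1 + Real.log K))) := by
      gcongr
      nlinarith
    _ = _ := by ring
end HL
end

section
open Complex Filter Topology MeasureTheory
namespace HL

noncomputable def ck (H x : ℝ) : ℂ := ∫ v in (0:ℝ)..H, Complex.exp (I * (v * x))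
noncomputable def hh (H x : ℝ) : ℝ := ‖ck H x‖ ^ 2

lemma norm_eI (a b : ℝ) : ‖Complex.exp (I * ((a:ℂ) * b))‖ = 1 := by
  rw [show I * ((a:ℂ) * b) = ((a * b : ℝ) : ℂ) * I by push_cast; ring, Complex.norm_exp_ofReal_mul_I]

lemma ck_eq (H x : ℝ) (hx : x ≠ 0) : ck H x = (Complex.exp (((H * x : ℝ) : ℂ) * I) - 1) / (I * x) := by
  unfold ck
  have hc : (I * x : ℂ) ≠ 0 := by simp [hx]
  have := integral_exp_mul_complex (a := 0) (b := H) hc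
  simp only [Complex.ofReal_zero, mul_zero, Complex.exp_zero] at this
  rw [show ((H * x : ℝ) : ℂ) * I = I * x * H by push_cast; ring, ← this]
  congr 1; ext v; congr 1; ring

lemma hh_eq (H x : ℝ) (hx : x ≠ 0) : hh H x = 2 * (1 - Real.cos (H * x)) / x ^ 2 := by
  unfold hh
  rw [ck_eq H x hx, norm_div, div_pow]
  congr 1
  · rw [← Complex.normSq_eq_norm_sq, Complex.normSq_apply]
    simp only [Complex.sub_re, Complex.sub_im, Complex.exp_ofReal_mul_I_re, Complex.exp_ofReal_mul_I_im, Complex.one_re, Complex.one_im]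
    nlinarith [Real.sin_sq_add_cos_sq (H * x)]
  · simp

lemma norm_ck_le (H x : ℝ) (hH : 0 ≤ H) : ‖ck H x‖ ≤ H := by
  have := intervalIntegral.norm_integral_le_of_norm_le_const (a := 0) (b := H) (C := 1)
    (f := fun v : ℝ => Complex.exp (I * (v * x))) (fun v _ => (norm_eI v x).le)
  simpa [ck, abs_of_nonneg hH] using this

lemma hh_nonneg (H x : ℝ) : 0 ≤ hh H x := by unfold hh; positivity
lemma hh_le (H x : ℝ) (hH : 0 ≤ H) : hh H x ≤ H ^ 2 := by
  unfold hh; exact pow_le_pow_left₀ (norm_nonneg _) (norm_ck_le H x hH) 2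
lemma hh_le' (H x : ℝ) (hx : x ≠ 0) : hh H x ≤ 4 / x ^ 2 := by
  rw [hh_eq H x hx]; gcongr; linarith [Real.neg_one_le_cos (H * x)]

lemma continuous_ck (H : ℝ) : Continuous (ck H) := by
  unfold ck
  apply intervalIntegral.continuous_parametric_intervalIntegral_of_continuous' (by fun_prop)
lemma continuous_hh (H : ℝ) : Continuous (hh H) := by
  have := continuous_ck H; unfold hh; fun_prop

lemma ck_lip (H x y : ℝ) (hH : 0 ≤ H) : ‖ck H x - ck H y‖ ≤ H ^ 2 * |x - y| := by
  unfold ck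
  rw [← intervalIntegral.integral_sub (by apply Continuous.intervalIntegrable; fun_prop) (by apply Continuous.intervalIntegrable; fun_prop)]
  have := intervalIntegral.norm_integral_le_of_norm_le_const (a := 0) (b := H) (C := H * |x - y|)
    (f := fun v : ℝ => Complex.exp (I * (v * x)) - Complex.exp (I * (v * y))) (fun v hv => by
      rw [Set.uIoc_of_le hH] at hv
      have := norm_exp_sub_exp (v * x) (v * y)
      push_cast at this
      refine this.trans ?_
      rw [← mul_sub, abs_mul, abs_of_pos hv.1]
      gcongr; exact hv.2)
  refine this.trans (le_of_eq ?_)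
  rw [sub_zero, abs_of_nonneg hH]; ring

lemma hh_lip (H x y : ℝ) (hH : 0 ≤ H) : |hh H x - hh H y| ≤ 2 * H ^ 3 * |x - y| := by
  unfold hh
  rw [sq_sub_sq, abs_mul]
  have h1 : |‖ck H x‖ - ‖ck H y‖| ≤ H ^ 2 * |x - y| := (abs_norm_sub_norm_le _ _).trans (ck_lip H x y hH)
  have h2 : |‖ck H x‖ + ‖ck H y‖| ≤ 2 * H := by
    rw [abs_of_nonneg (by positivity)]; linarith [norm_ck_le H x hH, norm_ck_le H y hH]
  calc _ ≤ (2 * H) * (H ^ 2 * |x - y|) := by gcongr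
    _ = _ := by ring

lemma hh_scale (H x : ℝ) : hh H x = H ^ 2 * hh 1 (H * x) := by
  rcases eq_or_ne x 0 with h | h
  · subst h; simp [hh, ck]
  rcases eq_or_ne H 0 with h' | h'
  · subst h'; simp [hh, ck]
  rw [hh_eq H x h, hh_eq 1 (H * x) (mul_ne_zero h' h)]
  field_simp

noncomputable def tent (x : ℝ) : ℂ := ((max 0 (1 - |x|) : ℝ) : ℂ)

lemma continuous_tent : Continuous tent := by unfold tent; fun_prop
lemma tent_zero (x : ℝ) (hx : 1 ≤ |x|) : tent x = 0 := by
  unfold tent; rw [max_eq_left (by linarith)]; simp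
lemma tent_compact : HasCompactSupport tent := by
  apply HasCompactSupport.intro (K := Set.Icc (-1) 1) isCompact_Icc
  intro x hx
  apply tent_zero
  by_contra h
  push Not at h
  rw [abs_lt] at h
  exact hx ⟨h.1.le, h.2.le⟩
lemma integrable_tent : Integrable tent := continuous_tent.integrable_of_hasCompactSupport tent_compact

lemma fourier_tent (ξ : ℝ) (hξ : ξ ≠ 0) : FourierTransform.fourier tent ξ = (hh 1 (2 * Real.pi * ξ) : ℂ) := by
  set a := 2 * Real.pi * ξ with ha
  have ha0 : a ≠ 0 := by have := Real.pi_ne_zero; positivity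
  have h1 : FourierTransform.fourier tent ξ = ∫ x : ℝ, Complex.exp (-(I * (a * x))) * tent x := by
    rw [Real.fourier_eq']
    congr 1; ext x
    simp only [smul_eq_mul, RCLike.inner_apply, conj_trivial]
    congr 2
    rw [ha]; push_cast; ring
  have h2 : FourierTransform.fourier tent ξ = ∫ x : ℝ, Complex.exp (I * (a * x)) * tent x := by
    rw [h1, ← integral_neg_eq_self]
    congr 1; ext x
    congr 1
    · congr 1; push_cast; ring
    · simp [tent]
  have hi : ∀ b : ℝ, Integrable (fun x : ℝ => Complex.exp (I * (b * x)) * tent x) := by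
    intro b
    refine integrable_tent.bdd_mul (c := 1) (by apply Continuous.aestronglyMeasurable; fun_prop) (Eventually.of_forall fun x => (norm_eI b x).le)
  have h3 : 2 * FourierTransform.fourier tent ξ = ∫ x : ℝ, ((2 * (Real.cos (a * |x|) * max 0 (1 - |x|)) : ℝ) : ℂ) := by
    rw [two_mul]
    nth_rewrite 1 [h1]
    rw [h2, ← integral_add (by have := hi (-a); simpa using this) (hi a)]
    congr 1; ext x
    have : Real.cos (a * |x|) = Real.cos (a * x) := by
      rcases abs_cases x with h | h <;> rw [h.1]
      rw [mul_neg, Real.cos_neg]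
    rw [this, tent]
    push_cast
    rw [Complex.cos]
    rw [show (a * x * I : ℂ) = I * (a * x) by ring, show (-(a * x : ℂ) * I : ℂ) = -(I * (a * x)) by ring]
    ring
  have h4 : ∫ x : ℝ, (2 * (Real.cos (a * |x|) * max 0 (1 - |x|)) : ℝ) = 2 * hh 1 a := by
    rw [integral_comp_abs (f := fun r => 2 * (Real.cos (a * r) * max 0 (1 - r)))]
    rw [integral_const_mul]
    have : ∫ x in Set.Ioi (0:ℝ), Real.cos (a * x) * max 0 (1 - x) = ∫ x in (0:ℝ)..1, (1 - x) * Real.cos (a * x) := by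
      rw [intervalIntegral.integral_of_le zero_le_one]
      rw [setIntegral_eq_of_subset_of_forall_sdiff_eq_zero (s := Set.Ioc (0:ℝ) 1) (t := Set.Ioi 0) (f := fun x => Real.cos (a * x) * max 0 (1 - x)) measurableSet_Ioi Set.Ioc_subset_Ioi_self]
      · apply setIntegral_congr_fun measurableSet_Ioc
        intro x hx
        simp only
        rw [max_eq_right (by linarith [hx.2])]; ring
      · intro x hx
        have h1 : ¬ x ≤ 1 := fun h => hx.2 ⟨hx.1, h⟩
        rw [max_eq_left (by linarith)]; simp
    rw [this]
    have hd : ∀ x ∈ Set.uIcc (0:ℝ) 1, HasDerivAt (fun x => (1 - x) * (Real.sin (a * x) / a) - Real.cos (a * x) / a ^ 2) ((1 - x) * Real.cos (a * x)) x := by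
      intro x _
      have d1 : HasDerivAt (fun x => a * x) a x := by simpa using (hasDerivAt_id x).const_mul a
      have d2 := (d1.sin).div_const a
      have d3 := (d1.cos).div_const (a ^ 2)
      have d4 := ((hasDerivAt_id x).const_sub 1).mul d2
      refine (d4.sub d3).congr_deriv ?_
      simp; field_simp; ring
    rw [intervalIntegral.integral_eq_sub_of_hasDerivAt hd (by apply Continuous.intervalIntegrable; fun_prop), hh_eq 1 a ha0]
    simp
    field_simp
    ring
  rw [integral_complex_ofReal, h4] at h3
  have := mul_left_cancel₀ (two_ne_zero) (h3.trans (by push_cast; rfl : ((2 * hh 1 a : ℝ) : ℂ) = 2 * (hh 1 a : ℂ)))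
  exact this

lemma integrable_hh1 : Integrable (hh 1) := by
  have hd : Integrable (fun x : ℝ => 8 * (1 + x ^ 2)⁻¹) := integrable_inv_one_add_sq.const_mul 8
  refine hd.mono' (continuous_hh 1).aestronglyMeasurable (Eventually.of_forall fun x => ?_)
  rw [Real.norm_eq_abs, abs_of_nonneg (hh_nonneg 1 x), ← div_eq_mul_inv, le_div_iff₀ (by positivity)]
  have h1 := hh_le 1 x zero_le_one
  have h0 := hh_nonneg 1 x
  rcases eq_or_ne x 0 with h | h
  · subst h; linarith
  · have h2 := hh_le' 1 x h
    rw [le_div_iff₀ (by positivity)] at h2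
    nlinarith

lemma integral_hh1 : ∫ x in Set.Ioi (0:ℝ), hh 1 x = Real.pi := by
  have hp : (0:ℝ) < 2 * Real.pi := by positivity
  have hae : FourierTransform.fourier tent =ᵐ[volume] (fun ξ : ℝ => ((hh 1 (2 * Real.pi * ξ) : ℝ) : ℂ)) := by
    have : ∀ᵐ ξ : ℝ, ξ ≠ 0 := by simp [ae_iff]
    filter_upwards [this] with ξ hξ
    exact fourier_tent ξ hξ
  have hI : Integrable (fun ξ : ℝ => ((hh 1 (2 * Real.pi * ξ) : ℝ) : ℂ)) := (integrable_hh1.comp_mul_left' hp.ne').ofReal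
  have hF : Integrable (FourierTransform.fourier tent) := hI.congr hae.symm
  have hinv := congrFun (continuous_tent.fourierInv_fourier_eq integrable_tent hF) 0
  rw [Real.fourierInv_eq'] at hinv
  simp only [inner_zero_right, mul_zero, Complex.ofReal_zero, zero_mul, Complex.exp_zero, one_smul] at hinv
  rw [integral_congr_ae hae, integral_complex_ofReal, Measure.integral_comp_mul_left (hh 1), abs_of_pos (by positivity)] at hinv
  have ht : tent 0 = ((1:ℝ):ℂ) := by simp [tent]
  rw [ht] at hinv
  have h1 : (2 * Real.pi)⁻¹ • ∫ x, hh 1 x = 1 := by exact_mod_cast hinv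
  rw [smul_eq_mul] at h1
  have h2 : ∫ x, hh 1 x = 2 * ∫ x in Set.Ioi (0:ℝ), hh 1 x := by
    rw [← integral_comp_abs]
    congr 1; ext x
    rcases abs_cases x with h | h <;> rw [h.1]
    rcases eq_or_ne x 0 with h0 | h0
    · simp [h0]
    rw [hh_eq _ _ h0, hh_eq _ _ (neg_ne_zero.mpr h0)]
    simp
  rw [h2] at h1
  field_simp at h1
  linarith

lemma integrable_hh (H : ℝ) (hH : 0 < H) : Integrable (hh H) := by
  have : hh H = fun x => H ^ 2 * hh 1 (H * x) := by ext x; exact hh_scale H x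
  rw [this]
  exact (integrable_hh1.comp_mul_left' hH.ne').const_mul _

lemma integral_hh (H : ℝ) (hH : 0 < H) : ∫ x in Set.Ioi (0:ℝ), hh H x = Real.pi * H := by
  simp_rw [hh_scale H]
  rw [integral_const_mul, integral_comp_mul_left_Ioi (hh 1) 0 hH, mul_zero, integral_hh1, smul_eq_mul]
  field_simp
end HL
end

section
open Complex Filter Topology MeasureTheory
namespace HL

lemma ii_hh (H a b : ℝ) : IntervalIntegrable (hh H) volume a b := (continuous_hh H).intervalIntegrable _ _

lemma step_sum (H L : ℝ) (hH : 0 < H) (n : ℕ) (hn : 1 ≤ n) :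
    |(1 / (n:ℝ)) * hh H (L - Real.log n) - ∫ y in (L - Real.log ((n+1:ℕ):ℝ))..(L - Real.log n), hh H y| ≤ (H ^ 2 + 2 * H ^ 3) * (1 / (n:ℝ) ^ 2) := by
  have hn0 : (0:ℝ) < n := by exact_mod_cast hn
  set l := Real.log ((n+1:ℕ):ℝ) - Real.log n with hl
  have hl' : l = Real.log (1 + 1 / n) := by
    rw [hl, ← Real.log_div (by positivity) (by positivity)]
    congr 1; push_cast; field_simp
  have hl1 : l ≤ 1 / n := by
    rw [hl']; have := Real.log_le_sub_one_of_pos (show (0:ℝ) < 1 + 1 / n by positivity); linarith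
  have hl2 : 1 / n - 1 / (n:ℝ) ^ 2 ≤ l := by
    have h1 := Real.one_sub_inv_le_log_of_pos (show (0:ℝ) < 1 + 1 / n by positivity)
    rw [← hl'] at h1
    refine le_trans ?_ h1
    rw [← sub_nonneg]
    have : 1 - (1 + 1 / (n:ℝ))⁻¹ - (1 / n - 1 / (n:ℝ) ^ 2) = 1 / ((n:ℝ) ^ 2 * (n + 1)) := by field_simp; ring
    rw [this]; positivity
  have hl0 : 0 ≤ l := by rw [hl']; apply Real.log_nonneg; have : 0 ≤ 1 / (n:ℝ) := by positivity
                         linarith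
  set x := L - Real.log n with hx
  have e1 : L - Real.log ((n+1:ℕ):ℝ) = x - l := by rw [hx, hl]; ring
  rw [e1]
  have e2 : ∫ y in (x - l)..x, (hh H x - hh H y) = l * hh H x - ∫ y in (x-l)..x, hh H y := by
    rw [intervalIntegral.integral_sub (by simp) (ii_hh _ _ _)]
    simp
  have e3 : |∫ y in (x - l)..x, (hh H x - hh H y)| ≤ 2 * H ^ 3 * l * l := by
    have := intervalIntegral.norm_integral_le_of_norm_le_const (a := x - l) (b := x) (C := 2 * H ^ 3 * l)
      (f := fun y => hh H x - hh H y) (fun y hy => by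
        rw [Set.uIoc_of_le (by linarith)] at hy
        refine (hh_lip H x y hH.le).trans ?_
        gcongr
        rw [abs_of_nonneg (by linarith [hy.2])]; linarith [hy.1])
    rw [Real.norm_eq_abs] at this
    refine this.trans (le_of_eq ?_)
    rw [sub_sub_cancel, abs_of_nonneg hl0]
  have e4 : (1 / (n:ℝ)) * hh H x - ∫ y in (x-l)..x, hh H y = (1 / n - l) * hh H x + ∫ y in (x - l)..x, (hh H x - hh H y) := by
    rw [e2]; ring
  rw [e4]
  refine (abs_add_le _ _).trans ?_
  have e5 : |(1 / (n:ℝ) - l) * hh H x| ≤ 1 / (n:ℝ) ^ 2 * H ^ 2 := by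
    rw [abs_mul, abs_of_nonneg (hh_nonneg H x), abs_of_nonneg (by linarith)]
    exact mul_le_mul (by linarith) (hh_le H x hH.le) (hh_nonneg _ _) (by positivity)
  have e6 : 2 * H ^ 3 * l * l ≤ 2 * H ^ 3 * (1 / (n:ℝ)) * (1 / n) := by gcongr
  have e7 : 2 * H ^ 3 * (1 / (n:ℝ)) * (1 / n) = 2 * H ^ 3 * (1 / (n:ℝ) ^ 2) := by field_simp
  linarith

lemma tel_sum (H L : ℝ) (hH : 0 < H) (a b : ℕ) (ha : 1 ≤ a) (hab : a ≤ b) :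
    |(∑ n ∈ Finset.Ioc a b, (1 / (n:ℝ)) * hh H (L - Real.log n)) - ∫ y in (L - Real.log ((b+1:ℕ):ℝ))..(L - Real.log ((a+1:ℕ):ℝ)), hh H y| ≤ (H ^ 2 + 2 * H ^ 3) * ∑ n ∈ Finset.Ioc a b, 1 / (n:ℝ) ^ 2 := by
  induction b, hab using Nat.le_induction with
  | base => simp
  | succ b hab ih =>
    rw [← Finset.insert_Ioc_right_eq_Ioc_add_one hab, Finset.sum_insert (by simp), Finset.sum_insert (by simp)]
    have h1 := step_sum H L hH (b+1) (by omega)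
    have h2 := intervalIntegral.integral_add_adjacent_intervals (ii_hh H (L - Real.log ((b+1+1:ℕ):ℝ)) (L - Real.log ((b+1:ℕ):ℝ))) (ii_hh H _ (L - Real.log ((a+1:ℕ):ℝ)))
    rw [← h2, mul_add]
    refine le_trans ?_ (add_le_add h1 ih)
    refine le_trans (le_of_eq ?_) (abs_add_le _ _)
    congr 1; ring

lemma tail_hh (H q : ℝ) (hH : 0 < H) (hq : 0 < q) : |∫ y in Set.Ioi q, hh H y| ≤ 4 / q := by
  have hi : IntegrableOn (fun y : ℝ => y ^ (-2:ℝ)) (Set.Ioi q) := integrableOn_Ioi_rpow_of_lt (by norm_num) hq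
  rw [abs_of_nonneg (setIntegral_nonneg measurableSet_Ioi fun y _ => hh_nonneg H y)]
  calc _ ≤ ∫ y in Set.Ioi q, 4 * y ^ (-2:ℝ) := by
        refine setIntegral_mono_on (integrable_hh H hH).integrableOn (hi.const_mul 4) measurableSet_Ioi (fun y hy => ?_)
        have hy0 : 0 < y := lt_trans hq hy
        refine (hh_le' H y hy0.ne').trans (le_of_eq ?_)
        rw [Real.rpow_neg hy0.le]; norm_cast
    _ = 4 / q := by
        rw [integral_const_mul, integral_Ioi_rpow_of_lt (by norm_num) hq]
        norm_num [Real.rpow_neg_one]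
        rfl

lemma main_sum (H L η : ℝ) (hH : 0 < H) (hL : 8 ≤ L) (hη : 0 < η) (hη1 : η ≤ 1) :
    |(∑ n ∈ Finset.Icc 1 ⌊Real.exp (L - η)⌋₊, (1 / (n:ℝ)) * hh H (L - Real.log n)) - Real.pi * H| ≤
      40 / L + (H ^ 2 + 2 * H ^ 3) * (2 * Real.exp (-(L/2))) + H ^ 2 * (η + 2 * Real.exp (-(L/2))) := by
  set b := ⌊Real.exp (L - η)⌋₊ with hb
  set a := ⌊Real.exp (L / 2)⌋₊ with ha
  have hab : a ≤ b := Nat.floor_mono (Real.exp_le_exp.2 (by linarith))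
  have he2 : (2:ℝ) ≤ Real.exp (L/2) := by
    have := Real.add_one_le_exp (L/2); linarith
  have ha1 : 1 ≤ a := by rw [ha, Nat.one_le_floor_iff]; linarith
  have haR : (0:ℝ) < a := by exact_mod_cast ha1
  have ha2 : (a:ℝ) ≤ Real.exp (L/2) := Nat.floor_le (by positivity)
  have ha3 : Real.exp (L/2) < a + 1 := Nat.lt_floor_add_one _
  have hia : 1 / (a:ℝ) ≤ 2 * Real.exp (-(L/2)) := by
    rw [Real.exp_neg, div_le_iff₀ haR, ← div_eq_mul_inv, div_mul_eq_mul_div, le_div_iff₀ (by positivity)]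
    linarith
  have hbR : (a:ℝ) ≤ b := by exact_mod_cast hab
  have hb0 : (0:ℝ) < b := by linarith
  have hb2 : (b:ℝ) ≤ Real.exp (L - η) := Nat.floor_le (by positivity)
  have hb3 : Real.exp (L - η) < b + 1 := Nat.lt_floor_add_one _
  have hib : 1 / (b:ℝ) ≤ 1 / a := one_div_le_one_div_of_le haR hbR
  set p := L - Real.log ((b+1:ℕ):ℝ) with hp
  set q := L - Real.log ((a+1:ℕ):ℝ) with hq
  have hp1 : p ≤ η := by
    have := Real.log_le_log (by positivity) hb3.le
    rw [Real.log_exp] at this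
    rw [hp]; push_cast; linarith
  have hp2 : η - 1 / b ≤ p := by
    have h1 : Real.log ((b+1:ℕ):ℝ) = Real.log b + Real.log (1 + 1 / b) := by
      rw [← Real.log_mul (by positivity) (by positivity)]; congr 1; push_cast; field_simp
    have h2 := Real.log_le_sub_one_of_pos (show (0:ℝ) < 1 + 1 / b by positivity)
    have h3 := Real.log_le_log hb0 hb2
    rw [Real.log_exp] at h3
    rw [hp, h1]; linarith
  have hq1 : L / 4 ≤ q := by
    have h1 : Real.log ((a+1:ℕ):ℝ) ≤ Real.log (2 * Real.exp (L/2)) := by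
      apply Real.log_le_log (by positivity); push_cast; linarith
    rw [Real.log_mul (by norm_num) (by positivity), Real.log_exp] at h1
    have := Real.log_two_lt_d9
    rw [hq]; linarith
  -- first part
  have s1 : |∑ n ∈ Finset.Icc 1 a, (1 / (n:ℝ)) * hh H (L - Real.log n)| ≤ 16 / L ^ 2 * (1 + L / 2) := by
    rw [abs_of_nonneg (Finset.sum_nonneg fun n _ => mul_nonneg (by positivity) (hh_nonneg _ _))]
    have hla : Real.log a ≤ L / 2 := by
      have := Real.log_le_log haR ha2; rwa [Real.log_exp] at this
    calc _ ≤ ∑ n ∈ Finset.Icc 1 a, 16 / L ^ 2 * (1 / (n:ℝ)) := by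
          apply Finset.sum_le_sum
          intro n hn
          rw [Finset.mem_Icc] at hn
          have hn0 : (0:ℝ) < n := by exact_mod_cast hn.1
          have hna : (n:ℝ) ≤ a := by exact_mod_cast hn.2
          have := Real.log_le_log hn0 hna
          have hx : L / 2 ≤ L - Real.log n := by linarith
          have h1 := hh_le' H (L - Real.log n) (by linarith)
          have h2 : 4 / (L - Real.log n) ^ 2 ≤ 4 / (L/2) ^ 2 := by gcongr
          have h3 : 4 / (L/2) ^ 2 = 16 / L ^ 2 := by field_simp; norm_num
          rw [mul_comm]
          exact mul_le_mul_of_nonneg_right (by linarith) (by positivity)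
      _ ≤ _ := by
          rw [← Finset.mul_sum]
          have := harm a
          gcongr
          linarith
  have s2 := tel_sum H L hH a b ha1 hab
  rw [← hp, ← hq] at s2
  have s3 : ∑ n ∈ Finset.Ioc a b, 1 / (n:ℝ) ^ 2 ≤ 2 * Real.exp (-(L/2)) := by
    have h1 := sum_Ioc_inv_sq_le_sub (α := ℝ) (k := a) (n := b) (by omega) hab
    have h2 : ∑ n ∈ Finset.Ioc a b, 1 / (n:ℝ) ^ 2 = ∑ n ∈ Finset.Ioc a b, ((n:ℝ) ^ 2)⁻¹ := by simp
    have h3 : (0:ℝ) ≤ (b:ℝ)⁻¹ := by positivity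
    rw [one_div] at hia
    linarith
  have s4 : (H ^ 2 + 2 * H ^ 3) * ∑ n ∈ Finset.Ioc a b, 1 / (n:ℝ) ^ 2 ≤ (H ^ 2 + 2 * H ^ 3) * (2 * Real.exp (-(L/2))) := by gcongr
  have hq0 : 0 < q := by linarith
  have s5 : ∫ y in p..q, hh H y = Real.pi * H - (∫ y in (0:ℝ)..p, hh H y) - ∫ y in Set.Ioi q, hh H y := by
    rw [← integral_hh H hH]
    have h1 := intervalIntegral.integral_add_adjacent_intervals (ii_hh H 0 p) (ii_hh H p q)
    have h2 := intervalIntegral.integral_interval_add_Ioi (a := 0) (b := q) (integrable_hh H hH).integrableOn (integrable_hh H hH).integrableOn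
    linarith
  have s6 := tail_hh H q hH hq0
  have s7 : 4 / q ≤ 16 / L := by
    rw [div_le_div_iff₀ hq0 (by linarith)]; linarith
  have hpa : |p| ≤ η + 2 * Real.exp (-(L/2)) := by
    have := Real.exp_pos (-(L/2))
    rw [abs_le]; constructor <;> linarith
  have s8 : |∫ y in (0:ℝ)..p, hh H y| ≤ H ^ 2 * (η + 2 * Real.exp (-(L/2))) := by
    have := intervalIntegral.norm_integral_le_of_norm_le_const (a := 0) (b := p) (C := H ^ 2)
      (f := fun y => hh H y) (fun y hy => by
        rw [Real.norm_eq_abs, abs_of_nonneg (hh_nonneg _ _)]; exact hh_le H y hH.le)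
    rw [Real.norm_eq_abs, sub_zero] at this
    exact this.trans (by gcongr)
  have s9 : 16 / L ^ 2 * (1 + L / 2) ≤ 24 / L := by
    have hLp : 0 < L := by linarith
    rw [div_mul_eq_mul_div, div_le_div_iff₀ (by positivity) hLp]
    nlinarith
  have s10 : ∑ n ∈ Finset.Icc 1 b, (1 / (n:ℝ)) * hh H (L - Real.log n) = (∑ n ∈ Finset.Icc 1 a, (1 / (n:ℝ)) * hh H (L - Real.log n)) + ∑ n ∈ Finset.Ioc a b, (1 / (n:ℝ)) * hh H (L - Real.log n) := by
    rw [← Finset.sum_union]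
    · congr 1; ext n; simp only [Finset.mem_union, Finset.mem_Icc, Finset.mem_Ioc]; omega
    · rw [Finset.disjoint_left]; intro n; simp only [Finset.mem_Icc, Finset.mem_Ioc]; omega
  rw [s10]
  rw [s5] at s2
  have s11 : 40 / L = 24 / L + 16 / L := by ring
  rw [abs_le] at *
  obtain ⟨_, _⟩ := s1; obtain ⟨_, _⟩ := s2; obtain ⟨_, _⟩ := s6; obtain ⟨_, _⟩ := s8
  constructor <;> linarith
end HL
end

section
open Complex Filter Topology MeasureTheory
namespace HL

lemma Lg_mono {a b : ℝ} (ha : 0 < a) (hab : a ≤ b) : Lg a ≤ Lg b := by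
  unfold Lg
  have : Real.log (a / (2 * Real.pi)) ≤ Real.log (b / (2 * Real.pi)) := by
    apply Real.log_le_log (by positivity); gcongr
  linarith

lemma hasDerivAt_Lg (t : ℝ) (ht : 0 < t) : HasDerivAt Lg (1 / (2 * t)) t := by
  unfold Lg
  have h1 : HasDerivAt (fun t : ℝ => t / (2 * Real.pi)) (1 / (2 * Real.pi)) t := (hasDerivAt_id t).div_const _
  refine ((h1.log (by positivity)).const_mul (1/2)).congr_deriv ?_
  field_simp

lemma osc2 (T b l μ : ℝ) (hT : 8 ≤ T) (hb : T ≤ b) (hμ : 0 < μ) (hl : μ ≤ 2 * Lg T - l) :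
    ‖∫ t in T..b, G t ^ 2 * Complex.exp (I * (((-l : ℝ) : ℂ) * t))‖ ≤ 2 / μ + (16 / (T * μ) + 1 / (T * μ ^ 2)) * (b - T) := by
  set g : ℝ → ℂ := fun t => G t ^ 2 * Complex.exp (I * (((-l : ℝ) : ℂ) * t)) with hg
  have hgc : Continuous g := by have := continuous_G; fun_prop
  set om : ℝ → ℝ := fun t => 2 * Lg t - l with hom
  have hom1 : ∀ t, T ≤ t → μ ≤ om t := fun t ht => by
    have := Lg_mono (by linarith) ht; simp only [hom]; linarith
  set ph : ℝ → ℂ := fun t => Complex.exp (I * ((2 * P t - l * t : ℝ) : ℂ)) with hph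
  have hphn : ∀ t, ‖ph t‖ = 1 := fun t => by
    simp only [hph]; rw [mul_comm, Complex.norm_exp_ofReal_mul_I]
  have hgE : ∀ t, g t = E t ^ 2 * ph t := fun t => by
    simp only [hg, hph]
    rw [G_eq_E, mul_pow, ← Complex.exp_nat_mul, mul_assoc, ← Complex.exp_add]
    congr 2; push_cast; ring
  set W : ℝ → ℂ := fun t => E t ^ 2 * ph t / (I * (om t : ℂ)) with hW
  have hWn : ∀ t, T ≤ t → ‖W t‖ ≤ 1 / μ := fun t ht => by
    have := hom1 t ht
    simp only [hW]
    rw [norm_div, norm_mul, norm_pow, norm_E, hphn, norm_mul, Complex.norm_I, Complex.norm_real, Real.norm_eq_abs, abs_of_pos (by linarith)]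
    simp only [one_pow, one_mul, mul_one]
    exact one_div_le_one_div_of_le hμ this
  set V : ℝ → ℂ := fun t => W t - ∫ s in T..t, g s with hV
  set r : ℝ → ℂ := fun t => (2 * E t * deriv E t * ph t) / (I * om t) - E t ^ 2 * ph t * (I * ((1 / t : ℝ) : ℂ)) / (I * om t) ^ 2 with hr
  have hd : ∀ t, T ≤ t → HasDerivAt V (r t) t := fun t ht => by
    have ht0 : 0 < t := by linarith
    have hop : 0 < om t := lt_of_lt_of_le hμ (hom1 t ht)
    have hoc : (om t : ℂ) ≠ 0 := by exact_mod_cast hop.ne'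
    have dE := (differentiableAt_E t ht0).hasDerivAt
    have dom : HasDerivAt om (1 / t) t := by
      refine (((hasDerivAt_Lg t ht0).const_mul 2).sub_const l).congr_deriv ?_
      field_simp
    have dP : HasDerivAt (fun t => 2 * P t - l * t) (om t) t := by
      refine (((hasDerivAt_P t ht0).const_mul 2).sub ((hasDerivAt_id t).const_mul l)).congr_deriv ?_
      simp only [hom, Lg]; ring
    have dph : HasDerivAt ph (ph t * (I * (om t : ℂ))) t := (dP.ofReal_comp.const_mul I).cexp
    have dden : HasDerivAt (fun t => I * (om t : ℂ)) (I * ((1 / t : ℝ) : ℂ)) t := dom.ofReal_comp.const_mul I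
    have dW := ((dE.pow 2).mul dph).div dden (mul_ne_zero Complex.I_ne_zero hoc)
    have dI := intervalIntegral.integral_hasDerivAt_right (hgc.intervalIntegrable T t) hgc.aestronglyMeasurable.stronglyMeasurableAtFilter hgc.continuousAt
    refine (dW.sub dI).congr_deriv ?_
    rw [hgE]
    simp only [hr]
    have hI := Complex.I_ne_zero
    simp only [Pi.mul_apply, Pi.pow_apply]
    generalize (((1 / t : ℝ)) : ℂ) = z
    field_simp
    push_cast
    ring
  have hrn : ∀ t, T ≤ t → ‖r t‖ ≤ 16 / (T * μ) + 1 / (T * μ ^ 2) := fun t ht => by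
    have h1 := hom1 t ht
    have ht0 : 0 < t := by linarith
    have hT0 : 0 < T := by linarith
    simp only [hr]
    refine (norm_sub_le _ _).trans ?_
    have hE' := norm_deriv_E t (by linarith)
    apply add_le_add
    · rw [norm_div, norm_mul, norm_mul, norm_mul, norm_E, hphn, norm_mul, Complex.norm_I, Complex.norm_real, Real.norm_eq_abs, abs_of_pos (by linarith)]
      simp only [one_mul, mul_one, Complex.norm_ofNat]
      have : 2 * ‖deriv E t‖ ≤ 16 / T := by
        have : 8 / t ≤ 8 / T := by gcongr
        have h3 : 16 / T = 2 * (8 / T) := by ring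
        linarith
      calc _ ≤ (16 / T) / μ := by gcongr
        _ = _ := by field_simp
    · rw [norm_div, norm_mul, norm_mul, norm_mul, norm_pow, norm_pow, norm_mul, norm_E, hphn, Complex.norm_I, Complex.norm_real, Complex.norm_real, Real.norm_eq_abs, Real.norm_eq_abs, abs_of_pos (by positivity), abs_of_pos (show 0 < om t by linarith)]
      simp only [one_mul, mul_one, one_pow]
      rw [div_div]
      gcongr
  have key := (convex_Icc T b).norm_image_sub_le_of_norm_hasDerivWithin_le (f := V) (f' := r) (C := 16 / (T * μ) + 1 / (T * μ ^ 2)) (x := T) (y := b)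
    (fun t ht => (hd t ht.1).hasDerivWithinAt) (fun t ht => hrn t ht.1) ⟨le_rfl, hb⟩ ⟨hb, le_rfl⟩
  rw [Real.norm_eq_abs, abs_of_nonneg (by linarith)] at key
  have e1 : ∫ t in T..b, g t = W b - W T - (V b - V T) := by
    simp only [hV, intervalIntegral.integral_same]; ring
  rw [e1]
  have h1 := norm_sub_le (W b - W T) (V b - V T)
  have h2 := norm_sub_le (W b) (W T)
  have h3 := hWn b hb
  have h4 := hWn T le_rfl
  have h5 : 2 / μ = 1 / μ + 1 / μ := by ring
  linarith

/-- Dirichlet polynomial -/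
lemma osc_sum (T b μ H : ℝ) (K : ℕ) (c : ℕ → ℂ) (hT : 8 ≤ T) (hb : T ≤ b) (hμ : 0 < μ) (hH : 0 ≤ H)
    (hc : ∀ n ∈ Finset.Icc 1 K, ‖c n‖ ≤ H * (n:ℝ) ^ (-(1/2):ℝ))
    (hl : ∀ n ∈ Finset.Icc 1 K, μ ≤ Lg T - Real.log n) :
    ‖∫ t in T..b, G t ^ 2 * (∑ n ∈ Finset.Icc 1 K, c n * en n t) ^ 2‖ ≤ (4 * H ^ 2 * K) * (2 / μ + (16 / (T * μ) + 1 / (T * μ ^ 2)) * (b - T)) := by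
  set B := 2 / μ + (16 / (T * μ) + 1 / (T * μ ^ 2)) * (b - T) with hB
  have hB0 : 0 ≤ B := by
    have : 0 ≤ b - T := by linarith
    have : 0 < T := by linarith
    positivity
  have e1 : ∀ t : ℝ, G t ^ 2 * (∑ n ∈ Finset.Icc 1 K, c n * en n t) ^ 2 = ∑ m ∈ Finset.Icc 1 K, ∑ n ∈ Finset.Icc 1 K, (c m * c n) * (G t ^ 2 * Complex.exp (I * (((-(Real.log m + Real.log n) : ℝ) : ℂ) * t))) := by
    intro t
    rw [pow_two (∑ n ∈ Finset.Icc 1 K, c n * en n t), Finset.sum_mul_sum, Finset.mul_sum]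
    refine Finset.sum_congr rfl fun m _ => ?_
    rw [Finset.mul_sum]
    refine Finset.sum_congr rfl fun n _ => ?_
    have : Complex.exp (I * (((-(Real.log m + Real.log n) : ℝ) : ℂ) * t)) = en m t * en n t := by
      unfold en; rw [← Complex.exp_add]; congr 1; push_cast; ring
    rw [this]; ring
  have hcont : ∀ l : ℝ, Continuous (fun t : ℝ => G t ^ 2 * Complex.exp (I * (((-l : ℝ) : ℂ) * t))) := by
    intro l; have := continuous_G; fun_prop
  simp_rw [e1]
  rw [intervalIntegral.integral_finsetSum (fun m _ => (continuous_finsetSum _ fun n _ => (hcont _).const_mul _).intervalIntegrable _ _)]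
  have e2 : ∀ m, ∫ t in T..b, ∑ n ∈ Finset.Icc 1 K, (c m * c n) * (G t ^ 2 * Complex.exp (I * (((-(Real.log m + Real.log n) : ℝ) : ℂ) * t))) = ∑ n ∈ Finset.Icc 1 K, (c m * c n) * ∫ t in T..b, (G t ^ 2 * Complex.exp (I * (((-(Real.log m + Real.log n) : ℝ) : ℂ) * t))) := by
    intro m
    rw [intervalIntegral.integral_finsetSum (fun n _ => ((hcont _).const_mul _).intervalIntegrable _ _)]
    refine Finset.sum_congr rfl fun n _ => ?_
    rw [intervalIntegral.integral_const_mul]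
  simp_rw [e2]
  have e3 : ∀ m ∈ Finset.Icc 1 K, ∀ n ∈ Finset.Icc 1 K, ‖(c m * c n) * ∫ t in T..b, (G t ^ 2 * Complex.exp (I * (((-(Real.log m + Real.log n) : ℝ) : ℂ) * t)))‖ ≤ (‖c m‖ * ‖c n‖) * B := by
    intro m hm n hn
    rw [norm_mul, norm_mul]
    have := osc2 T b (Real.log m + Real.log n) μ hT hb hμ (by linarith [hl m hm, hl n hn])
    gcongr
  have e4 : ∑ n ∈ Finset.Icc 1 K, ‖c n‖ ≤ H * (2 * (K:ℝ) ^ (1/2:ℝ)) := by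
    refine (Finset.sum_le_sum hc).trans ?_
    rw [← Finset.mul_sum]
    have := sum_sqrt K
    gcongr
  calc _ ≤ ∑ m ∈ Finset.Icc 1 K, ∑ n ∈ Finset.Icc 1 K, (‖c m‖ * ‖c n‖) * B := 
        (norm_sum_le _ _).trans (Finset.sum_le_sum fun m hm => (norm_sum_le _ _).trans (Finset.sum_le_sum fun n hn => e3 m hm n hn))
    _ = (∑ n ∈ Finset.Icc 1 K, ‖c n‖) ^ 2 * B := by
        rw [pow_two, Finset.sum_mul_sum, Finset.sum_mul]
        exact Finset.sum_congr rfl fun m _ => by rw [Finset.sum_mul]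
    _ ≤ (H * (2 * (K:ℝ) ^ (1/2:ℝ))) ^ 2 * B := by gcongr
    _ = _ := by
        rw [mul_pow, mul_pow, ← Real.rpow_natCast ((K:ℝ) ^ (1/2:ℝ)), ← Real.rpow_mul (by positivity)]
        norm_num; left; ring
end HL
end

section
open Complex Filter Topology MeasureTheory
namespace HL

structure Sc (T q s : ℝ) : Prop where
  hs : 0 < s
  hq : 100 ≤ q
  hT : T = s ^ 4
  hr : T ^ (1/2:ℝ) = s ^ 2
  he : eta T = 1 / q ^ 50
  hU : UU T = s ^ 2 * q ^ 100
  hqs : q ^ 1000 ≤ s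
  hlog : Real.log T + 1 ≤ q
  hlog1 : 100 ≤ Real.log T
  hL : Real.log T / 4 ≤ Lg T
  hexp : Real.exp (-(Lg T / 2)) ≤ 2 / s
  hexp1 : Real.exp (Lg T) ≤ s ^ 2
  h10 : T ^ (-(1/10):ℝ) ≤ 1 / q ^ 50

lemma ev_Sc : ∀ᶠ T : ℝ in atTop, Sc T (T ^ (1/1000000:ℝ)) (T ^ (1/4:ℝ)) := by
  have h1 : ∀ᶠ T : ℝ in atTop, Real.log T ≤ (1/2) * T ^ (1/1000000:ℝ) := by
    have := (isLittleO_log_rpow_atTop (show (0:ℝ) < 1/1000000 by norm_num)).bound (show (0:ℝ) < 1/2 by norm_num)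
    filter_upwards [this, eventually_ge_atTop 1] with T hT h1
    rw [Real.norm_eq_abs, Real.norm_eq_abs, abs_of_nonneg (show 0 ≤ T ^ (1/1000000:ℝ) by positivity)] at hT
    exact (le_abs_self _).trans hT
  have h2 : ∀ᶠ T : ℝ in atTop, 100 ≤ T ^ (1/1000000:ℝ) :=
    (tendsto_rpow_atTop (show (0:ℝ) < 1/1000000 by norm_num)).eventually_ge_atTop 100
  filter_upwards [h1, h2, Real.tendsto_log_atTop.eventually_ge_atTop 100, eventually_ge_atTop 1] with T h1 h2 h3 h4
  have hT0 : 0 < T := by linarith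
  have hs : 0 < T ^ (1/4:ℝ) := by positivity
  have hp : ∀ (a : ℝ) (n : ℕ), (T ^ a) ^ n = T ^ (a * n) := fun a n => by
    rw [Real.rpow_mul hT0.le, Real.rpow_natCast]
  have hT4 : T = (T ^ (1/4:ℝ)) ^ 4 := by rw [hp]; norm_num
  have hl : Real.log (2 * Real.pi) ≤ 4 * Real.log 2 := by
    have : (4:ℝ) * Real.log 2 = Real.log (2 ^ 4) := by rw [Real.log_pow]; norm_num
    rw [this]
    apply Real.log_le_log (by positivity)
    have := Real.pi_lt_four; linarith
  have hl0 : 0 ≤ Real.log (2 * Real.pi) := Real.log_nonneg (by have := Real.pi_gt_three; linarith)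
  have hl2 := Real.log_two_lt_d9
  have hLg : Lg T = 1 / 2 * Real.log T - 1 / 2 * Real.log (2 * Real.pi) := by
    unfold Lg; rw [Real.log_div (by positivity) (by positivity)]; ring
  have hls : Real.log (T ^ (1/4:ℝ)) = 1 / 4 * Real.log T := Real.log_rpow hT0 _
  refine ⟨hs, h2, hT4, ?_, ?_, ?_, ?_, by linarith, h3, by rw [hLg]; linarith, ?_, ?_, ?_⟩
  · rw [hp]; norm_num
  · rw [hp, one_div, ← Real.rpow_neg hT0.le, eta]; norm_num
  · rw [hp, hp, ← Real.rpow_add hT0, UU]; norm_num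
  · rw [hp]; apply Real.rpow_le_rpow_of_exponent_le h4; norm_num
  · rw [hLg, le_div_iff₀ hs]
    calc _ = Real.exp (Real.log (2 * Real.pi) / 4) := by
          conv_lhs => rw [← Real.exp_log hs, hls, ← Real.exp_add]
          congr 1; ring
      _ ≤ Real.exp (Real.log 2) := Real.exp_le_exp.2 (by linarith)
      _ = 2 := Real.exp_log (by norm_num)
  · rw [hLg, ← Real.exp_log (show 0 < (T ^ (1/4:ℝ)) ^ 2 by positivity), Real.log_pow, hls]
    apply Real.exp_le_exp.2
    push_cast; linarith
  · rw [hp, one_div (T ^ _), ← Real.rpow_neg hT0.le]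
    apply Real.rpow_le_rpow_of_exponent_le h4; norm_num

noncomputable def MM (T : ℝ) : ℕ := ⌊Real.exp (Lg T - eta T)⌋₊
noncomputable def DD (T t : ℝ) : ℝ := HardyZ t - 2 * (G t * SX (MM T) t).re

lemma continuous_SX (X : ℕ) : Continuous (SX X) := by
  unfold SX
  refine continuous_finsetSum _ fun n hn => ?_
  have hn0 : (n : ℂ) ≠ 0 := by have := (Finset.mem_Icc.mp hn).1; exact_mod_cast (by omega : n ≠ 0)
  refine Continuous.const_cpow (by fun_prop) (Or.inl hn0)

lemma continuous_DD (T : ℝ) : Continuous (DD T) := by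
  unfold DD
  have h1 := continuous_HardyZ
  have h2 := continuous_G
  have h3 := continuous_SX (MM T)
  have h4 : Continuous fun t => (G t * SX (MM T) t).re := Complex.continuous_re.comp (h2.mul h3)
  fun_prop

lemma sum_recip_log (a b : ℕ) (ha : 1 ≤ a) (hab : a ≤ b) : ∑ n ∈ Finset.Ioc a b, 1 / (n:ℝ) ≤ Real.log b - Real.log a := by
  induction b, hab using Nat.le_induction with
  | base => simp
  | succ b hab ih =>
    rw [← Finset.insert_Ioc_right_eq_Ioc_add_one hab, Finset.sum_insert (by simp)]
    have hb : (0:ℝ) < b := by exact_mod_cast (by omega : 0 < b)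
    have h1 := Real.one_sub_inv_le_log_of_pos (show (0:ℝ) < ((b+1:ℕ):ℝ) / b by positivity)
    rw [Real.log_div (by positivity) (by positivity)] at h1
    have h2 : 1 - (((b+1:ℕ):ℝ) / b)⁻¹ = 1 / ((b+1:ℕ):ℝ) := by push_cast; field_simp; ring
    linarith

lemma term_eq (n : ℕ) (hn : 1 ≤ n) (t : ℝ) : (n : ℂ) ^ (-(1 / 2 + I * t : ℂ)) = (((n:ℝ) ^ (-(1/2):ℝ) : ℝ) : ℂ) * en n t := by
  have := term_split n hn 0 t
  rw [zero_add] at this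
  rw [this, en]
  congr 1
  rw [Complex.ofReal_cpow (by positivity)]
  push_cast; congr 1; ring

lemma MM_facts {T q s : ℝ} (h : Sc T q s) : 1 ≤ MM T ∧ (MM T : ℝ) ≤ s ^ 2 ∧ Lg T - eta T - 2 * (2 / s) ≤ Real.log (MM T) ∧ Real.log (MM T) ≤ Lg T - eta T ∧ 0 < eta T ∧ eta T ≤ 1 / 100 := by
  have hq := h.hq
  have he0 : 0 < eta T := by rw [h.he]; positivity
  have he1 : eta T ≤ 1 / 100 := by
    rw [h.he]; apply one_div_le_one_div_of_le (by norm_num)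
    exact hq.trans (le_self_pow₀ (by linarith) (by norm_num))
  have hL : 25 ≤ Lg T := by linarith [h.hL, h.hlog1]
  set X := Real.exp (Lg T - eta T) with hX
  have hX1 : Real.exp (Lg T / 2) ≤ X := Real.exp_le_exp.2 (by linarith)
  have hX2 : 2 ≤ Real.exp (Lg T / 2) := by have := Real.add_one_le_exp (Lg T / 2); linarith
  have hM : MM T = ⌊X⌋₊ := rfl
  have h1 : 1 ≤ MM T := by rw [hM, Nat.one_le_floor_iff]; linarith
  have hM0 : (0:ℝ) < MM T := by exact_mod_cast h1
  have h2 : (MM T:ℝ) ≤ X := by rw [hM]; exact Nat.floor_le (by positivity)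
  have h3 : X < MM T + 1 := by rw [hM]; exact Nat.lt_floor_add_one _
  have h4 := Real.log_le_log hM0 h2
  rw [hX, Real.log_exp] at h4
  refine ⟨h1, ?_, ?_, h4, he0, he1⟩
  · refine h2.trans (le_trans (Real.exp_le_exp.2 (by linarith)) h.hexp1)
  · have h5 : Real.log ((MM T:ℝ)+1) = Real.log (MM T) + Real.log (1 + 1 / MM T) := by
      rw [← Real.log_mul (by positivity) (by positivity)]; congr 1; field_simp
    have h6 := Real.log_le_sub_one_of_pos (show (0:ℝ) < 1 + 1 / MM T by positivity)
    have h7 := Real.log_le_log (by positivity) h3.le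
    rw [hX, Real.log_exp, h5] at h7
    have h8 : 1 / (MM T:ℝ) ≤ 2 * Real.exp (-(Lg T/2)) := by
      rw [Real.exp_neg, div_le_iff₀ hM0, ← div_eq_mul_inv, div_mul_eq_mul_div, le_div_iff₀ (by positivity)]
      linarith
    have := h.hexp
    linarith

lemma D_bound : ∃ C > 0, ∀ᶠ T : ℝ in atTop, ∫ t in T..(T + 2 * UU T), (DD T t) ^ 2 ≤ C * (UU T * eta T) := by
  obtain ⟨C, hC, h⟩ := prop_A
  refine ⟨48 + 96 + 4 * C ^ 2, by positivity, ?_⟩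
  filter_upwards [h, ev_Sc] with T ⟨w, hw, hw1, hw0, hZ⟩ hsc
  obtain ⟨hM1, hMs, hMl, hMu, he0, he1⟩ := MM_facts hsc
  set q := T ^ (1/1000000:ℝ)
  set s := T ^ (1/4:ℝ)
  have hq := hsc.hq
  have hs := hsc.hs
  have hq1 : 1 ≤ q := by linarith
  set K := ⌊T ^ (1/2:ℝ)⌋₊ with hK
  have hKs : (K:ℝ) ≤ s ^ 2 := by rw [hK, hsc.hr]; exact Nat.floor_le (by positivity)
  have hMK : MM T ≤ K := by
    rw [hK, hsc.hr]; exact Nat.le_floor hMs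
  have hU0 : 0 < UU T := by rw [hsc.hU]; positivity
  set c : ℕ → ℂ := fun n => if n ≤ MM T then 0 else ((w n * (n:ℝ) ^ (-(1/2):ℝ) : ℝ) : ℂ) with hc
  have hcn : ∀ n ∈ Finset.Icc 1 K, ‖c n‖ ≤ 1 * (n:ℝ) ^ (-(1/2):ℝ) := by
    intro n hn
    simp only [hc]
    split_ifs
    · simp; positivity
    · rw [Complex.norm_real, Real.norm_eq_abs, abs_of_nonneg (mul_nonneg (hw n).1 (by positivity))]
      gcongr; exact (hw n).2
  set R : ℝ → ℂ := fun t => ∑ n ∈ Finset.Icc 1 K, c n * en n t with hR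
  have hRc : Continuous R := continuous_finsetSum _ fun n _ => continuous_const.mul (continuous_en n)
  have hsplit : ∀ t : ℝ, ∑ n ∈ Finset.Icc 1 K, (w n : ℂ) * (n : ℂ) ^ (-(1 / 2 + I * t : ℂ)) = SX (MM T) t + R t := by
    intro t
    have e0 : SX (MM T) t = ∑ n ∈ Finset.Icc 1 K, if n ≤ MM T then (n : ℂ) ^ (-(1 / 2 + I * t : ℂ)) else 0 := by
      unfold SX
      rw [← Finset.sum_filter]
      congr 1; ext n; simp only [Finset.mem_filter, Finset.mem_Icc]; omega
    rw [e0, hR, ← Finset.sum_add_distrib]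
    refine Finset.sum_congr rfl fun n hn => ?_
    have hn1 := (Finset.mem_Icc.mp hn).1
    have hn0 : (0:ℝ) < n := by exact_mod_cast hn1
    simp only [hc]
    split_ifs with hnM
    · have hlog : Real.log n ≤ Real.log (MM T) := Real.log_le_log hn0 (by exact_mod_cast hnM)
      rw [hw1 n hn1 (by linarith)]; simp
    · rw [term_eq n hn1]; push_cast; ring
  have hD : ∀ t ∈ Set.Icc T (T + 2 * UU T), (DD T t) ^ 2 ≤ 8 * ‖R t‖ ^ 2 + 2 * C ^ 2 * eta T := by
    intro t ht
    have h1 := hZ t ht.1 ht.2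
    rw [hsplit t, mul_add, Complex.add_re] at h1
    have h2 : |(G t * R t).re| ≤ ‖R t‖ := by
      refine (Complex.abs_re_le_norm _).trans ?_
      rw [norm_mul, norm_G, one_mul]
    have h3 : C * T ^ (-(1/10):ℝ) ≤ C * eta T := by
      have := hsc.h10; rw [← hsc.he] at this; gcongr
    have h4 : |DD T t| ≤ 2 * ‖R t‖ + C * eta T := by
      have : DD T t = (HardyZ t - 2 * ((G t * SX (MM T) t).re + (G t * R t).re)) + 2 * (G t * R t).re := by
        unfold DD; ring
      rw [this]
      refine (abs_add_le _ _).trans ?_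
      rw [abs_mul, abs_two]
      linarith
    have h5 : (DD T t) ^ 2 ≤ (2 * ‖R t‖ + C * eta T) ^ 2 := by
      rw [← sq_abs]; exact pow_le_pow_left₀ (abs_nonneg _) h4 2
    have h6 : (2 * ‖R t‖ + C * eta T) ^ 2 ≤ 8 * ‖R t‖ ^ 2 + 2 * C ^ 2 * (eta T) ^ 2 := by
      nlinarith [sq_nonneg (2 * ‖R t‖ - C * eta T)]
    have h7 : 2 * C ^ 2 * (eta T) ^ 2 ≤ 2 * C ^ 2 * eta T := by
      have : (eta T) ^ 2 ≤ eta T := by rw [pow_two]; exact mul_le_of_le_one_left he0.le (by linarith)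
      gcongr
    linarith
  have hIntg : ∫ t in T..(T + 2 * UU T), (DD T t) ^ 2 ≤ ∫ t in T..(T + 2 * UU T), (8 * ‖R t‖ ^ 2 + 2 * C ^ 2 * eta T) := by
    apply intervalIntegral.integral_mono_on (by linarith)
    · exact ((continuous_DD T).pow 2).intervalIntegrable _ _
    · apply Continuous.intervalIntegrable; fun_prop
    · exact hD
  have hcont : Continuous fun t => 8 * ‖R t‖ ^ 2 := by fun_prop
  rw [intervalIntegral.integral_add (hcont.intervalIntegrable _ _) (by simp), intervalIntegral.integral_const_mul, intervalIntegral.integral_const, smul_eq_mul] at hIntg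
  have hmv := mean_value K c 1 zero_le_one hcn T (T + 2 * UU T)
  have hsum : ∑ n ∈ Finset.Icc 1 K, ‖c n‖ ^ 2 ≤ 3 * eta T := by
    set J := ⌊Real.exp (Lg T + eta T)⌋₊ with hJ
    have hMJ : MM T ≤ J := Nat.floor_mono (Real.exp_le_exp.2 (by linarith))
    have hJ0 : (0:ℝ) < J := by exact_mod_cast (by omega : 0 < J)
    have hJl : Real.log J ≤ Lg T + eta T := by
      have : (J:ℝ) ≤ Real.exp (Lg T + eta T) := Nat.floor_le (by positivity)
      have := Real.log_le_log hJ0 this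
      rwa [Real.log_exp] at this
    have h1 : ∑ n ∈ Finset.Icc 1 K, ‖c n‖ ^ 2 ≤ ∑ n ∈ Finset.Ioc (MM T) J, 1 / (n:ℝ) := by
      have e1 : ∀ n ∈ Finset.Icc 1 K, ‖c n‖ ^ 2 ≤ if n ∈ Finset.Ioc (MM T) J then 1 / (n:ℝ) else 0 := by
        intro n hn
        have hn1 := (Finset.mem_Icc.mp hn).1
        have hn0 : (0:ℝ) < n := by exact_mod_cast hn1
        have hsq : ((n:ℝ) ^ (-(1/2):ℝ)) ^ 2 = 1 / n := by
          rw [← Real.rpow_natCast, ← Real.rpow_mul hn0.le]; norm_num [Real.rpow_neg_one]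
        split_ifs with hmem
        · rw [← hsq]
          apply pow_le_pow_left₀ (norm_nonneg _)
          simpa using hcn n hn
        · simp only [hc]
          split_ifs with hnM
          · simp
          · have hnJ : J < n := by
              rw [Finset.mem_Ioc] at hmem; omega
            have h2 : Real.exp (Lg T + eta T) < n := (Nat.floor_lt (by positivity)).1 hnJ
            have h3 := Real.log_le_log (by positivity) h2.le
            rw [Real.log_exp] at h3
            rw [hw0 n (by linarith)]; simp
      refine (Finset.sum_le_sum e1).trans ?_
      rw [← Finset.sum_filter]
      apply Finset.sum_le_sum_of_subset_of_nonneg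
      · intro n hn; exact (Finset.mem_filter.mp hn).2
      · intro n _ _; positivity
    have h2 := sum_recip_log (MM T) J hM1 hMJ
    have h3 : 2 * (2 / s) ≤ eta T := by
      rw [hsc.he, ← mul_div_assoc, div_le_div_iff₀ hs (by positivity)]
      have : q ^ 51 ≤ q ^ 1000 := pow_le_pow_right₀ hq1 (by norm_num)
      have h4 : 4 * q ^ 50 ≤ q ^ 51 := by rw [pow_succ q 50]; rw [mul_comm]; gcongr; linarith
      linarith [hsc.hqs]
    linarith
  have hKlog : (K:ℝ) * (1 + Real.log K) ≤ UU T * eta T := by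
    rw [hsc.hU, hsc.he]
    have hK1 : 1 ≤ K := hM1.trans hMK
    have hK0 : (0:ℝ) < K := by exact_mod_cast hK1
    have h1 : Real.log K ≤ Real.log T := by
      apply Real.log_le_log hK0
      have hs1 : 1 ≤ s := le_trans (one_le_pow₀ hq1) hsc.hqs
      have : s ^ 2 ≤ s ^ 4 := pow_le_pow_right₀ hs1 (by norm_num)
      rw [hsc.hT]; linarith
    have h2 : 1 + Real.log K ≤ q ^ 50 := by
      have := hsc.hlog
      have h3 : q ≤ q ^ 50 := le_self_pow₀ hq1 (by norm_num)
      linarith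
    calc (K:ℝ) * (1 + Real.log K) ≤ s ^ 2 * q ^ 50 := by
          apply mul_le_mul hKs h2 _ (by positivity)
          have := Real.log_nonneg (show (1:ℝ) ≤ K by exact_mod_cast hK1)
          linarith
      _ = _ := by
          field_simp
  have hmv2 := (abs_le.1 hmv).2
  have h1 : (T + 2 * UU T - T) * ∑ n ∈ Finset.Icc 1 K, ‖c n‖ ^ 2 ≤ 6 * (UU T * eta T) := by
    rw [add_sub_cancel_left]
    calc _ ≤ (2 * UU T) * (3 * eta T) := by gcongr
      _ = _ := by ring
  have h2 : (T + 2 * UU T - T) * (2 * C ^ 2 * eta T) = 4 * C ^ 2 * (UU T * eta T) := by ring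
  rw [h2] at hIntg
  linarith
end HL
end

section
open Complex Filter Topology MeasureTheory
namespace HL

lemma cs_int (f : ℝ → ℝ) (hf : Continuous f) (H : ℝ) (hH : 0 < H) : (∫ v in (0:ℝ)..H, f v) ^ 2 ≤ H * ∫ v in (0:ℝ)..H, (f v) ^ 2 := by
  set J := ∫ v in (0:ℝ)..H, f v with hJ
  have h0 : 0 ≤ ∫ v in (0:ℝ)..H, (f v - J / H) ^ 2 := intervalIntegral.integral_nonneg hH.le fun v _ => sq_nonneg _
  have h1 : ∫ v in (0:ℝ)..H, (f v - J / H) ^ 2 = (∫ v in (0:ℝ)..H, (f v) ^ 2) - (2 * (J / H)) * J + H * (J / H) ^ 2 := by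
    have : ∀ v, (f v - J / H) ^ 2 = ((f v) ^ 2 - (2 * (J / H)) * f v) + (J / H) ^ 2 := fun v => by ring
    simp_rw [this]
    rw [intervalIntegral.integral_add (by apply Continuous.intervalIntegrable; fun_prop) (by simp),
      intervalIntegral.integral_sub (by apply Continuous.intervalIntegrable; fun_prop) (by apply Continuous.intervalIntegrable; fun_prop),
      intervalIntegral.integral_const_mul, intervalIntegral.integral_const]
    simp
    left; exact hJ.symm
  rw [h1] at h0
  have h2 : (∫ v in (0:ℝ)..H, (f v) ^ 2) - (2 * (J / H)) * J + H * (J / H) ^ 2 = (∫ v in (0:ℝ)..H, (f v) ^ 2) - J ^ 2 / H := by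
    field_simp; ring
  rw [h2, sub_nonneg, div_le_iff₀ hH] at h0
  linarith

lemma fub (f : ℝ → ℝ) (hf : Continuous f) (H a U : ℝ) (hH : 0 < H) (hHU : H ≤ U) :
    ∫ t in a..(a + U), (∫ v in (0:ℝ)..H, f (t + v)) ^ 2 ≤ H ^ 2 * ∫ t in a..(a + 2 * U), (f t) ^ 2 := by
  have hU : 0 < U := by linarith
  have hc2 : Continuous (Function.uncurry fun t v => (f (t + v)) ^ 2) := by
    unfold Function.uncurry; fun_prop
  have hc1 : Continuous (Function.uncurry fun t v => (f (t + v))) := by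
    unfold Function.uncurry; fun_prop
  have hg1 : Continuous fun t => ∫ v in (0:ℝ)..H, f (t + v) :=
    intervalIntegral.continuous_parametric_intervalIntegral_of_continuous' hc1 _ _
  have hg2 : Continuous fun t => ∫ v in (0:ℝ)..H, (f (t + v)) ^ 2 :=
    intervalIntegral.continuous_parametric_intervalIntegral_of_continuous' hc2 _ _
  calc _ ≤ ∫ t in a..(a + U), H * ∫ v in (0:ℝ)..H, (f (t + v)) ^ 2 := by
        apply intervalIntegral.integral_mono_on (by linarith)
        · exact (hg1.pow 2).intervalIntegrable _ _
        · exact (continuous_const.mul hg2).intervalIntegrable _ _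
        · intro t _
          exact cs_int (fun v => f (t + v)) (by fun_prop) H hH
    _ = H * ∫ v in (0:ℝ)..H, ∫ t in a..(a + U), (f (t + v)) ^ 2 := by
        rw [intervalIntegral.integral_const_mul, intervalIntegral_intervalIntegral_swap]
        have : IntegrableOn (Function.uncurry fun t v => (f (t + v)) ^ 2) (Set.Icc a (a+U) ×ˢ Set.Icc 0 H) := 
          hc2.continuousOn.integrableOn_compact (isCompact_Icc.prod isCompact_Icc)
        refine this.mono_set ?_
        rw [Set.uIoc_of_le (by linarith), Set.uIoc_of_le hH.le]
        exact Set.prod_mono Set.Ioc_subset_Icc_self Set.Ioc_subset_Icc_self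
    _ ≤ H * ∫ v in (0:ℝ)..H, ∫ t in a..(a + 2 * U), (f t) ^ 2 := by
        gcongr
        apply intervalIntegral.integral_mono_on hH.le
        · apply Continuous.intervalIntegrable
          apply intervalIntegral.continuous_parametric_intervalIntegral_of_continuous'
          unfold Function.uncurry; fun_prop
        · simp
        · intro v hv
          rw [intervalIntegral.integral_comp_add_right (fun t => (f t) ^ 2)]
          apply intervalIntegral.integral_mono_interval
          · linarith [hv.1]
          · linarith
          · linarith [hv.2]
          · exact Eventually.of_forall fun t => sq_nonneg _
          · apply Continuous.intervalIntegrable; fun_prop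
    _ = _ := by
        rw [intervalIntegral.integral_const, smul_eq_mul, sub_zero]; ring

noncomputable def cc (H T : ℝ) (n : ℕ) : ℂ := (((n:ℝ) ^ (-(1/2):ℝ) : ℝ) : ℂ) * ck H (Lg T - Real.log n)
noncomputable def AA (H T t : ℝ) : ℂ := ∑ n ∈ Finset.Icc 1 (MM T), cc H T n * en n t
noncomputable def F1 (H T t : ℝ) : ℝ := 2 * (G t * AA H T t).re

lemma continuous_AA (H T : ℝ) : Continuous (AA H T) :=
  continuous_finsetSum _ fun n _ => continuous_const.mul (continuous_en n)
lemma continuous_F1 (H T : ℝ) : Continuous (F1 H T) := by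
  unfold F1
  exact continuous_const.mul (Complex.continuous_re.comp (continuous_G.mul (continuous_AA H T)))

lemma AA_eq (H T t : ℝ) : AA H T t = ∫ v in (0:ℝ)..H, Complex.exp (I * (v * Lg T)) * SX (MM T) (t + v) := by
  unfold AA SX
  simp_rw [Finset.mul_sum]
  rw [intervalIntegral.integral_finsetSum]
  · refine Finset.sum_congr rfl fun n hn => ?_
    have hn1 := (Finset.mem_Icc.mp hn).1
    have : ∀ v : ℝ, Complex.exp (I * (v * Lg T)) * (n:ℂ) ^ (-(1 / 2 + I * ((t + v : ℝ) : ℂ) : ℂ)) = ((((n:ℝ) ^ (-(1/2):ℝ) : ℝ) : ℂ) * en n t) * Complex.exp (I * (v * ((Lg T - Real.log n : ℝ) : ℂ))) := by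
      intro v
      rw [term_split n hn1, term_eq n hn1, mul_left_comm, ← Complex.exp_add]
      congr 2; push_cast; ring
    simp_rw [this]
    rw [intervalIntegral.integral_const_mul, cc, ck]; ring
  · intro n hn
    have hn1 := (Finset.mem_Icc.mp hn).1
    have hn0 : (n : ℂ) ≠ 0 := by exact_mod_cast (by omega : n ≠ 0)
    apply Continuous.intervalIntegrable
    refine Continuous.mul (by fun_prop) (Continuous.const_cpow (by fun_prop) (Or.inl hn0))

lemma e_eq (H T t : ℝ) : (∫ u in t..(t+H), HardyZ u) - F1 H T t = (∫ v in (0:ℝ)..H, DD T (t + v)) +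
    2 * (∫ v in (0:ℝ)..H, (G (t + v) - G t * Complex.exp (I * (v * Lg T))) * SX (MM T) (t + v)).re := by
  have hG := continuous_G
  have hS := continuous_SX (MM T)
  have hD := continuous_DD T
  have h1 : ∫ u in t..(t+H), HardyZ u = ∫ v in (0:ℝ)..H, HardyZ (t + v) := by
    rw [intervalIntegral.integral_comp_add_left (fun u => HardyZ u), add_zero]
  have hc : Continuous fun v : ℝ => G (t + v) * SX (MM T) (t + v) := by fun_prop
  have h2 : ∫ v in (0:ℝ)..H, HardyZ (t + v) = (∫ v in (0:ℝ)..H, DD T (t + v)) + 2 * (∫ v in (0:ℝ)..H, G (t + v) * SX (MM T) (t + v)).re := by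
    have e1 : (∫ v in (0:ℝ)..H, G (t + v) * SX (MM T) (t + v)).re = ∫ v in (0:ℝ)..H, (G (t + v) * SX (MM T) (t + v)).re := by
      have := Complex.reCLM.intervalIntegral_comp_comm (hc.intervalIntegrable (μ := volume) 0 H)
      simpa using this.symm
    rw [e1, ← intervalIntegral.integral_const_mul, ← intervalIntegral.integral_add]
    · congr 1; ext v; unfold DD; ring
    · apply Continuous.intervalIntegrable; fun_prop
    · exact (continuous_const.mul (Complex.continuous_re.comp hc)).intervalIntegrable _ _
  have h3 : G t * AA H T t = ∫ v in (0:ℝ)..H, (G t * Complex.exp (I * (v * Lg T))) * SX (MM T) (t + v) := by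
    rw [AA_eq, ← intervalIntegral.integral_const_mul]
    congr 1; ext v; ring
  rw [h1, h2, F1, h3]
  have h4 : ∫ v in (0:ℝ)..H, (G (t + v) - G t * Complex.exp (I * (v * Lg T))) * SX (MM T) (t + v) = (∫ v in (0:ℝ)..H, G (t + v) * SX (MM T) (t + v)) - ∫ v in (0:ℝ)..H, (G t * Complex.exp (I * (v * Lg T))) * SX (MM T) (t + v) := by
    rw [← intervalIntegral.integral_sub]
    · congr 1; ext v; ring
    · exact hc.intervalIntegrable _ _
    · apply Continuous.intervalIntegrable; fun_prop
  rw [h4, Complex.sub_re]; ring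

lemma G_diff (T U H t v : ℝ) (hT : 8 ≤ T) (hU : U ≤ T / 2) (hH : 0 < H) (hHT : H ≤ T / 2) (ht : T ≤ t) (ht2 : t ≤ T + U) (hv : 0 ≤ v) (hv2 : v ≤ H) :
    ‖G (t + v) - G t * Complex.exp (I * (v * Lg T))‖ ≤ (8 * H + H ^ 2) / T + H * (U / T) := by
  have hT0 : 0 < T := by linarith
  have h1 := G_taylor t v (by linarith) (by rw [abs_of_nonneg hv]; linarith)
  rw [abs_of_nonneg hv] at h1
  have h2 : (8 * v + v ^ 2) / t ≤ (8 * H + H ^ 2) / T := by gcongr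
  have h3 : ‖G t * Complex.exp (I * (Lg t * v)) - G t * Complex.exp (I * (v * Lg T))‖ ≤ H * (U / T) := by
    rw [← mul_sub, norm_mul, norm_G, one_mul]
    have h4 := norm_exp_sub_exp (Lg t * v) (v * Lg T)
    push_cast at h4
    refine h4.trans ?_
    rw [show Lg t * v - v * Lg T = v * (Lg t - Lg T) by ring, abs_mul, abs_of_nonneg hv]
    have h5 := Lg_sub T (t - T) hT0 (by rw [abs_of_nonneg (by linarith)]; linarith)
    rw [add_sub_cancel, abs_of_nonneg (show 0 ≤ t - T by linarith)] at h5
    have h6 : (t - T) / T ≤ U / T := by gcongr; linarith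
    exact mul_le_mul hv2 (h5.trans h6) (abs_nonneg _) hH.le
  calc _ = ‖(G (t + v) - G t * Complex.exp (I * (Lg t * v))) + (G t * Complex.exp (I * (Lg t * v)) - G t * Complex.exp (I * (v * Lg T)))‖ := by congr 1; ring
    _ ≤ _ := (norm_add_le _ _).trans (add_le_add (h1.trans h2) h3)

lemma err2 {T q s : ℝ} (h : Sc T q s) (H t : ℝ) (hH : 0 < H) (hHq : H ≤ q) (ht : T ≤ t) (ht2 : t ≤ T + UU T) :
    ‖∫ v in (0:ℝ)..H, (G (t + v) - G t * Complex.exp (I * (v * Lg T))) * SX (MM T) (t + v)‖ ≤ 1 / q ^ 50 := by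
  have hq := h.hq
  have hs := h.hs
  have hq1 : 1 ≤ q := by linarith
  have hq0 : 0 < q := by linarith
  have hqs := h.hqs
  have hs1 : 1 ≤ s := le_trans (one_le_pow₀ hq1) hqs
  have hqss : q ^ 200 ≤ s := le_trans (pow_le_pow_right₀ hq1 (by norm_num)) hqs
  have hqs1 : q ^ 101 ≤ s := le_trans (pow_le_pow_right₀ hq1 (by norm_num)) hqs
  have h2q : 2 * q ^ 100 ≤ q ^ 101 := by rw [pow_succ q 100, mul_comm]; gcongr; linarith
  have hss : s ≤ s ^ 2 := le_self_pow₀ hs1 (by norm_num)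
  have hUT : UU T ≤ T / 2 := by
    rw [h.hU, h.hT]
    have : s ^ 2 * (2 * q ^ 100) ≤ s ^ 2 * s ^ 2 := by gcongr; linarith
    have e : s ^ 4 = s ^ 2 * s ^ 2 := by ring
    linarith
  have hqU : q ≤ UU T := by
    rw [h.hU]
    calc q ≤ q ^ 100 := le_self_pow₀ hq1 (by norm_num)
      _ ≤ s ^ 2 * q ^ 100 := le_mul_of_one_le_left (by positivity) (one_le_pow₀ hs1)
  have hT8 : 8 ≤ T := by linarith
  have hT0 : 0 < T := by linarith
  obtain ⟨hM1, hMs, -⟩ := MM_facts h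
  have hSn : ∀ u, ‖SX (MM T) u‖ ≤ 2 * s := fun u => by
    refine (norm_SX _ _).trans ?_
    have : (MM T : ℝ) ^ (1/2:ℝ) ≤ (s ^ 2) ^ (1/2:ℝ) := by gcongr
    rw [← Real.sqrt_eq_rpow, ← Real.sqrt_eq_rpow, Real.sqrt_sq hs.le] at this
    rw [← Real.sqrt_eq_rpow]; linarith
  have key := intervalIntegral.norm_integral_le_of_norm_le_const (a := 0) (b := H) (C := ((8 * H + H ^ 2) / T + H * (UU T / T)) * (2 * s))
    (f := fun v : ℝ => (G (t + v) - G t * Complex.exp (I * (v * Lg T))) * SX (MM T) (t + v)) (fun v hv => by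
      rw [Set.uIoc_of_le hH.le] at hv
      rw [norm_mul]
      apply mul_le_mul (G_diff T (UU T) H t v hT8 hUT hH (by linarith) ht ht2 hv.1.le hv.2) (hSn _) (norm_nonneg _)
      have : 0 < UU T := by linarith
      positivity)
  rw [sub_zero, abs_of_pos hH] at key
  refine key.trans ?_
  have hU0 : 0 < UU T := by linarith
  have e1 : 8 * H + H ^ 2 ≤ 9 * q * UU T := by
    have : H ^ 2 ≤ q * UU T := by rw [pow_two]; gcongr; linarith
    have : H ≤ q * UU T := by
      calc H ≤ q := hHq
        _ ≤ q * UU T := le_mul_of_one_le_right hq0.le (by linarith)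
    linarith
  have e2 : (8 * H + H ^ 2) / T + H * (UU T / T) ≤ 10 * q * UU T / T := by
    calc _ ≤ 9 * q * UU T / T + q * (UU T / T) := by gcongr
      _ = _ := by ring
  calc _ ≤ (10 * q * UU T / T) * (2 * s) * q := by gcongr
    _ = 20 * q ^ 102 / s := by rw [h.hU, h.hT]; field_simp; ring
    _ ≤ 1 / q ^ 50 := by
      rw [div_le_div_iff₀ hs (by positivity)]
      have : 20 * q ^ 102 * q ^ 50 = 20 * q ^ 152 := by ring
      rw [this, one_mul]
      have h3 : 20 * q ^ 152 ≤ q ^ 153 := by rw [pow_succ q 152, mul_comm]; gcongr; linarith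
      have h4 : q ^ 153 ≤ q ^ 200 := pow_le_pow_right₀ hq1 (by norm_num)
      linarith
end HL
end

section
open Complex Filter Topology MeasureTheory
namespace HL

lemma continuous_F (H : ℝ) : Continuous fun t => ∫ u in t..(t+H), HardyZ u := by
  have h1 : (fun t => ∫ u in t..(t+H), HardyZ u) = fun t => ∫ v in (0:ℝ)..H, HardyZ (t + v) := by
    ext t
    rw [intervalIntegral.integral_comp_add_left (fun u => HardyZ u), add_zero]
  rw [h1]
  apply intervalIntegral.continuous_parametric_intervalIntegral_of_continuous'
  have := continuous_HardyZ
  unfold Function.uncurry; fun_prop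

lemma e_bound {T q s : ℝ} (h : Sc T q s) (H C : ℝ) (hH : 0 < H) (hHq : H ≤ q) (hC : 0 < C)
    (hD : ∫ t in T..(T + 2 * UU T), (DD T t) ^ 2 ≤ C * (UU T * eta T)) :
    ∫ t in T..(T + UU T), ((∫ u in t..(t+H), HardyZ u) - F1 H T t) ^ 2 ≤ (2 * C + 8) * (UU T / q ^ 48) := by
  have hq := h.hq
  have hs := h.hs
  have hq1 : 1 ≤ q := by linarith
  have hq0 : 0 < q := by linarith
  have hs1 : 1 ≤ s := le_trans (one_le_pow₀ hq1) h.hqs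
  have hqU : q ≤ UU T := by
    rw [h.hU]
    calc q ≤ q ^ 100 := le_self_pow₀ hq1 (by norm_num)
      _ ≤ s ^ 2 * q ^ 100 := le_mul_of_one_le_left (by positivity) (one_le_pow₀ hs1)
  have hU0 : 0 < UU T := by linarith
  have hDc := continuous_DD T
  have hg : Continuous fun t => ∫ v in (0:ℝ)..H, DD T (t + v) := by
    apply intervalIntegral.continuous_parametric_intervalIntegral_of_continuous'
    unfold Function.uncurry; fun_prop
  have h1 : ∫ t in T..(T + UU T), ((∫ u in t..(t+H), HardyZ u) - F1 H T t) ^ 2 ≤ ∫ t in T..(T + UU T), (2 * (∫ v in (0:ℝ)..H, DD T (t + v)) ^ 2 + 8 / q ^ 48) := by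
    apply intervalIntegral.integral_mono_on (by linarith)
    · exact (((continuous_F H).sub (continuous_F1 H T)).pow 2).intervalIntegrable _ _
    · apply Continuous.intervalIntegrable; fun_prop
    · intro t ht
      rw [e_eq]
      have h2 := err2 h H t hH hHq ht.1 ht.2
      set a := ∫ v in (0:ℝ)..H, DD T (t + v)
      set z := ∫ v in (0:ℝ)..H, (G (t + v) - G t * Complex.exp (I * (v * Lg T))) * SX (MM T) (t + v)
      have h3 : |z.re| ≤ 1 / q ^ 50 := (Complex.abs_re_le_norm z).trans h2
      have h4 : z.re ^ 2 ≤ 1 / q ^ 48 := by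
        rw [← sq_abs]
        calc |z.re| ^ 2 ≤ (1 / q ^ 50) ^ 2 := pow_le_pow_left₀ (abs_nonneg _) h3 2
          _ = 1 / q ^ 100 := by rw [div_pow, ← pow_mul]; norm_num
          _ ≤ 1 / q ^ 48 := one_div_le_one_div_of_le (by positivity) (pow_le_pow_right₀ hq1 (by norm_num))
      have h5 : 8 / q ^ 48 = 8 * (1 / q ^ 48) := by ring
      rw [h5]
      nlinarith [sq_nonneg (a - 2 * z.re)]
  have hc : Continuous fun t => 2 * (∫ v in (0:ℝ)..H, DD T (t + v)) ^ 2 := by fun_prop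
  rw [intervalIntegral.integral_add (hc.intervalIntegrable _ _) (by simp), intervalIntegral.integral_const_mul, intervalIntegral.integral_const, smul_eq_mul, add_sub_cancel_left] at h1
  have h2 := fub (DD T) hDc H T (UU T) hH (by linarith)
  have h3 : H ^ 2 * ∫ t in T..(T + 2 * UU T), (DD T t) ^ 2 ≤ C * (UU T / q ^ 48) := by
    calc _ ≤ q ^ 2 * (C * (UU T * eta T)) := by
          apply mul_le_mul (pow_le_pow_left₀ hH.le hHq 2) hD _ (by positivity)
          exact intervalIntegral.integral_nonneg (by linarith) fun t _ => sq_nonneg _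
      _ = _ := by rw [h.he]; field_simp
  have h4 : UU T * (8 / q ^ 48) = 8 * (UU T / q ^ 48) := by ring
  linarith

lemma norm_cc_sq (H T : ℝ) (n : ℕ) (hn : 1 ≤ n) : ‖cc H T n‖ ^ 2 = (1 / (n:ℝ)) * hh H (Lg T - Real.log n) := by
  have hn0 : (0:ℝ) < n := by exact_mod_cast hn
  rw [cc, norm_mul, mul_pow, hh, Complex.norm_real, Real.norm_eq_abs, sq_abs]
  congr 1
  rw [← Real.rpow_natCast, ← Real.rpow_mul hn0.le]; norm_num [Real.rpow_neg_one]

lemma norm_cc (H T : ℝ) (hH : 0 ≤ H) (n : ℕ) : ‖cc H T n‖ ≤ H * (n:ℝ) ^ (-(1/2):ℝ) := by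
  rw [cc, norm_mul, Complex.norm_real, Real.norm_eq_abs, abs_of_nonneg (by positivity), mul_comm]
  gcongr; exact norm_ck_le _ _ hH

lemma F1_sq (H T t : ℝ) : (F1 H T t) ^ 2 = 2 * ‖AA H T t‖ ^ 2 + 2 * (G t ^ 2 * (AA H T t) ^ 2).re := by
  have h1 : ‖AA H T t‖ ^ 2 = ‖G t * AA H T t‖ ^ 2 := by rw [norm_mul, norm_G, one_mul]
  rw [h1, F1, ← mul_pow]
  generalize G t * AA H T t = z
  rw [← Complex.normSq_eq_norm_sq, Complex.normSq_apply, pow_two z, Complex.mul_re]; ring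

lemma F1_bound {T q s : ℝ} (h : Sc T q s) (H : ℝ) (hH : 0 < H) (hHq : H ≤ q) :
    |(∫ t in T..(T + UU T), (F1 H T t) ^ 2) - 2 * Real.pi * H * UU T| ≤ 1000 * (UU T / Real.log T) := by
  have hq := h.hq
  have hs := h.hs
  have hq1 : 1 ≤ q := by linarith
  have hq0 : 0 < q := by linarith
  have hs1 : 1 ≤ s := le_trans (one_le_pow₀ hq1) h.hqs
  have hlog := h.hlog
  have hlog1 := h.hlog1
  have hl0 : 0 < Real.log T := by linarith
  have hU0 : 0 < UU T := by rw [h.hU]; positivity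
  obtain ⟨hM1, hMs, hMl, hMu, he0, he1⟩ := MM_facts h
  set U := UU T with hUd
  set l := Real.log T with hld
  have hT1 : s ^ 2 ≤ T := by rw [h.hT]; exact pow_le_pow_right₀ hs1 (by norm_num)
  have hqq : q ≤ q ^ 1000 := le_self_pow₀ hq1 (by norm_num)
  have hss : s ≤ s ^ 2 := le_self_pow₀ hs1 (by norm_num)
  have hT8 : 8 ≤ T := by linarith [h.hqs]
  have hT0 : 0 < T := by linarith
  have hql : U / q ≤ U / l := by gcongr; linarith
  have hM0 : (0:ℝ) < MM T := by exact_mod_cast hM1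
  have hH2 : H ^ 2 ≤ q ^ 2 := pow_le_pow_left₀ hH.le hHq 2
  have hH3 : H ^ 3 ≤ q ^ 3 := pow_le_pow_left₀ hH.le hHq 3
  -- integral of |A|^2
  have hmv := mean_value (MM T) (cc H T) H hH.le (fun n _ => norm_cc H T hH.le n) T (T + U)
  rw [add_sub_cancel_left] at hmv
  have hmvE : 12 * H ^ 2 * (MM T * (1 + Real.log (MM T))) ≤ 12 * (U / q) := by
    have h1 : 1 + Real.log (MM T) ≤ q := by
      have : Real.log (MM T) ≤ l := Real.log_le_log hM0 (by linarith)
      linarith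
    have h1' : 0 ≤ 1 + Real.log (MM T) := by
      have := Real.log_nonneg (show (1:ℝ) ≤ MM T by exact_mod_cast hM1)
      linarith
    calc _ ≤ 12 * q ^ 2 * (s ^ 2 * q) := by gcongr
      _ = 12 * (s ^ 2 * q ^ 4 / q) := by field_simp
      _ ≤ 12 * (s ^ 2 * q ^ 100 / q) := by
          have : q ^ 4 ≤ q ^ 100 := pow_le_pow_right₀ hq1 (by norm_num)
          gcongr
      _ = _ := by rw [hUd, h.hU]
  have hsum : ∑ n ∈ Finset.Icc 1 (MM T), ‖cc H T n‖ ^ 2 = ∑ n ∈ Finset.Icc 1 (MM T), (1 / (n:ℝ)) * hh H (Lg T - Real.log n) :=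
    Finset.sum_congr rfl fun n hn => norm_cc_sq H T n (Finset.mem_Icc.mp hn).1
  have hms := main_sum H (Lg T) (eta T) hH (by linarith [h.hL]) he0 (by linarith)
  rw [show ⌊Real.exp (Lg T - eta T)⌋₊ = MM T from rfl, ← hsum] at hms
  set Sg := ∑ n ∈ Finset.Icc 1 (MM T), ‖cc H T n‖ ^ 2 with hSg
  have hx := h.hexp
  have hsq : 2 / s ≤ 1 / q ^ 50 := by
    rw [div_le_div_iff₀ hs (by positivity)]
    have h3 : 2 * q ^ 50 ≤ q ^ 51 := by rw [pow_succ q 50, mul_comm]; gcongr; linarith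
    have h4 : q ^ 51 ≤ q ^ 1000 := pow_le_pow_right₀ hq1 (by norm_num)
    linarith [h.hqs]
  have hmE : 40 / Lg T + (H ^ 2 + 2 * H ^ 3) * (2 * Real.exp (-(Lg T/2))) + H ^ 2 * (eta T + 2 * Real.exp (-(Lg T/2))) ≤ 160 / l + 9 / q := by
    have a1 : 40 / Lg T ≤ 160 / l := by
      rw [div_le_div_iff₀ (by linarith [h.hL]) hl0]; linarith [h.hL]
    have a2 : (H ^ 2 + 2 * H ^ 3) * (2 * Real.exp (-(Lg T/2))) ≤ (3 * q ^ 3) * (2 * (1 / q ^ 50)) := by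
      have : q ^ 2 ≤ q ^ 3 := pow_le_pow_right₀ hq1 (by norm_num)
      have : H ^ 2 + 2 * H ^ 3 ≤ 3 * q ^ 3 := by linarith
      have : Real.exp (-(Lg T/2)) ≤ 1 / q ^ 50 := hx.trans hsq
      gcongr
    have a3 : H ^ 2 * (eta T + 2 * Real.exp (-(Lg T/2))) ≤ q ^ 3 * (3 * (1 / q ^ 50)) := by
      have : q ^ 2 ≤ q ^ 3 := pow_le_pow_right₀ hq1 (by norm_num)
      have h5 : Real.exp (-(Lg T/2)) ≤ 1 / q ^ 50 := hx.trans hsq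
      have h6 : eta T + 2 * Real.exp (-(Lg T/2)) ≤ 3 * (1 / q ^ 50) := by rw [h.he]; linarith
      apply mul_le_mul (by linarith) h6 (by positivity) (by positivity)
    have a4 : q ^ 3 * (1 / q ^ 50) ≤ 1 / q := by
      rw [mul_one_div, div_le_div_iff₀ (by positivity) hq0, one_mul, ← pow_succ]
      exact pow_le_pow_right₀ hq1 (by norm_num)
    have a5 : 9 / q = 9 * (1 / q) := by ring
    rw [a5]; linarith
  -- oscillating part
  have hos := osc_sum T (T + U) (eta T) H (MM T) (cc H T) hT8 (by linarith) he0 hH.le (fun n _ => norm_cc H T hH.le n) (fun n hn => by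
    have hn' := Finset.mem_Icc.mp hn
    have hn0 : (0:ℝ) < n := by exact_mod_cast hn'.1
    have : Real.log n ≤ Real.log (MM T) := Real.log_le_log hn0 (by exact_mod_cast hn'.2)
    linarith)
  rw [add_sub_cancel_left] at hos
  have hosE : (4 * H ^ 2 * MM T) * (2 / eta T + (16 / (T * eta T) + 1 / (T * (eta T) ^ 2)) * U) ≤ 76 * (U / q) := by
    have b0 : U / T ≤ eta T := by
      rw [hUd, h.hU, h.he, h.hT, div_le_div_iff₀ (by positivity) (by positivity)]
      have : q ^ 150 ≤ q ^ 1000 := pow_le_pow_right₀ hq1 (by norm_num)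
      have h7 := h.hqs
      calc s ^ 2 * q ^ 100 * q ^ 50 = s ^ 2 * q ^ 150 := by ring
        _ ≤ s ^ 2 * s ^ 2 := by gcongr; linarith
        _ = _ := by ring
    have b1 : (16 / (T * eta T) + 1 / (T * (eta T) ^ 2)) * U = 16 / eta T * (U / T) + 1 / (eta T) ^ 2 * (U / T) := by
      field_simp
    have b2 : 16 / eta T * (U / T) + 1 / (eta T) ^ 2 * (U / T) ≤ 16 / eta T * 1 + 1 / (eta T) ^ 2 * eta T := by
      gcongr; linarith
    have b3 : 1 / (eta T) ^ 2 * eta T = 1 / eta T := by field_simp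
    have b4 : 2 / eta T + (16 / (T * eta T) + 1 / (T * (eta T) ^ 2)) * U ≤ 19 / eta T := by
      rw [b1]
      have : 19 / eta T = 2 / eta T + (16 / eta T * 1 + 1 / eta T) := by ring
      linarith
    calc _ ≤ (4 * q ^ 2 * s ^ 2) * (19 / eta T) := by
          apply mul_le_mul _ b4 (by positivity) (by positivity)
          gcongr
      _ = 76 * (s ^ 2 * q ^ 53 / q) := by rw [h.he]; field_simp; norm_num
      _ ≤ 76 * (s ^ 2 * q ^ 100 / q) := by
          have : q ^ 53 ≤ q ^ 100 := pow_le_pow_right₀ hq1 (by norm_num)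
          gcongr
      _ = _ := by rw [hUd, h.hU]
  have hAc := continuous_AA H T
  have hGc := continuous_G
  have hc2 : Continuous fun t => G t ^ 2 * (AA H T t) ^ 2 := by fun_prop
  have hIntg : ∫ t in T..(T + U), (F1 H T t) ^ 2 = 2 * (∫ t in T..(T + U), ‖AA H T t‖ ^ 2) + 2 * (∫ t in T..(T + U), G t ^ 2 * (AA H T t) ^ 2).re := by
    have e1 : (∫ t in T..(T + U), G t ^ 2 * (AA H T t) ^ 2).re = ∫ t in T..(T + U), (G t ^ 2 * (AA H T t) ^ 2).re := by
      have := Complex.reCLM.intervalIntegral_comp_comm (hc2.intervalIntegrable (μ := volume) T (T + U))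
      simpa using this.symm
    have hc3 : Continuous fun t => 2 * (G t ^ 2 * (AA H T t) ^ 2).re := continuous_const.mul (Complex.continuous_re.comp hc2)
    rw [e1, ← intervalIntegral.integral_const_mul, ← intervalIntegral.integral_const_mul, ← intervalIntegral.integral_add]
    · congr 1; ext t; exact F1_sq H T t
    · apply Continuous.intervalIntegrable; fun_prop
    · exact hc3.intervalIntegrable _ _
  have hos2 : |(∫ t in T..(T + U), G t ^ 2 * (AA H T t) ^ 2).re| ≤ 76 * (U / q) :=
    (Complex.abs_re_le_norm _).trans (hos.trans hosE)
  have hmv2 : |(∫ t in T..(T + U), ‖AA H T t‖ ^ 2) - U * Sg| ≤ 12 * (U / q) := hmv.trans hmvE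
  have hms2 : |U * Sg - U * (Real.pi * H)| ≤ 160 * (U / l) + 9 * (U / q) := by
    rw [← mul_sub, abs_mul, abs_of_pos hU0]
    calc _ ≤ U * (160 / l + 9 / q) := mul_le_mul_of_nonneg_left (hms.trans hmE) hU0.le
      _ = _ := by ring
  rw [hIntg]
  rw [abs_le] at *
  obtain ⟨_, _⟩ := hos2; obtain ⟨_, _⟩ := hmv2; obtain ⟨_, _⟩ := hms2
  have : 0 ≤ U / l := by positivity
  have hr : 2 * Real.pi * H * U = 2 * (U * (Real.pi * H)) := by ring
  rw [hr]
  constructor <;> linarith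

lemma final {T q s : ℝ} (h : Sc T q s) (H C : ℝ) (hH : 0 < H) (hHq : H ≤ q) (hC : 0 < C)
    (hD : ∫ t in T..(T + 2 * UU T), (DD T t) ^ 2 ≤ C * (UU T * eta T)) :
    |(∫ t in T..(T + UU T), (∫ u in t..(t+H), HardyZ u) ^ 2) - 2 * Real.pi * H * UU T| ≤ (4 * C + 3000) * (UU T / Real.log T) := by
  have hq := h.hq
  have hs := h.hs
  have hq1 : 1 ≤ q := by linarith
  have hq0 : 0 < q := by linarith
  have hlog := h.hlog
  have hlog1 := h.hlog1
  have hl0 : 0 < Real.log T := by linarith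
  have hU0 : 0 < UU T := by rw [h.hU]; positivity
  have h1 := F1_bound h H hH hHq
  have h2 := e_bound h H C hH hHq hC hD
  set U := UU T with hUd
  set l := Real.log T with hld
  have hql : U / q ≤ U / l := by gcongr; linarith
  set F : ℝ → ℝ := fun t => ∫ u in t..(t+H), HardyZ u with hF
  have hFc : Continuous F := continuous_F H
  have hF1c := continuous_F1 H T
  set I1 := ∫ t in T..(T + U), (F1 H T t) ^ 2 with hI1
  set I2 := ∫ t in T..(T + U), (F t - F1 H T t) ^ 2 with hI2
  have hI2' : I2 ≤ (2 * C + 8) * (U / q ^ 48) := h2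
  have hI20 : 0 ≤ I2 := intervalIntegral.integral_nonneg (by linarith) fun t _ => sq_nonneg _
  have hI10 : 0 ≤ I1 := intervalIntegral.integral_nonneg (by linarith) fun t _ => sq_nonneg _
  have e1 : (∫ t in T..(T + U), (F t) ^ 2) - I1 = ∫ t in T..(T + U), ((F t) ^ 2 - (F1 H T t) ^ 2) := by
    rw [intervalIntegral.integral_sub]
    · apply Continuous.intervalIntegrable; fun_prop
    · apply Continuous.intervalIntegrable; fun_prop
  have e2 : ‖∫ t in T..(T + U), ((F t) ^ 2 - (F1 H T t) ^ 2)‖ ≤ ∫ t in T..(T + U), (1 / q ^ 3 * (F1 H T t) ^ 2 + 2 * q ^ 3 * (F t - F1 H T t) ^ 2) := by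
    apply intervalIntegral.norm_integral_le_of_norm_le (by linarith)
    · refine Eventually.of_forall fun t _ => ?_
      set x := F1 H T t
      set y := F t - x with hy
      have hFy : F t = x + y := by rw [hy]; ring
      rw [hFy, Real.norm_eq_abs]
      have a1 : 1 ≤ q ^ 3 := one_le_pow₀ hq1
      set p := q ^ 3
      have a2 : 0 < p := by linarith
      have a3 : |(x + y) ^ 2 - x ^ 2| ≤ 2 * (|x| * |y|) + y ^ 2 := by
        rw [show (x + y) ^ 2 - x ^ 2 = 2 * (x * y) + y ^ 2 by ring]
        refine (abs_add_le _ _).trans ?_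
        rw [abs_mul, abs_two, abs_mul, abs_of_nonneg (sq_nonneg y)]
      have a4 : 2 * (|x| * |y|) ≤ 1 / p * x ^ 2 + p * y ^ 2 := by
        have := sq_nonneg (|x| - p * |y|)
        have a5 : (|x| - p * |y|) ^ 2 = x ^ 2 - p * (2 * (|x| * |y|)) + p ^ 2 * y ^ 2 := by
          rw [← sq_abs x, ← sq_abs y]; ring
        rw [a5] at this
        have a6 : 1 / p * x ^ 2 + p * y ^ 2 - 2 * (|x| * |y|) = (x ^ 2 - p * (2 * (|x| * |y|)) + p ^ 2 * y ^ 2) / p := by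
          field_simp; ring
        have a7 : 0 ≤ 1 / p * x ^ 2 + p * y ^ 2 - 2 * (|x| * |y|) := by rw [a6]; positivity
        linarith
      have a8 : y ^ 2 ≤ p * y ^ 2 := le_mul_of_one_le_left (sq_nonneg y) a1
      linarith
    · apply Continuous.intervalIntegrable; fun_prop
  rw [← e1, intervalIntegral.integral_add (by apply Continuous.intervalIntegrable; fun_prop) (by apply Continuous.intervalIntegrable; fun_prop),
    intervalIntegral.integral_const_mul, intervalIntegral.integral_const_mul, ← hI1, ← hI2, Real.norm_eq_abs] at e2
  have e3 : 1 / q ^ 3 * I1 ≤ 1008 * (U / l) := by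
    have b1 : I1 ≤ 2 * Real.pi * H * U + 1000 * (U / l) := by have := (abs_le.1 h1).2; linarith
    have b2 : 2 * Real.pi * H * U ≤ 8 * q * U := by
      have := Real.pi_lt_four
      gcongr; linarith
    have b3 : 1 / q ^ 3 * (8 * q * U) ≤ 8 * (U / q) := by
      have : 1 / q ^ 3 * (8 * q * U) = 8 * (U / q ^ 2) := by field_simp
      rw [this]
      have : q ≤ q ^ 2 := le_self_pow₀ hq1 (by norm_num)
      gcongr
    have b4 : 1 / q ^ 3 * (1000 * (U / l)) ≤ 1000 * (U / l) := by
      apply mul_le_of_le_one_left (by positivity)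
      rw [div_le_one (by positivity)]; exact one_le_pow₀ hq1
    have b5 : 1 / q ^ 3 * I1 ≤ 1 / q ^ 3 * (8 * q * U + 1000 * (U / l)) := by gcongr; linarith
    rw [mul_add] at b5
    linarith
  have e4 : 2 * q ^ 3 * I2 ≤ (4 * C + 16) * (U / l) := by
    calc 2 * q ^ 3 * I2 ≤ 2 * q ^ 3 * ((2 * C + 8) * (U / q ^ 48)) := by gcongr
      _ = (4 * C + 16) * (U / q ^ 45) := by field_simp; ring
      _ ≤ (4 * C + 16) * (U / q) := by
          have : q ≤ q ^ 45 := le_self_pow₀ hq1 (by norm_num)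
          gcongr
      _ ≤ _ := by gcongr
  have e5 : |(∫ t in T..(T + U), (F t) ^ 2) - 2 * Real.pi * H * U| ≤ |(∫ t in T..(T + U), (F t) ^ 2) - I1| + |I1 - 2 * Real.pi * H * U| := abs_sub_le _ _ _
  have : 0 ≤ U / l := by positivity
  have hr : (4 * C + 3000) * (U / l) = (4 * C + 16) * (U / l) + 2984 * (U / l) := by ring
  rw [hr]
  linarith
end HL
end

theorem hardy_littlewood_formula :
    ∃ C > (0 : ℝ), ∃ T₀ > (0 : ℝ), ∀ T ≥ T₀, ∀ H : ℝ,
      Real.log (Real.log T) / Real.log T < H → H < T ^ (1 / Real.log (Real.log T)) →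
      |(∫ t in T..(T + T ^ (0.5001 : ℝ)),
          (∫ u in t..(t + H), HardyZ u) ^ 2) - 2 * Real.pi * H * T ^ (0.5001 : ℝ)| ≤
        C * T ^ (0.5001 : ℝ) / Real.log T := by
  obtain ⟨C, hC, hD⟩ := HL.D_bound
  have hll : ∀ᶠ T : ℝ in Filter.atTop, 1000000 ≤ Real.log (Real.log T) :=
    (Real.tendsto_log_atTop.comp Real.tendsto_log_atTop).eventually_ge_atTop 1000000
  obtain ⟨T₁, hT₁⟩ := Filter.eventually_atTop.1 ((hD.and HL.ev_Sc).and hll)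
  refine ⟨4 * C + 3000, by positivity, max T₁ 1, by positivity, ?_⟩
  intro T hT H hH1 hH2
  obtain ⟨⟨hDT, hsc⟩, hllT⟩ := hT₁ T ((le_max_left _ _).trans hT)
  have hT1 : 1 ≤ T := (le_max_right _ _).trans hT
  have hl := hsc.hlog1
  have hH0 : 0 < H := lt_trans (div_pos (by linarith) (by linarith)) hH1
  have hHq : H ≤ T ^ (1/1000000:ℝ) := by
    refine hH2.le.trans (Real.rpow_le_rpow_of_exponent_le hT1 ?_)
    exact one_div_le_one_div_of_le (by norm_num) hllT
  have := HL.final hsc H C hH0 hHq hC hDT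
  rw [mul_div_assoc]
  exact this
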